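/- When ordered by absolute discriminant, the average size of the 3-torsion subgroup Cl(K)[3] of the ideal class group, as K ranges over imaginary quadratic fields, equals 2, and as K ranges over real quadratic fields, equals 4/3. That is, lim_{X→∞} (∑_{K imaginary quadratic, |d_K|<X} |Cl(K)[3]|) / #{K imaginary quadratic : |d_K|<X} = 2, and the analogous limit over real quadratic fields equals 4/3. -/

import Mathlib

open IntermediateField NumberField Filter Asymptotics
open scoped nonZeroDivisors

/-- A square root of `d` in `ℂ`. -/
noncomputable def sqrtD (d : ℤ) : ℂ :=
  if 0 ≤ d then ((Real.sqrt d : ℝ) : ℂ) else Complex.I * ((Real.sqrt (-d) : ℝ) : ℂ)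

lemma sqrtD_sq (d : ℤ) : (sqrtD d) ^ 2 = (d : ℂ) := by
  unfold sqrtD
  split_ifs with h
  · rw [← Complex.ofReal_pow, Real.sq_sqrt (by exact_mod_cast h)]
    simp
  · rw [mul_pow, Complex.I_sq, ← Complex.ofReal_pow,
      Real.sq_sqrt (by push_neg at h; nlinarith [show (d:ℝ) < 0 from by exact_mod_cast h])]
    push_cast
    ring

/-- The quadratic field `K = ℚ(√d)` realized inside `ℂ`.  For `d` a fundamental
discriminant, these realize all quadratic fields (identified with their
fundamental discriminants), `d > 0` giving the real ones and `d < 0` the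
imaginary ones. -/
noncomputable def Kd (d : ℤ) : IntermediateField ℚ ℂ := ℚ⟮sqrtD d⟯

instance (d : ℤ) : FiniteDimensional ℚ (Kd d) := by
  apply IntermediateField.adjoin.finiteDimensional
  have : IsAlgebraic ℚ (sqrtD d) := by
    refine ⟨Polynomial.X ^ 2 - Polynomial.C (d : ℚ), ?_, ?_⟩
    · exact Polynomial.X_pow_sub_C_ne_zero (by norm_num) _
    · simp [sqrtD_sq d]
  exact this.isIntegral

instance (d : ℤ) : NumberField (Kd d) := ⟨⟩

/-- The ring of integers `O_K` of `K = ℚ(√d)`. -/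
noncomputable abbrev Od (d : ℤ) := 𝓞 (Kd d)

/-- `d` is a fundamental discriminant, i.e. the discriminant of a quadratic field:
either `d ≡ 1 (mod 4)` and `d` squarefree, or `d = 4m` with `m` squarefree and
`m ≡ 2, 3 (mod 4)` (and `d ≠ 1`, which is not the discriminant of a quadratic field). -/
def IsFundamentalDiscriminant (d : ℤ) : Prop :=
  d ≠ 1 ∧ ((d % 4 = 1 ∧ Squarefree d) ∨
    ∃ m : ℤ, d = 4 * m ∧ (m % 4 = 2 ∨ m % 4 = 3) ∧ Squarefree m)

/-- The average of `f` over the family of quadratic fields (identified with their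
fundamental discriminants `d`) satisfying `F`, ordered by absolute discriminant,
exists and equals `A`:
`lim_{X→∞} (∑_{F d, |d| < X} f d) / #{d : F d, |d| < X} = A`. -/
noncomputable def HasAverage (F : ℤ → Prop) (f : ℤ → ℝ) (A : ℝ) : Prop :=
  Tendsto (fun X : ℝ =>
      (∑ᶠ d ∈ {d : ℤ | F d ∧ |(d : ℝ)| < X}, f d) /
        (Nat.card {d : ℤ // F d ∧ |(d : ℝ)| < X} : ℝ))
    atTop (nhds A)

/-- The binary cubic form `a x³ + 3 b x² y + 3 c x y² + d y³`, stored as `((a, b), (c, d))`. -/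
abbrev BCF (R : Type*) := (R × R) × (R × R)

namespace BCF

section Ring

variable {R : Type*} [CommRing R]

/-- The reduced discriminant, that is, the discriminant of the Hessian. -/
def disc (f : BCF R) : R :=
  f.1.1 ^ 2 * f.2.2 ^ 2 - 6 * f.1.1 * f.1.2 * f.2.1 * f.2.2 + 4 * f.1.1 * f.2.1 ^ 3
    + 4 * f.1.2 ^ 3 * f.2.2 - 3 * f.1.2 ^ 2 * f.2.1 ^ 2

/-- First coefficient of the Hessian. -/
def hA (f : BCF R) : R := f.1.2 ^ 2 - f.1.1 * f.2.1

/-- Second coefficient of the Hessian. -/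
def hB (f : BCF R) : R := f.1.2 * f.2.1 - f.1.1 * f.2.2

/-- Third coefficient of the Hessian. -/
def hC (f : BCF R) : R := f.2.1 ^ 2 - f.1.2 * f.2.2

/-- First coefficient of the cubic covariant. -/
def g₀ (f : BCF R) : R := f.1.1 ^ 2 * f.2.2 - 3 * f.1.1 * f.1.2 * f.2.1 + 2 * f.1.2 ^ 3

/-- Second coefficient of the cubic covariant. -/
def g₁ (f : BCF R) : R :=
  f.1.1 * f.1.2 * f.2.2 - 2 * f.1.1 * f.2.1 ^ 2 + f.1.2 ^ 2 * f.2.1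

/-- Third coefficient of the cubic covariant. -/
def g₂ (f : BCF R) : R :=
  -(f.1.1 * f.2.1 * f.2.2 - 2 * f.1.2 ^ 2 * f.2.2 + f.1.2 * f.2.1 ^ 2)

/-- Fourth coefficient of the cubic covariant. -/
def g₃ (f : BCF R) : R := -(f.1.1 * f.2.2 ^ 2 - 3 * f.1.2 * f.2.1 * f.2.2 + 2 * f.2.1 ^ 3)

/-- The value of the form. -/
def ev (f : BCF R) (x y : R) : R :=
  f.1.1 * x ^ 3 + 3 * f.1.2 * x ^ 2 * y + 3 * f.2.1 * x * y ^ 2 + f.2.2 * y ^ 3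

/-- The value of the Hessian. -/
def hess (f : BCF R) (x y : R) : R := f.hA * x ^ 2 + f.hB * x * y + f.hC * y ^ 2

/-- The form `f (p x + q y, r x + t y)`. -/
def sub (f : BCF R) (p q r t : R) : BCF R :=
  ((f.ev p r,
    f.1.1 * p ^ 2 * q + f.1.2 * (p ^ 2 * t + 2 * p * q * r) + f.2.1 * (2 * p * r * t + q * r ^ 2)
      + f.2.2 * r ^ 2 * t),
   (f.1.1 * p * q ^ 2 + f.1.2 * (2 * p * q * t + q ^ 2 * r) + f.2.1 * (p * t ^ 2 + 2 * q * r * t)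
      + f.2.2 * r * t ^ 2,
    f.ev q t))

theorem disc_eq (f : BCF R) : f.disc = f.hB ^ 2 - 4 * f.hA * f.hC := by
  simp only [disc, hA, hB, hC]; ring

theorem syzygy (f : BCF R) : f.g₀ ^ 2 - f.disc * f.1.1 ^ 2 = 4 * f.hA ^ 3 := by
  simp only [disc, hA, g₀]; ring

theorem ev_sub (f : BCF R) (p q r t x y : R) :
    (f.sub p q r t).ev x y = f.ev (p * x + q * y) (r * x + t * y) := by
  simp only [sub, ev]; ring

theorem hA_sub (f : BCF R) (p q r t : R) :
    (f.sub p q r t).hA = (p * t - q * r) ^ 2 * f.hess p r := by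
  simp only [sub, ev, hA, hB, hC, hess]; ring

theorem hC_sub (f : BCF R) (p q r t : R) :
    (f.sub p q r t).hC = (p * t - q * r) ^ 2 * f.hess q t := by
  simp only [sub, ev, hA, hB, hC, hess]; ring

theorem hB_sub (f : BCF R) (p q r t : R) :
    (f.sub p q r t).hB =
      (p * t - q * r) ^ 2 * (2 * f.hA * p * q + f.hB * (p * t + q * r) + 2 * f.hC * r * t) := by
  simp only [sub, ev, hA, hB, hC]; ring

theorem disc_sub (f : BCF R) (p q r t : R) :
    (f.sub p q r t).disc = (p * t - q * r) ^ 6 * f.disc := by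
  rw [disc_eq, hA_sub, hB_sub, hC_sub, disc_eq]; unfold hess; ring

theorem sub_sub (f : BCF R) (p q r t p' q' r' t' : R) :
    (f.sub p q r t).sub p' q' r' t' =
      f.sub (p * p' + q * r') (p * q' + q * t') (r * p' + t * r') (r * q' + t * t') := by
  simp only [sub, ev, Prod.mk.injEq]; refine ⟨⟨?_, ?_⟩, ?_, ?_⟩ <;> ring

theorem sub_one (f : BCF R) : f.sub 1 0 0 1 = f := by
  ext <;> simp [sub, ev]

theorem sub_neg_one (f : BCF R) : f.sub (-1) 0 0 (-1) = -f := by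
  ext <;> simp [sub, ev] <;> ring

/-- Coefficientwise image of a form under a ring homomorphism. -/
def map {S : Type*} [CommRing S] (φ : R →+* S) (f : BCF R) : BCF S :=
  ((φ f.1.1, φ f.1.2), (φ f.2.1, φ f.2.2))

variable {S : Type*} [CommRing S] (φ : R →+* S) (f : BCF R)

theorem disc_map : (f.map φ).disc = φ f.disc := by simp [disc, map, map_ofNat]
theorem hA_map : (f.map φ).hA = φ f.hA := by simp [hA, map]
theorem hB_map : (f.map φ).hB = φ f.hB := by simp [hB, map]
theorem hC_map : (f.map φ).hC = φ f.hC := by simp [hC, map]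

theorem sub_map (p q r t : R) : (f.map φ).sub (φ p) (φ q) (φ r) (φ t) = (f.sub p q r t).map φ := by
  ext <;> simp [sub, ev, map, map_ofNat]

end Ring

/-- Proper equivalence of integral forms. -/
def Equivalent (f f' : BCF ℤ) : Prop :=
  ∃ p q r t : ℤ, p * t - q * r = 1 ∧ f' = f.sub p q r t

theorem Equivalent.refl (f : BCF ℤ) : Equivalent f f :=
  ⟨1, 0, 0, 1, by norm_num, f.sub_one.symm⟩

theorem Equivalent.symm {f f' : BCF ℤ} : Equivalent f f' → Equivalent f' f := by
  rintro ⟨p, q, r, t, h, rfl⟩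
  refine ⟨t, -q, -r, p, by linear_combination h, ?_⟩
  rw [sub_sub]
  have h1 : p * t + q * -r = 1 := by linear_combination h
  have h2 : p * -q + q * p = 0 := by ring
  have h3 : r * t + t * -r = 0 := by ring
  have h4 : r * -q + t * p = 1 := by linear_combination h
  rw [h1, h2, h3, h4, sub_one]

theorem Equivalent.trans {f f' f'' : BCF ℤ} :
    Equivalent f f' → Equivalent f' f'' → Equivalent f f'' := by
  rintro ⟨p, q, r, t, h, rfl⟩ ⟨p', q', r', t', h', rfl⟩
  exact ⟨_, _, _, _, by linear_combination (p' * t' - q' * r') * h + h', sub_sub ..⟩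

/-- Proper equivalence as a setoid. -/
instance equivSetoid : Setoid (BCF ℤ) where
  r := Equivalent
  iseqv := ⟨Equivalent.refl, Equivalent.symm, Equivalent.trans⟩

theorem Equivalent.disc_eq {f f' : BCF ℤ} : Equivalent f f' → f'.disc = f.disc := by
  rintro ⟨p, q, r, t, h, rfl⟩
  rw [disc_sub, h]; ring

/-- A form with no nontrivial rational zero. -/
def Irr (f : BCF ℤ) : Prop := ∀ x y : ℤ, f.ev x y = 0 → x = 0 ∧ y = 0

theorem Irr.equivalent {f f' : BCF ℤ} (hf : f.Irr) : Equivalent f f' → f'.Irr := by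
  rintro ⟨p, q, r, t, h, rfl⟩ x y hxy
  rw [ev_sub] at hxy
  obtain ⟨h1, h2⟩ := hf _ _ hxy
  constructor
  · linear_combination t * h1 - q * h2 - x * h
  · linear_combination -r * h1 + p * h2 - y * h

theorem Irr.leading_ne_zero {f : BCF ℤ} (hf : f.Irr) : f.1.1 ≠ 0 := fun h => by
  have := hf 1 0 (by simp [ev, h])
  exact one_ne_zero this.1

end BCF

/-- A square-free integer multiplied by the square of a non-integral rational is not integral. -/
theorem exists_int_of_squarefree_mul_sq {e k : ℤ} (he : Squarefree e) {r : ℚ}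
    (h : (e : ℚ) * r ^ 2 = k) : ∃ n : ℤ, r = n := by
  have hq : (r.den : ℚ) ≠ 0 := by exact_mod_cast r.den_nz
  have h1 : e * r.num ^ 2 = k * (r.den : ℤ) ^ 2 := by
    have h2 : r = r.num / r.den := (Rat.num_div_den r).symm
    rw [h2] at h
    field_simp at h
    rw [mul_comm k]; exact_mod_cast h
  have hco : IsCoprime ((r.den : ℤ) ^ 2) (r.num ^ 2) := by
    refine IsCoprime.pow ?_
    rw [Int.isCoprime_iff_gcd_eq_one]
    have := r.reduced
    rw [Nat.coprime_comm] at this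
    simpa [Int.gcd, Nat.Coprime] using this
  have h3 : (r.den : ℤ) ^ 2 ∣ e := hco.dvd_of_dvd_mul_right ⟨k, by rw [h1]; ring⟩
  have h4 : IsUnit (r.den : ℤ) := he _ (by rwa [← sq])
  refine ⟨r.num, ?_⟩
  have h5 : r.den = 1 := by
    rcases Int.isUnit_iff.1 h4 with h | h <;> omega
  exact ((Rat.den_eq_one_iff r).1 h5).symm

theorem IsFundamentalDiscriminant.not_sq {D : ℤ} (hD : IsFundamentalDiscriminant D) (r : ℚ) :
    r ^ 2 ≠ D := by
  intro h
  have h0 : ∃ n : ℤ, r = n := exists_int_of_squarefree_mul_sq squarefree_one (k := D) (by simpa)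
  obtain ⟨n, rfl⟩ := h0
  have h : n ^ 2 = D := by exact_mod_cast h
  obtain ⟨h1, ⟨h2, h3⟩ | ⟨m, h2, h3, h4⟩⟩ := hD
  · have := h3 n ⟨1, by rw [← h]; ring⟩
    rcases Int.isUnit_iff.1 this with rfl | rfl <;> exact h1 (by rw [← h]; rfl)
  · rcases Int.even_or_odd' n with ⟨k, rfl | rfl⟩
    · have : k * k = m := by linarith [show (2 * k) ^ 2 = 4 * (k * k) by ring]
      rcases Int.even_or_odd' k with ⟨j, rfl | rfl⟩ <;> ring_nf at this <;> omega
    · ring_nf at h; omega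

theorem IsFundamentalDiscriminant.ne_zero {D : ℤ} (hD : IsFundamentalDiscriminant D) : D ≠ 0 := by
  rintro rfl; exact hD.not_sq 0 (by simp)

theorem IsFundamentalDiscriminant.emod_four {D : ℤ} (hD : IsFundamentalDiscriminant D) :
    D % 4 = 0 ∨ D % 4 = 1 := by
  obtain ⟨-, ⟨h, -⟩ | ⟨m, h, -⟩⟩ := hD <;> omega

theorem IsFundamentalDiscriminant.even_sub {D : ℤ} (hD : IsFundamentalDiscriminant D)
    {m N : ℤ} {v : ℚ} (h : (D : ℚ) * v ^ 2 = (m ^ 2 - 4 * N : ℤ)) :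
    ∃ n : ℤ, v = n ∧ 2 ∣ m - n * D := by
  obtain ⟨h1, ⟨h2, h3⟩ | ⟨e, h2, h3, h4⟩⟩ := hD
  · obtain ⟨n, rfl⟩ := exists_int_of_squarefree_mul_sq h3 h
    refine ⟨n, rfl, ?_⟩
    have h : D * n ^ 2 = m ^ 2 - 4 * N := by exact_mod_cast h
    have h5 : (2 : ℤ) ∣ m ^ 2 - n ^ 2 * D := ⟨2 * N, by linear_combination -h⟩
    have := h5
    rw [← even_iff_two_dvd] at this ⊢
    simp only [Int.even_sub, Int.even_mul, Int.even_pow] at this ⊢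
    simpa using this
  · obtain ⟨n, hn⟩ := exists_int_of_squarefree_mul_sq h4 (r := 2 * v) (k := m ^ 2 - 4 * N)
      (by rw [← h, h2]; push_cast; ring)
    have h : e * n ^ 2 = m ^ 2 - 4 * N := by
      rw [h2] at h
      have : (e : ℚ) * n ^ 2 = (m ^ 2 - 4 * N : ℤ) := by rw [← hn, ← h]; push_cast; ring
      exact_mod_cast this
    have hmod : (e * n ^ 2) % 4 = (m ^ 2) % 4 := by omega
    rcases Int.even_or_odd' n with ⟨k, hk | hk⟩
    · refine ⟨k, ?_, ?_⟩
      · rw [hk] at hn; push_cast at hn; linarith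
      · rw [h2]
        rcases Int.even_or_odd' m with ⟨j, hj | hj⟩
        · exact ⟨j - 2 * k * e, by rw [hj]; ring⟩
        · exfalso
          rw [hk, hj] at h; ring_nf at h; omega
    · exfalso
      have h7 : e % 4 = (m ^ 2) % 4 := by
        rw [← hmod, hk, show e * (2 * k + 1) ^ 2 = e + 4 * (e * (k ^ 2 + k)) by ring]; omega
      rcases Int.even_or_odd' m with ⟨j, hj | hj⟩ <;> rw [hj] at h7 <;> ring_nf at h7 <;> omega

/-- A quadratic field with a chosen square root of `D` and the nontrivial automorphism. -/
structure QuadField (K : Type*) [Field K] [NumberField K] (D : ℤ) where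
  /-- the chosen square root -/
  s : K
  sq : s ^ 2 = D
  /-- the conjugation -/
  conj : K →ₐ[ℚ] K
  conj_s : conj s = -s
  span : ∀ x, ∃ u v : ℚ, x = u + v * s

namespace QuadField

variable {K : Type*} [Field K] [NumberField K] {D : ℤ} (Q : QuadField K D)
include Q

@[simp] theorem conj_coe (u v : ℚ) : Q.conj (u + v * Q.s) = u - v * Q.s := by
  simp [Q.conj_s]; ring

variable (hD : IsFundamentalDiscriminant D)
include hD

theorem s_ne_zero : Q.s ≠ 0 := fun h => by
  have := Q.sq
  rw [h] at this
  exact hD.ne_zero (by exact_mod_cast (by simpa using this.symm : (D : K) = 0))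

theorem coord_eq_zero {u v : ℚ} (h : (u : K) + v * Q.s = 0) : u = 0 ∧ v = 0 := by
  have hv : v = 0 := by
    by_contra hv
    have hvK : (v : K) ≠ 0 := by exact_mod_cast hv
    have : Q.s = -u / v := by field_simp; linear_combination h
    have h2 : ((-u / v : ℚ) : K) ^ 2 = D := by
      rw [← Q.sq, this]; push_cast; ring
    exact hD.not_sq (-u / v) (by exact_mod_cast h2)
  subst hv
  refine ⟨?_, rfl⟩
  simpa using h

theorem coord_unique {u v u' v' : ℚ} (h : (u : K) + v * Q.s = u' + v' * Q.s) :
    u = u' ∧ v = v' := by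
  have := Q.coord_eq_zero hD (u := u - u') (v := v - v') (by push_cast; linear_combination h)
  exact ⟨by linarith [this.1], by linarith [this.2]⟩

theorem int_coord_unique {u v u' v' : ℤ} (h : (u : K) + v * Q.s = u' + v' * Q.s) :
    u = u' ∧ v = v' := by
  have := Q.coord_unique hD (u := u) (v := v) (u' := u') (v' := v') (by exact_mod_cast h)
  exact_mod_cast this

theorem isIntegral_iff {x : K} :
    IsIntegral ℤ x ↔ ∃ m n : ℤ, 2 * x = m + n * Q.s ∧ 2 ∣ m - n * D := by
  constructor
  · intro hx
    obtain ⟨u, v, rfl⟩ := Q.span x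
    have hc : IsIntegral ℤ (Q.conj (u + v * Q.s)) := hx.map (Q.conj.restrictScalars ℤ)
    rw [Q.conj_coe] at hc
    have ht : IsIntegral ℤ ((2 * u : ℚ) : K) := by
      have e : ((2 * u : ℚ) : K) = (u + v * Q.s) + (u - v * Q.s) := by push_cast; ring
      rw [e]; exact hx.add hc
    have hn : IsIntegral ℤ ((u ^ 2 - D * v ^ 2 : ℚ) : K) := by
      have e : ((u ^ 2 - D * v ^ 2 : ℚ) : K) = (u + v * Q.s) * (u - v * Q.s) := by
        push_cast; linear_combination (v : K) ^ 2 * Q.sq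
      rw [e]; exact hx.mul hc
    have key : ∀ r : ℚ, IsIntegral ℤ ((r : ℚ) : K) → ∃ n : ℤ, r = n := by
      intro r hr
      have hr' : IsIntegral ℤ (algebraMap ℚ K r) := hr
      rw [isIntegral_algebraMap_iff (algebraMap ℚ K).injective] at hr'
      obtain ⟨n, hn⟩ := IsIntegrallyClosed.isIntegral_iff.1 hr'
      exact ⟨n, hn.symm⟩
    obtain ⟨m, hm⟩ := key _ ht
    obtain ⟨N, hN⟩ := key _ hn
    obtain ⟨n, hn, hmn⟩ := hD.even_sub (m := m) (N := N) (v := 2 * v) (by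
      push_cast; rw [← hm, ← hN]; ring)
    refine ⟨m, n, ?_, hmn⟩
    have h1 : (2 * (u : K)) = m := by exact_mod_cast congrArg (Rat.cast (K := K)) hm
    have h2 : (2 * (v : K)) = n := by exact_mod_cast congrArg (Rat.cast (K := K)) hn
    rw [← h1, ← h2]; ring
  · rintro ⟨m, n, h, k, hk⟩
    have h4 : ∃ l : ℤ, D ^ 2 - D = 4 * l := by
      rcases hD.emod_four with h | h
      · refine ⟨D / 4 * (D - 1), ?_⟩
        have : D = 4 * (D / 4) := by omega
        linear_combination (D - 1) * this
      · refine ⟨D * (D / 4), ?_⟩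
        have : D = 4 * (D / 4) + 1 := by omega
        linear_combination D * this
    obtain ⟨l, hl⟩ := h4
    have h2 : IsIntegral ℤ ((D + Q.s) / 2) := by
      refine ⟨Polynomial.X ^ 2 - Polynomial.C D * Polynomial.X + Polynomial.C l, ?_, ?_⟩
      · monicity!
      · have hl' : (D : K) ^ 2 - D = 4 * l := by exact_mod_cast hl
        simp only [Polynomial.eval₂_add, Polynomial.eval₂_sub, Polynomial.eval₂_mul,
          Polynomial.eval₂_pow, Polynomial.eval₂_C, Polynomial.eval₂_X]
        simp only [eq_intCast]
        field_simp
        linear_combination Q.sq - hl'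
    have : x = k + n * ((D + Q.s) / 2) := by
      have hk' : (m : K) - n * D = 2 * k := by exact_mod_cast hk
      have : (2 : K) ≠ 0 := two_ne_zero
      field_simp
      linear_combination h + hk'
    rw [this]
    exact (isIntegral_algebraMap (x := k) (R := ℤ)).add
      ((isIntegral_algebraMap (x := n) (R := ℤ)).mul h2)

end QuadField

open NumberField

namespace QuadField

variable {K : Type*} [Field K] [NumberField K] {D : ℤ} (Q : QuadField K D)
  (hD : IsFundamentalDiscriminant D)

/-- The second element of the standard integral basis. -/
noncomputable def τ : 𝓞 K := ⟨(D + Q.s) / 2, (Q.isIntegral_iff hD).2 ⟨D, 1, by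
  push_cast; field_simp, by simp⟩⟩

theorem two_mul_τ : 2 * (Q.τ hD : K) = D + Q.s := by
  have : (Q.τ hD : K) = (D + Q.s) / 2 := rfl
  rw [this]; field_simp

theorem exists_int_coord (x : 𝓞 K) : ∃ k n : ℤ, x = k + n * Q.τ hD := by
  obtain ⟨m, n, h, k, hk⟩ := (Q.isIntegral_iff hD).1 x.isIntegral_coe
  refine ⟨k, n, ?_⟩
  apply RingOfIntegers.ext
  simp only [map_add, map_mul, map_intCast]
  have hk' : (m : K) - n * D = 2 * k := by exact_mod_cast hk
  have : (2 : K) ≠ 0 := two_ne_zero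
  apply mul_left_cancel₀ this
  linear_combination h + hk' - n * Q.two_mul_τ hD

theorem τ_coord_eq_zero {k n : ℤ} (h : (k : K) + n * Q.τ hD = 0) : k = 0 ∧ n = 0 := by
  have := Q.int_coord_unique hD (u := 2 * k + n * D) (v := n) (u' := 0) (v' := 0) (by
    push_cast; linear_combination 2 * h - n * Q.two_mul_τ hD)
  obtain ⟨h1, rfl⟩ := this
  simpa using h1

/-- The standard integral basis. -/
noncomputable def basis : Module.Basis (Fin 2) ℤ (𝓞 K) :=
  Module.Basis.mk (v := ![1, Q.τ hD]) (by
    rw [LinearIndependent.pair_iff]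
    intro k n h
    have h' := congrArg (algebraMap (𝓞 K) K) h
    simp only [zsmul_eq_mul, mul_one, map_add, map_mul, map_intCast, map_zero] at h'
    exact Q.τ_coord_eq_zero hD h') (by
    intro x _
    obtain ⟨k, n, rfl⟩ := Q.exists_int_coord hD x
    rw [Matrix.range_cons, Matrix.range_cons, Matrix.range_empty, Set.union_empty,
      Set.singleton_union, Submodule.mem_span_pair]
    exact ⟨k, n, by simp⟩)

@[simp] theorem basis_zero : Q.basis hD 0 = 1 := by simp [basis]
@[simp] theorem basis_one : Q.basis hD 1 = Q.τ hD := by simp [basis]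

theorem conj_τ : 2 * Q.conj (Q.τ hD) = D - Q.s := by
  have := congrArg Q.conj (Q.two_mul_τ hD)
  rw [map_mul, map_add, map_ofNat, map_intCast, Q.conj_s] at this
  rw [this]; ring

include Q hD

/-- The oriented area spanned by an integral basis of an ideal is, up to sign, its norm. -/
theorem basis_area {I : Ideal (𝓞 K)} (b : Module.Basis (Fin 2) ℤ I) :
    ∃ n : ℤ, n.natAbs = Ideal.absNorm I ∧
      ((b 0 : 𝓞 K) : K) * Q.conj ((b 1 : 𝓞 K) : K) - Q.conj ((b 0 : 𝓞 K) : K) * ((b 1 : 𝓞 K) : K) = n * Q.s := by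
  refine ⟨-(Q.basis hD).det ((↑) ∘ b), ?_, ?_⟩
  · rw [Int.natAbs_neg, Ideal.natAbs_det_basis_change]
  · rw [Module.Basis.det_apply, Matrix.det_fin_two]
    simp only [Module.Basis.toMatrix_apply, Function.comp]
    have key : ∀ x : 𝓞 K, (x : K) = ((Q.basis hD).repr x 0 : K) + (Q.basis hD).repr x 1 * Q.τ hD := by
      intro x
      have h0 := (Q.basis hD).sum_repr x
      rw [Fin.sum_univ_two] at h0
      have h0 := congrArg (algebraMap (𝓞 K) K) h0
      simp only [zsmul_eq_mul, basis_zero, basis_one, mul_one, map_add, map_mul, map_intCast]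
        at h0
      exact h0.symm
    have h0 := key (b 0)
    have h1 := key (b 1)
    set p := (Q.basis hD).repr (b 0) 0
    set q := (Q.basis hD).repr (b 0) 1
    set r := (Q.basis hD).repr (b 1) 0
    set t := (Q.basis hD).repr (b 1) 1
    rw [h0, h1]
    simp only [map_add, map_mul, map_intCast]
    push_cast
    apply mul_left_cancel₀ (two_ne_zero : (2 : K) ≠ 0)
    linear_combination (p * t - r * q) * Q.conj_τ hD - (p * t - r * q) * Q.two_mul_τ hD

theorem absNorm_span_singleton {ε : 𝓞 K} (h : ε ≠ 0) :
    ∃ n : ℤ, n.natAbs = Ideal.absNorm (Ideal.span {ε}) ∧ (ε : K) * Q.conj ε = n := by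
  obtain ⟨n, hn, h1⟩ := Q.basis_area hD (Ideal.basisSpanSingleton (Q.basis hD) h)
  refine ⟨-n, by simpa using hn, ?_⟩
  simp only [Ideal.basisSpanSingleton_apply, basis_zero, basis_one, map_mul, mul_one] at h1
  have hs := Q.s_ne_zero hD
  push_cast
  apply mul_right_cancel₀ hs
  apply mul_left_cancel₀ (two_ne_zero : (2 : K) ≠ 0)
  linear_combination -2 * h1 + (ε : K) * Q.conj ε * Q.conj_τ hD
    - (ε : K) * Q.conj ε * Q.two_mul_τ hD

/-- An ideal has an integral basis with prescribed orientation. -/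
theorem exists_oriented_basis {I : Ideal (𝓞 K)} (hI : I ≠ ⊥) :
    ∃ α β : K, (∀ x : K, (∃ y ∈ I, (y : K) = x) ↔ ∃ m n : ℤ, x = m * α + n * β) ∧
      α * Q.conj β - Q.conj α * β = (Ideal.absNorm I : ℤ) * Q.s := by
  let b := Ideal.selfBasis (Q.basis hD) I hI
  obtain ⟨n, hn, h⟩ := Q.basis_area hD b
  have hmem : ∀ x : K, (∃ y ∈ I, (y : K) = x) ↔
      ∃ m n : ℤ, x = m * ((b 0 : 𝓞 K) : K) + n * ((b 1 : 𝓞 K) : K) := by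
    intro x
    constructor
    · rintro ⟨y, hy, rfl⟩
      have h0 := b.sum_repr ⟨y, hy⟩
      rw [Fin.sum_univ_two] at h0
      have h0 := congrArg (fun z : I => algebraMap (𝓞 K) K z) h0
      have e : ∀ (m : ℤ) (x : I), ((m • x : I) : 𝓞 K) = m * x := fun m x => by
        rw [← zsmul_eq_mul]; rfl
      simp only [Submodule.coe_add, e, map_add, map_mul, map_intCast] at h0
      exact ⟨_, _, h0.symm⟩
    · rintro ⟨m, n, rfl⟩
      refine ⟨(m • b 0 + n • b 1 : I), (m • b 0 + n • b 1 : I).2, by simp⟩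
  rcases Int.natAbs_eq n with h1 | h1
  · exact ⟨_, _, hmem, by rw [h, ← hn, ← h1]⟩
  · refine ⟨((b 0 : 𝓞 K) : K), -((b 1 : 𝓞 K) : K), ?_, ?_⟩
    · intro x
      rw [hmem]
      constructor
      · rintro ⟨m, n, rfl⟩; exact ⟨m, -n, by push_cast; ring⟩
      · rintro ⟨m, n, rfl⟩; exact ⟨m, -n, by push_cast; ring⟩
    · rw [← hn, map_neg]
      have : ((n.natAbs : ℤ) : K) = -(n : K) := by rw [← Int.cast_neg]; congr 1; omega
      rw [this]; linear_combination -h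

end QuadField

open NumberField

section CubeGroup

variable (R K : Type*) [CommRing R] [IsDomain R] [Field K] [Algebra R K] [IsFractionRing R K]

/-- The group of pairs `(δ, I)` with `I³ = (δ)`. -/
noncomputable def cubeGroup : Subgroup (Kˣ × (FractionalIdeal R⁰ K)ˣ) where
  carrier := {p | p.2 ^ 3 = toPrincipalIdeal R K p.1}
  mul_mem' {a b} ha hb := by
    simp only [Set.mem_ofPred_eq, Prod.fst_mul, Prod.snd_mul] at *
    rw [mul_pow, ha, hb, map_mul]
  one_mem' := by simp
  inv_mem' {a} ha := by
    simp only [Set.mem_ofPred_eq, Prod.fst_inv, Prod.snd_inv] at *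
    rw [inv_pow, ha, map_inv]

variable {R K} in
theorem mem_cubeGroup {p : Kˣ × (FractionalIdeal R⁰ K)ˣ} :
    p ∈ cubeGroup R K ↔ p.2 ^ 3 = toPrincipalIdeal R K p.1 := Iff.rfl

/-- The trivial pairs `(κ³, (κ))`. -/
noncomputable def cubeGroupOfUnit : Kˣ →* cubeGroup R K :=
  ((powMonoidHom 3).prod (toPrincipalIdeal R K)).codRestrict _ fun x => by
    simp [mem_cubeGroup]

theorem toPrincipalIdeal_eq_one_iff {x : Kˣ} :
    toPrincipalIdeal R K x = 1 ↔ ∃ u : Rˣ, Units.map (algebraMap R K).toMonoidHom u = x := by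
  rw [toPrincipalIdeal_eq_iff, Units.val_one]
  constructor
  · intro h
    have h1 : (x : K) ∈ (1 : FractionalIdeal R⁰ K) := by
      rw [← h]; exact FractionalIdeal.mem_spanSingleton_self _ _
    have h2 : ((x⁻¹ : Kˣ) : K) ∈ (1 : FractionalIdeal R⁰ K) := by
      have : FractionalIdeal.spanSingleton R⁰ ((x⁻¹ : Kˣ) : K) = 1 := by
        have h3 := FractionalIdeal.spanSingleton_mul_spanSingleton (S := R⁰) (x : K) ((x⁻¹ : Kˣ) : K)
        rw [h, one_mul, Units.mul_inv, FractionalIdeal.spanSingleton_one] at h3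
        exact h3
      rw [← this]; exact FractionalIdeal.mem_spanSingleton_self _ _
    obtain ⟨a, ha⟩ := (FractionalIdeal.mem_one_iff _).1 h1
    obtain ⟨b, hb⟩ := (FractionalIdeal.mem_one_iff _).1 h2
    have hab : a * b = 1 := by
      apply IsFractionRing.injective R K
      rw [map_mul, ha, hb, Units.mul_inv, map_one]
    exact ⟨⟨a, b, hab, by rw [mul_comm, hab]⟩, Units.ext ha⟩
  · rintro ⟨u, rfl⟩
    apply FractionalIdeal.coeToSubmodule_injective
    apply le_antisymm
    · intro y hy
      obtain ⟨z, rfl⟩ := (FractionalIdeal.mem_spanSingleton R⁰).1 hy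
      exact (FractionalIdeal.mem_one_iff _).2 ⟨z * u, by simp [Algebra.smul_def]⟩
    · intro y hy
      obtain ⟨z, rfl⟩ := (FractionalIdeal.mem_one_iff _).1 hy
      refine (FractionalIdeal.mem_spanSingleton R⁰).2 ⟨z * (u⁻¹ : Rˣ), ?_⟩
      rw [Algebra.smul_def]
      simp [← map_mul, mul_assoc]

theorem card_cubeGroup_quotient :
    Nat.card (cubeGroup R K ⧸ (cubeGroupOfUnit R K).range) =
      Nat.card {x : ClassGroup R // x ^ 3 = 1} * Nat.card (Rˣ ⧸ (powMonoidHom 3 : Rˣ →* Rˣ).range) := by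
  let φ : cubeGroup R K →* (FractionalIdeal R⁰ K)ˣ ⧸ (toPrincipalIdeal R K).range :=
    (QuotientGroup.mk' _).comp ((MonoidHom.snd _ _).comp (cubeGroup R K).subtype)
  let ψ : Rˣ →* cubeGroup R K :=
    ((Units.map (algebraMap R K).toMonoidHom).prod 1).codRestrict _ fun x => by
      rw [mem_cubeGroup]
      exact (one_pow 3).trans ((toPrincipalIdeal_eq_one_iff R K).2 ⟨x, rfl⟩).symm
  have hle : (cubeGroupOfUnit R K).range ≤ φ.ker := by
    rintro _ ⟨x, rfl⟩
    rw [MonoidHom.mem_ker]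
    exact (QuotientGroup.eq_one_iff _).2 ⟨x, rfl⟩
  have hker : φ.ker = (cubeGroupOfUnit R K).range ⊔ ψ.range := by
    apply le_antisymm
    · intro p hp
      obtain ⟨x, hx⟩ := (QuotientGroup.eq_one_iff _).1 (MonoidHom.mem_ker.1 hp)
      have hp2 := mem_cubeGroup.1 p.2
      change toPrincipalIdeal R K x = p.1.2 at hx
      have h1 : toPrincipalIdeal R K (p.1.1 * (x ^ 3)⁻¹) = 1 := by
        rw [map_mul, map_inv, map_pow, hx, hp2, mul_inv_cancel]
      obtain ⟨u, hu⟩ := (toPrincipalIdeal_eq_one_iff R K).1 h1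
      have : p = cubeGroupOfUnit R K x * ψ u := by
        apply Subtype.ext
        apply Prod.ext
        · change p.1.1 = x ^ 3 * Units.map (algebraMap R K).toMonoidHom u
          rw [hu, mul_comm, inv_mul_cancel_right]
        · change p.1.2 = toPrincipalIdeal R K x * 1
          rw [hx, mul_one]
      rw [this]
      exact Subgroup.mul_mem_sup ⟨x, rfl⟩ ⟨u, rfl⟩
    · refine sup_le hle ?_
      rintro _ ⟨u, rfl⟩
      exact (QuotientGroup.eq_one_iff _).2 ⟨1, map_one _⟩
  have hcomap : (cubeGroupOfUnit R K).range.comap ψ = (powMonoidHom 3 : Rˣ →* Rˣ).range := by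
    ext u
    constructor
    · rintro ⟨x, hx⟩
      have h1 : x ^ 3 = Units.map (algebraMap R K).toMonoidHom u :=
        congrArg (fun p : cubeGroup R K => p.1.1) hx
      have h2 : toPrincipalIdeal R K x = 1 := congrArg (fun p : cubeGroup R K => p.1.2) hx
      obtain ⟨v, rfl⟩ := (toPrincipalIdeal_eq_one_iff R K).1 h2
      refine ⟨v, ?_⟩
      rw [← map_pow] at h1
      exact Units.map_injective (f := (algebraMap R K).toMonoidHom) (IsFractionRing.injective R K) h1
    · rintro ⟨v, rfl⟩
      refine ⟨Units.map (algebraMap R K).toMonoidHom v, ?_⟩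
      apply Subtype.ext
      apply Prod.ext
      · exact (map_pow _ _ _).symm
      · exact (toPrincipalIdeal_eq_one_iff R K).2 ⟨v, rfl⟩
  have h1 := Subgroup.relIndex_mul_index hle
  have h2 : (cubeGroupOfUnit R K).range.relIndex φ.ker
      = Nat.card (Rˣ ⧸ (powMonoidHom 3 : Rˣ →* Rˣ).range) := by
    rw [hker, Subgroup.relIndex_sup_left, ← Subgroup.index_comap, hcomap]
    rfl
  have h3 : φ.ker.index = Nat.card {x : ClassGroup R // x ^ 3 = 1} := by
    rw [Subgroup.index_ker]
    refine Nat.card_congr ?_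
    refine Equiv.subtypeEquiv (ClassGroup.equiv K).symm.toEquiv ?_
    intro a
    have e : ((ClassGroup.equiv K).symm.toEquiv a) ^ 3 = 1 ↔ a ^ 3 = 1 := by
      change ((ClassGroup.equiv K).symm a) ^ 3 = 1 ↔ a ^ 3 = 1
      exact (map_pow (ClassGroup.equiv (R := R) K).symm a 3) ▸
        EmbeddingLike.map_eq_one_iff (f := (ClassGroup.equiv (R := R) K).symm)
    rw [e]
    constructor
    · rintro ⟨p, rfl⟩
      rw [← map_pow]
      exact (QuotientGroup.eq_one_iff _).2 ⟨p.1.1, (mem_cubeGroup.1 p.2).symm⟩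
    · intro ha
      obtain ⟨I, rfl⟩ := QuotientGroup.mk_surjective a
      obtain ⟨x, hx⟩ := (QuotientGroup.eq_one_iff _).1 ha
      exact ⟨⟨(x, I), hx.symm⟩, rfl⟩
  rw [h2, h3] at h1
  rw [mul_comm, h1]
  rfl

end CubeGroup

open NumberField

namespace BCF

section Ring

variable {R : Type*} [CommRing R]

/-- The cubic covariant. -/
def cov (f : BCF R) : BCF R := ((f.g₀, f.g₁), (f.g₂, f.g₃))

theorem cov_sub (f : BCF R) (p q r t : R) :
    (f.sub p q r t).cov = (p * t - q * r) ^ 3 • f.cov.sub p q r t := by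
  simp only [cov, g₀, g₁, g₂, g₃, sub, ev, Prod.smul_mk, smul_eq_mul, Prod.mk.injEq]
  refine ⟨⟨?_, ?_⟩, ?_, ?_⟩ <;> ring

theorem cov_map {S : Type*} [CommRing S] (φ : R →+* S) (f : BCF R) :
    (f.map φ).cov = f.cov.map φ := by
  simp [cov, g₀, g₁, g₂, g₃, map, map_ofNat]

end Ring

theorem disc_modEq (f : BCF ℤ) : ∃ k, f.disc = f.hB + 2 * k := by
  obtain ⟨j, hj⟩ := Int.even_mul_succ_self (f.hB - 1)
  exact ⟨j - 2 * f.hA * f.hC, by rw [disc_eq]; linear_combination hj⟩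

variable {K : Type*} [Field K]

/-- The form `(G + s f) / 2`, a multiple of the cube of a linear form if `s² = disc f`. -/
def theta (s : K) (f : BCF K) : BCF K := (2⁻¹ : K) • (f.cov + s • f)

theorem theta_sub (s : K) (f : BCF K) {p q r t : K} (h : p * t - q * r = 1) :
    theta s (f.sub p q r t) = (theta s f).sub p q r t := by
  rw [theta, cov_sub, h, theta]
  ext <;> simp [sub, ev] <;> ring

section Relations

variable [CharZero K] {s : K} {f : BCF K} (h : s ^ 2 = f.disc)
include h

theorem theta_rel₁ : (theta s f).1.1 * (theta s f).2.1 = (theta s f).1.2 ^ 2 := by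
  simp only [theta, cov, g₀, g₁, g₂, disc, Prod.smul_fst, Prod.smul_snd, Prod.fst_add,
    Prod.snd_add, smul_eq_mul] at *
  field_simp
  linear_combination (f.1.1 * f.2.1 - f.1.2 ^ 2) * h

theorem theta_rel₂ : (theta s f).1.1 * (theta s f).2.2 = (theta s f).1.2 * (theta s f).2.1 := by
  simp only [theta, cov, g₀, g₁, g₂, g₃, disc, Prod.smul_fst, Prod.smul_snd, Prod.fst_add,
    Prod.snd_add, smul_eq_mul] at *
  field_simp
  linear_combination (f.1.1 * f.2.2 - f.1.2 * f.2.1) * h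

theorem s_mul_theta₀ :
    s * (theta s f).1.1 = -f.hB * (theta s f).1.1 + 2 * f.hA * (theta s f).1.2 := by
  simp only [theta, cov, g₀, g₁, hA, hB, disc, Prod.smul_fst, Prod.smul_snd, Prod.fst_add,
    Prod.snd_add, smul_eq_mul] at *
  field_simp
  linear_combination f.1.1 * h

theorem s_mul_theta₁ :
    s * (theta s f).1.2 = -2 * f.hC * (theta s f).1.1 + f.hB * (theta s f).1.2 := by
  simp only [theta, cov, g₀, g₁, hC, hB, disc, Prod.smul_fst, Prod.smul_snd, Prod.fst_add,
    Prod.snd_add, smul_eq_mul] at *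
  field_simp
  linear_combination f.1.2 * h

omit h
theorem theta_hA_sq : f.1.2 * (theta s f).1.1 - f.1.1 * (theta s f).1.2 = f.hA ^ 2 := by
  simp only [theta, cov, g₀, g₁, hA, Prod.smul_fst, Prod.smul_snd, Prod.fst_add,
    Prod.snd_add, smul_eq_mul] at *
  field_simp
  ring

theorem theta_hC_sq : f.2.2 * (theta s f).2.1 - f.2.1 * (theta s f).2.2 = f.hC ^ 2 := by
  simp only [theta, cov, g₂, g₃, hC, Prod.smul_fst, Prod.smul_snd, Prod.fst_add,
    Prod.snd_add, smul_eq_mul] at *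
  field_simp
  ring

theorem theta_hB_sq : f.2.2 * (theta s f).1.1 - f.1.1 * (theta s f).2.2
    + f.2.1 * (theta s f).1.2 - f.1.2 * (theta s f).2.1 = f.hB ^ 2 := by
  simp only [theta, cov, g₀, g₁, g₂, g₃, hB, Prod.smul_fst, Prod.smul_snd, Prod.fst_add,
    Prod.snd_add, smul_eq_mul] at *
  field_simp
  ring

end Relations

/-- The Hessian of a form with fundamental discriminant is primitive. -/
theorem exists_hess_combination {D : ℤ} (hD : IsFundamentalDiscriminant D) {f : BCF ℤ}
    (hf : f.disc = D) : ∃ u v w : ℤ, u * f.hA ^ 2 + v * f.hB ^ 2 + w * f.hC ^ 2 = 1 := by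
  have hprim : ∀ p : ℤ, Prime p → p ∣ f.hA → p ∣ f.hB → p ∣ f.hC → False := by
    rintro p hp ⟨a, ha⟩ ⟨b, hb⟩ ⟨c, hc⟩
    have hdisc : D = p * p * (b ^ 2 - 4 * a * c) := by
      rw [← hf, disc_eq, ha, hb, hc]; ring
    obtain ⟨h1, ⟨h2, h3⟩ | ⟨e, h2, h3, h4⟩⟩ := hD
    · exact hp.not_isUnit (h3 p ⟨_, hdisc⟩)
    · by_cases hp2 : p.natAbs = 2
      · have : p * p = 4 := by
          have := Int.natAbs_mul_self' p; rw [hp2] at this; push_cast at this; linarith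
        rw [this, h2] at hdisc
        have hdisc : e = b ^ 2 - 4 * (a * c) := by linarith
        rcases Int.even_or_odd' b with ⟨j, hj | hj⟩ <;> rw [hj] at hdisc <;> ring_nf at hdisc <;> omega
      · have hco : IsCoprime (p * p) (4 : ℤ) := by
          have : IsCoprime p 2 := by
            rw [Prime.coprime_iff_not_dvd hp]
            intro h
            have h5 := Int.natAbs_dvd_natAbs.2 h
            have h6 := (Nat.prime_dvd_prime_iff_eq (Int.prime_iff_natAbs_prime.1 hp)
              Nat.prime_two).1 h5
            exact hp2 h6
          have h22 : IsCoprime (p * p) (2 * 2) := (this.mul_left this).mul_right (this.mul_left this)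
          exact h22
        have : p * p ∣ e := hco.dvd_of_dvd_mul_left ⟨_, by rw [← h2, hdisc]⟩
        exact hp.not_isUnit (h4 p this)
  have hg : Int.gcd (f.hA ^ 2) (Int.gcd (f.hB ^ 2) (f.hC ^ 2)) = 1 := by
    by_contra hne
    obtain ⟨p, hp, hpd⟩ := Nat.exists_prime_and_dvd hne
    have hp' : Prime (p : ℤ) := Nat.prime_iff_prime_int.1 hp
    have h1 : (p : ℤ) ∣ Int.gcd (f.hA ^ 2) (Int.gcd (f.hB ^ 2) (f.hC ^ 2)) := by exact_mod_cast hpd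
    have h2 := h1.trans (Int.gcd_dvd_right ..)
    exact hprim p hp' (hp'.dvd_of_dvd_pow (h1.trans (Int.gcd_dvd_left ..)))
      (hp'.dvd_of_dvd_pow (h2.trans (Int.gcd_dvd_left ..)))
      (hp'.dvd_of_dvd_pow (h2.trans (Int.gcd_dvd_right ..)))
  have e1 := Int.gcd_eq_gcd_ab (f.hA ^ 2) (Int.gcd (f.hB ^ 2) (f.hC ^ 2))
  have e2 := Int.gcd_eq_gcd_ab (f.hB ^ 2) (f.hC ^ 2)
  rw [hg] at e1
  set x := Int.gcdA (f.hA ^ 2) (Int.gcd (f.hB ^ 2) (f.hC ^ 2))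
  set y := Int.gcdB (f.hA ^ 2) (Int.gcd (f.hB ^ 2) (f.hC ^ 2))
  rw [e2] at e1
  exact ⟨x, y * Int.gcdA (f.hB ^ 2) (f.hC ^ 2), y * Int.gcdB (f.hB ^ 2) (f.hC ^ 2), by
    push_cast at e1; linear_combination -e1⟩

theorem hA_ne_zero {D : ℤ} (hD : IsFundamentalDiscriminant D) {f : BCF ℤ}
    (hf : f.disc = D) : f.hA ≠ 0 := fun h => by
  rw [disc_eq, h] at hf
  exact hD.not_sq f.hB (by rw [← hf]; push_cast; ring)

end BCF

open NumberField

namespace QuadField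

open BCF

variable {K : Type*} [Field K] [NumberField K] {D : ℤ} (Q : QuadField K D)

/-- The integers `θᵢ` attached to an integral form. -/
noncomputable def th (f : BCF ℤ) : BCF K := theta Q.s (f.map (Int.castRingHom K))

theorem two_mul_th (f : BCF ℤ) : 2 * (Q.th f).1.1 = (f.g₀ : K) + (f.1.1 : K) * Q.s ∧
    2 * (Q.th f).1.2 = (f.g₁ : K) + (f.1.2 : K) * Q.s ∧
    2 * (Q.th f).2.1 = (f.g₂ : K) + (f.2.1 : K) * Q.s ∧
    2 * (Q.th f).2.2 = (f.g₃ : K) + (f.2.2 : K) * Q.s := by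
  rw [th, theta, cov_map]
  refine ⟨?_, ?_, ?_, ?_⟩ <;> simp [cov, BCF.map, mul_comm, mul_left_comm (2 : K)]

theorem sq_eq_disc {f : BCF ℤ} (hf : f.disc = D) :
    Q.s ^ 2 = (f.map (Int.castRingHom K)).disc := by
  rw [disc_map, hf, Q.sq]; rfl

theorem th_sub (f : BCF ℤ) {p q r t : ℤ} (h : p * t - q * r = 1) :
    Q.th (f.sub p q r t) = (Q.th f).sub (p : K) q r t := by
  have := sub_map (Int.castRingHom K) f p q r t
  rw [th, ← this, theta_sub _ _ (by
    simp only [eq_intCast]; exact_mod_cast h)]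
  rfl

variable (hD : IsFundamentalDiscriminant D) {f : BCF ℤ} (hf : f.disc = D)
include hD hf

theorem exists_th_combination : ∃ e₀ e₁ e₂ e₃ : ℤ,
    e₀ * (Q.th f).1.1 + e₁ * (Q.th f).1.2 + e₂ * (Q.th f).2.1 + e₃ * (Q.th f).2.2 = 1 := by
  obtain ⟨u, v, w, h⟩ := exists_hess_combination hD hf
  have h' : (u * f.hA ^ 2 + v * f.hB ^ 2 + w * f.hC ^ 2 : K) = 1 := by exact_mod_cast h
  have h1 := theta_hA_sq (s := Q.s) (f := f.map (Int.castRingHom K))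
  have h2 := theta_hB_sq (s := Q.s) (f := f.map (Int.castRingHom K))
  have h3 := theta_hC_sq (s := Q.s) (f := f.map (Int.castRingHom K))
  rw [hA_map] at h1
  rw [hB_map] at h2
  rw [hC_map] at h3
  simp only [BCF.map, eq_intCast] at h1 h2 h3
  refine ⟨u * f.1.2 + v * f.2.2, -u * f.1.1 + v * f.2.1, -v * f.1.2 + w * f.2.2,
    -v * f.1.1 - w * f.2.1, ?_⟩
  push_cast
  unfold th
  simp only [BCF.map, eq_intCast]
  linear_combination h' + u * h1 + v * h2 + w * h3

theorem th_isIntegral : IsIntegral ℤ (Q.th f).1.1 ∧ IsIntegral ℤ (Q.th f).1.2 ∧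
    IsIntegral ℤ (Q.th f).2.1 ∧ IsIntegral ℤ (Q.th f).2.2 := by
  obtain ⟨h0, h1, h2, h3⟩ := Q.two_mul_th f
  obtain ⟨k, hk⟩ := disc_modEq f
  rw [hf] at hk
  subst hk
  simp only [Q.isIntegral_iff hD]
  obtain ⟨j, hj⟩ := Int.even_mul_succ_self f.1.2
  obtain ⟨l, hl⟩ := Int.even_mul_succ_self f.2.1
  refine ⟨⟨_, _, h0, ?_⟩, ⟨_, _, h1, ?_⟩, ⟨_, _, h2, ?_⟩, ⟨_, _, h3, ?_⟩⟩ <;>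
    simp only [g₀, g₁, g₂, g₃, hB]
  · exact ⟨f.1.1 ^ 2 * f.2.2 - 2 * f.1.1 * f.1.2 * f.2.1 + f.1.2 ^ 3 - f.1.1 * k, by ring⟩
  · exact ⟨f.1.1 * f.1.2 * f.2.2 - f.1.1 * f.2.1 ^ 2 - f.1.2 * k, by ring⟩
  · exact ⟨f.1.2 ^ 2 * f.2.2 - f.1.2 * f.2.1 ^ 2 - f.2.1 * k, by ring⟩
  · exact ⟨f.1.2 * f.2.1 * f.2.2 - f.2.1 ^ 3 - f.2.2 * k, by ring⟩

theorem th_ne_zero : (Q.th f).1.1 ≠ 0 := by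
  intro h
  have h0 := (Q.two_mul_th f).1
  rw [h] at h0
  obtain ⟨h1, h2⟩ := Q.int_coord_unique hD (u := f.g₀) (v := f.1.1) (u' := 0) (v' := 0)
    (by push_cast; linear_combination -h0)
  have := f.syzygy
  rw [h1, h2] at this
  exact hA_ne_zero hD hf (by simpa using this.symm)

theorem th_area : Q.conj (Q.th f).1.1 * (Q.th f).1.2 - (Q.th f).1.1 * Q.conj (Q.th f).1.2
    = (f.hA : K) ^ 2 * Q.s := by
  obtain ⟨h0, h1, -⟩ := Q.two_mul_th f
  have c0 := congrArg Q.conj h0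
  have c1 := congrArg Q.conj h1
  simp only [map_mul, map_add, map_ofNat, map_intCast, Q.conj_s] at c0 c1
  have hA : (2 * f.hA ^ 2 : ℤ) = (f.1.2 * f.g₀ - f.1.1 * f.g₁) := by
    simp only [BCF.hA, g₀, g₁]; ring
  have hA' : (2 * f.hA ^ 2 : K) = (f.1.2 * f.g₀ - f.1.1 * f.g₁) := by exact_mod_cast hA
  apply mul_left_cancel₀ (by norm_num : (4 : K) ≠ 0)
  linear_combination -2 * Q.s * hA' - (2 * Q.conj (Q.th f).1.2) * h0 - (f.g₀ + f.1.1 * Q.s : K) * c1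
    + (2 * Q.conj (Q.th f).1.1) * h1 + (f.g₁ + f.1.2 * Q.s : K) * c0

theorem th_coord_eq_zero {m n : ℤ} (h : m * (Q.th f).1.1 + n * (Q.th f).1.2 = 0) :
    m = 0 ∧ n = 0 := by
  have hc := congrArg Q.conj h
  simp only [map_mul, map_add, map_intCast, map_zero] at hc
  have ha := Q.th_area hD hf
  have hA : (f.hA : K) ≠ 0 := by exact_mod_cast hA_ne_zero hD hf
  have hs := Q.s_ne_zero hD
  have h2 : (f.hA : K) ^ 2 * Q.s ≠ 0 := by positivity
  constructor
  · have : (m : K) * ((f.hA : K) ^ 2 * Q.s) = 0 := by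
      linear_combination -m * ha - Q.conj (Q.th f).1.2 * h + (Q.th f).1.2 * hc
    exact_mod_cast (mul_eq_zero.1 this).resolve_right h2
  · have : (n : K) * ((f.hA : K) ^ 2 * Q.s) = 0 := by
      linear_combination -n * ha + Q.conj (Q.th f).1.1 * h - (Q.th f).1.1 * hc
    exact_mod_cast (mul_eq_zero.1 this).resolve_right h2

omit hD hf in
/-- The fractional ideal generated by `θ₀` and `θ₁`. -/
noncomputable def thIdeal (f : BCF ℤ) : FractionalIdeal (𝓞 K)⁰ K :=
  FractionalIdeal.spanSingleton _ (Q.th f).1.1 + FractionalIdeal.spanSingleton _ (Q.th f).1.2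

theorem τ_mul_th : ∃ k : ℤ,
    (Q.τ hD : K) * (Q.th f).1.1 = k * (Q.th f).1.1 + f.hA * (Q.th f).1.2 ∧
    (Q.τ hD : K) * (Q.th f).1.2 = -f.hC * (Q.th f).1.1 + (k + f.hB) * (Q.th f).1.2 := by
  obtain ⟨k, hk⟩ := disc_modEq f
  have h0 := s_mul_theta₀ (Q.sq_eq_disc hf)
  have h1 := s_mul_theta₁ (Q.sq_eq_disc hf)
  simp only [hA_map, hB_map, hC_map, eq_intCast] at h0 h1
  have ht := Q.two_mul_τ hD
  have hk' : (D : K) = f.hB + 2 * k := by rw [← hf, hk]; push_cast; ring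
  rw [hk'] at ht
  unfold th
  refine ⟨k, ?_, ?_⟩ <;> apply mul_left_cancel₀ (two_ne_zero : (2 : K) ≠ 0)
  · linear_combination h0 + (theta Q.s (f.map (Int.castRingHom K))).1.1 * ht
  · linear_combination h1 + (theta Q.s (f.map (Int.castRingHom K))).1.2 * ht

theorem mem_thIdeal {x : K} :
    x ∈ Q.thIdeal f ↔ ∃ m n : ℤ, x = m * (Q.th f).1.1 + n * (Q.th f).1.2 := by
  rw [thIdeal, FractionalIdeal.mem_add]
  simp only [FractionalIdeal.mem_spanSingleton, Algebra.smul_def]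
  constructor
  · rintro ⟨_, ⟨x, rfl⟩, _, ⟨y, rfl⟩, rfl⟩
    obtain ⟨a, b, rfl⟩ := Q.exists_int_coord hD x
    obtain ⟨c, d, rfl⟩ := Q.exists_int_coord hD y
    obtain ⟨k, h0, h1⟩ := Q.τ_mul_th hD hf
    refine ⟨a + b * k - d * f.hC, b * f.hA + c + d * (k + f.hB), ?_⟩
    simp only [map_add, map_mul, map_intCast]
    push_cast
    linear_combination b * h0 + d * h1
  · rintro ⟨m, n, rfl⟩
    exact ⟨_, ⟨m, rfl⟩, _, ⟨n, rfl⟩, by simp⟩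

theorem thIdeal_pow : Q.thIdeal f ^ 3 = FractionalIdeal.spanSingleton _ ((Q.th f).1.1 ^ 2) := by
  have r1 : (Q.th f).1.1 * (Q.th f).2.1 = (Q.th f).1.2 ^ 2 := theta_rel₁ (Q.sq_eq_disc hf)
  have r2 : (Q.th f).1.1 * (Q.th f).2.2 = (Q.th f).1.2 * (Q.th f).2.1 :=
    theta_rel₂ (Q.sq_eq_disc hf)
  obtain ⟨i0, i1, i2, i3⟩ := Q.th_isIntegral hD hf
  obtain ⟨e₀, e₁, e₂, e₃, he⟩ := Q.exists_th_combination hD hf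
  have hone : FractionalIdeal.spanSingleton (𝓞 K)⁰ (Q.th f).1.1 +
      FractionalIdeal.spanSingleton (𝓞 K)⁰ (Q.th f).1.2 +
      FractionalIdeal.spanSingleton (𝓞 K)⁰ (Q.th f).2.1 +
      FractionalIdeal.spanSingleton (𝓞 K)⁰ (Q.th f).2.2 = 1 := by
    apply le_antisymm
    · have key : ∀ x : K, IsIntegral ℤ x → FractionalIdeal.spanSingleton (𝓞 K)⁰ x ≤ 1 := by
        intro x hx
        rw [FractionalIdeal.spanSingleton_le_iff_mem, FractionalIdeal.mem_one_iff]
        exact ⟨⟨x, hx⟩, rfl⟩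
      simp only [← FractionalIdeal.sup_eq_add]
      exact sup_le (sup_le (sup_le (key _ i0) (key _ i1)) (key _ i2)) (key _ i3)
    · rw [← FractionalIdeal.spanSingleton_one, FractionalIdeal.spanSingleton_le_iff_mem, ← he]
      simp only [FractionalIdeal.mem_add, FractionalIdeal.mem_spanSingleton, Algebra.smul_def]
      exact ⟨_, ⟨_, ⟨_, ⟨e₀, rfl⟩, _, ⟨e₁, rfl⟩, rfl⟩, _, ⟨e₂, rfl⟩, rfl⟩, _, ⟨e₃, rfl⟩, by simp⟩
  have hadd : ∀ I : FractionalIdeal (𝓞 K)⁰ K, I * 3 = I := fun I => by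
    rw [show (3 : FractionalIdeal (𝓞 K)⁰ K) = 1 + 1 + 1 by norm_num]
    simp only [← FractionalIdeal.sup_eq_add, sup_idem, mul_one]
  rw [← mul_one (FractionalIdeal.spanSingleton _ ((Q.th f).1.1 ^ 2)), ← hone]
  simp only [mul_add, FractionalIdeal.spanSingleton_mul_spanSingleton]
  have c1 : (Q.th f).1.1 ^ 2 * (Q.th f).2.1 = (Q.th f).1.1 * (Q.th f).1.2 ^ 2 := by
    linear_combination (Q.th f).1.1 * r1
  have c2 : (Q.th f).1.1 ^ 2 * (Q.th f).2.2 = (Q.th f).1.2 ^ 3 := by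
    linear_combination (Q.th f).1.1 * r2 + (Q.th f).1.2 * r1
  rw [c1, c2]
  simp only [← FractionalIdeal.spanSingleton_mul_spanSingleton, ← FractionalIdeal.spanSingleton_pow]
  rw [thIdeal]
  set x := FractionalIdeal.spanSingleton (𝓞 K)⁰ (Q.th f).1.1
  set y := FractionalIdeal.spanSingleton (𝓞 K)⁰ (Q.th f).1.2
  have : (x + y) ^ 3 = x ^ 3 + x ^ 2 * y * 3 + x * y ^ 2 * 3 + y ^ 3 := by ring
  rw [this, hadd, hadd]
  ring

end QuadField

open NumberField

namespace BCF

/-- The class of a form. -/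
def cls (f : BCF ℤ) : Quotient equivSetoid := Quotient.mk _ f

theorem cls_eq_iff {f f' : BCF ℤ} : cls f = cls f' ↔ Equivalent f f' := Quotient.eq

end BCF

namespace QuadField

open BCF

variable {K : Type*} [Field K] [NumberField K] {D : ℤ} (Q : QuadField K D)
  (hD : IsFundamentalDiscriminant D)

section Sub

variable {f : BCF ℤ} (hf : f.disc = D) {p q r t : ℤ} (h : p * t - q * r = 1)
include hD hf h

theorem th_sub₀ : (Q.th f).1.1 ^ 2 * (Q.th (f.sub p q r t)).1.1 =
    (p * (Q.th f).1.1 + r * (Q.th f).1.2) ^ 3 := by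
  have r1 : (Q.th f).1.1 * (Q.th f).2.1 = (Q.th f).1.2 ^ 2 := theta_rel₁ (Q.sq_eq_disc hf)
  have r2 : (Q.th f).1.1 * (Q.th f).2.2 = (Q.th f).1.2 * (Q.th f).2.1 :=
    theta_rel₂ (Q.sq_eq_disc hf)
  rw [Q.th_sub f h]
  simp only [sub, ev]
  linear_combination (3 * (Q.th f).1.1 * p * r ^ 2 + (Q.th f).1.2 * r ^ 3) * r1
    + (Q.th f).1.1 * r ^ 3 * r2

theorem th_sub₁ : (Q.th f).1.1 ^ 2 * (Q.th (f.sub p q r t)).1.2 =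
    (p * (Q.th f).1.1 + r * (Q.th f).1.2) ^ 2 * (q * (Q.th f).1.1 + t * (Q.th f).1.2) := by
  have r1 : (Q.th f).1.1 * (Q.th f).2.1 = (Q.th f).1.2 ^ 2 := theta_rel₁ (Q.sq_eq_disc hf)
  have r2 : (Q.th f).1.1 * (Q.th f).2.2 = (Q.th f).1.2 * (Q.th f).2.1 :=
    theta_rel₂ (Q.sq_eq_disc hf)
  rw [Q.th_sub f h]
  simp only [sub, ev]
  linear_combination ((Q.th f).1.1 * (2 * p * r * t + q * r ^ 2) + (Q.th f).1.2 * r ^ 2 * t) * r1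
    + (Q.th f).1.1 * r ^ 2 * t * r2

theorem exists_scaling_of_sub : ∃ κ : K, κ ≠ 0 ∧
    (Q.th (f.sub p q r t)).1.1 = κ ^ 3 * (Q.th f).1.1 ∧
    Q.thIdeal (f.sub p q r t) = FractionalIdeal.spanSingleton _ (κ ^ 2) * Q.thIdeal f := by
  have h0 := Q.th_ne_zero hD hf
  have hf' : (f.sub p q r t).disc = D := by rw [disc_sub, h, hf]; ring
  have e0 := Q.th_sub₀ hD hf h
  have e1 := Q.th_sub₁ hD hf h
  have hne : p * (Q.th f).1.1 + r * (Q.th f).1.2 ≠ 0 := fun h1 => by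
    obtain ⟨rfl, rfl⟩ := Q.th_coord_eq_zero hD hf h1
    omega
  set κ := (p * (Q.th f).1.1 + r * (Q.th f).1.2) / (Q.th f).1.1 with hκ
  have hκ0 : κ * (Q.th f).1.1 = p * (Q.th f).1.1 + r * (Q.th f).1.2 := by
    rw [hκ]; field_simp
  rw [← hκ0] at e0 e1
  have e0' : (Q.th (f.sub p q r t)).1.1 = κ ^ 2 * (p * (Q.th f).1.1 + r * (Q.th f).1.2) := by
    apply mul_left_cancel₀ (pow_ne_zero 2 h0)
    rw [e0, ← hκ0]; ring
  have e1' : (Q.th (f.sub p q r t)).1.2 = κ ^ 2 * (q * (Q.th f).1.1 + t * (Q.th f).1.2) := by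
    apply mul_left_cancel₀ (pow_ne_zero 2 h0)
    rw [e1]; ring
  refine ⟨κ, div_ne_zero hne h0, ?_, ?_⟩
  · rw [e0', ← hκ0]; ring
  · have h' : (p : K) * t - q * r = 1 := by exact_mod_cast h
    ext x
    rw [Q.mem_thIdeal hD hf', FractionalIdeal.mem_singleton_mul, e0', e1']
    simp only [Q.mem_thIdeal hD hf]
    constructor
    · rintro ⟨m, n, rfl⟩
      exact ⟨_, ⟨m * p + n * q, m * r + n * t, rfl⟩, by push_cast; ring⟩
    · rintro ⟨_, ⟨m, n, rfl⟩, rfl⟩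
      refine ⟨t * m - q * n, -r * m + p * n, ?_⟩
      push_cast
      linear_combination -κ ^ 2 * (m * (Q.th f).1.1 + n * (Q.th f).1.2) * h'

end Sub

include hD in
theorem norm_pos_or {x : K} (hx : x ≠ 0) : ∃ ν : ℚ, ν ≠ 0 ∧ x * Q.conj x = ν ∧
    (ν < 0 → 0 < D) := by
  obtain ⟨u, v, rfl⟩ := Q.span x
  refine ⟨u ^ 2 - D * v ^ 2, ?_, ?_, ?_⟩
  · intro h
    have : ((u : K) + v * Q.s) * Q.conj (u + v * Q.s) = 0 := by
      have h' : (u : K) ^ 2 - D * v ^ 2 = 0 := by exact_mod_cast h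
      rw [Q.conj_coe]; linear_combination h' - v ^ 2 * Q.sq
    rcases mul_eq_zero.1 this with h | h
    · exact hx h
    · exact hx ((map_eq_zero Q.conj).1 h)
  · rw [Q.conj_coe]; push_cast; linear_combination - (v : K) ^ 2 * Q.sq
  · intro h
    by_contra hD0
    have : (D : ℚ) ≤ 0 := by exact_mod_cast not_lt.1 hD0
    nlinarith [sq_nonneg u, sq_nonneg v]

include hD in
theorem equivalent_of_scaling {f f' : BCF ℤ} (hf : f.disc = D) (hf' : f'.disc = D) {κ : K}
    (hκ : κ ≠ 0) (h0 : (Q.th f').1.1 = κ ^ 3 * (Q.th f).1.1)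
    (hJ : Q.thIdeal f' = FractionalIdeal.spanSingleton _ (κ ^ 2) * Q.thIdeal f) :
    Equivalent f f' := by
  have hmem : ∀ x : K, (∃ m n : ℤ, x = m * (Q.th f').1.1 + n * (Q.th f').1.2) ↔
      ∃ m n : ℤ, x = κ ^ 2 * (m * (Q.th f).1.1 + n * (Q.th f).1.2) := by
    intro x
    rw [← Q.mem_thIdeal hD hf', hJ, FractionalIdeal.mem_singleton_mul]
    simp only [Q.mem_thIdeal hD hf]
    constructor
    · rintro ⟨_, ⟨m, n, rfl⟩, rfl⟩; exact ⟨m, n, rfl⟩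
    · rintro ⟨m, n, rfl⟩; exact ⟨_, ⟨m, n, rfl⟩, rfl⟩
  have hκ2 : κ ^ 2 ≠ 0 := pow_ne_zero 2 hκ
  obtain ⟨p, r, e0⟩ := (hmem (Q.th f').1.1).1 ⟨1, 0, by simp⟩
  obtain ⟨q, t, e1⟩ := (hmem (Q.th f').1.2).1 ⟨0, 1, by simp⟩
  obtain ⟨p', r', e2⟩ := (hmem (κ ^ 2 * (Q.th f).1.1)).2 ⟨1, 0, by simp⟩
  obtain ⟨q', t', e3⟩ := (hmem (κ ^ 2 * (Q.th f).1.2)).2 ⟨0, 1, by simp⟩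
  rw [e0, e1] at e2 e3
  have z2 := Q.th_coord_eq_zero hD hf (m := p' * p + r' * q - 1) (n := p' * r + r' * t) (by
    apply mul_left_cancel₀ hκ2; push_cast; linear_combination -e2)
  have z3 := Q.th_coord_eq_zero hD hf (m := q' * p + t' * q) (n := q' * r + t' * t - 1) (by
    apply mul_left_cancel₀ hκ2; push_cast; linear_combination -e3)
  have hdet : (p * t - q * r) * (p' * t' - q' * r') = 1 := by
    linear_combination (q' * r + t' * t) * z2.1 + z3.2 - (p' * r + r' * t) * z3.1
  have a' := Q.th_area hD hf'
  have a := Q.th_area hD hf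
  obtain ⟨ν, hν0, hν, -⟩ := Q.norm_pos_or hD hκ
  have hA : (f'.hA : ℚ) ^ 2 = ν ^ 2 * (p * t - q * r : ℤ) * (f.hA : ℚ) ^ 2 := by
    have : (f'.hA : K) ^ 2 = (ν : K) ^ 2 * (p * t - q * r : ℤ) * (f.hA : K) ^ 2 := by
      apply mul_right_cancel₀ (Q.s_ne_zero hD)
      rw [← a', e0, e1, ← hν]
      simp only [map_mul, map_add, map_pow, map_intCast]
      push_cast
      linear_combination (κ * Q.conj κ) ^ 2 * (p * t - q * r) * a
    exact_mod_cast this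
  have hpos : (0 : ℚ) < (p * t - q * r : ℤ) := by
    have h1 : (0 : ℚ) < (f'.hA : ℚ) ^ 2 := by
      have : (f'.hA : ℚ) ≠ 0 := by exact_mod_cast hA_ne_zero hD hf'
      positivity
    rw [hA] at h1
    have h2 : (0 : ℚ) < (f.hA : ℚ) ^ 2 := by
      have : (f.hA : ℚ) ≠ 0 := by exact_mod_cast hA_ne_zero hD hf
      positivity
    have h3 : 0 < ν ^ 2 := by positivity
    by_contra hc
    push Not at hc
    nlinarith [mul_pos h3 h2]
  have hdet1 : p * t - q * r = 1 := by
    have : 0 < p * t - q * r := by exact_mod_cast hpos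
    rcases Int.isUnit_iff.1 (IsUnit.of_mul_eq_one _ hdet) with h | h <;> omega
  refine ⟨p, q, r, t, hdet1, ?_⟩
  have s0 := Q.th_sub₀ hD hf hdet1
  have s1 := Q.th_sub₁ hD hf hdet1
  have hne := Q.th_ne_zero hD hf
  have hκ0 : p * (Q.th f).1.1 + r * (Q.th f).1.2 = κ * (Q.th f).1.1 := by
    apply mul_left_cancel₀ hκ2
    rw [← e0, h0]; ring
  have t0 : (Q.th (f.sub p q r t)).1.1 = (Q.th f').1.1 := by
    apply mul_left_cancel₀ (pow_ne_zero 2 hne)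
    rw [s0, hκ0, h0]; ring
  have t1 : (Q.th (f.sub p q r t)).1.2 = (Q.th f').1.2 := by
    apply mul_left_cancel₀ (pow_ne_zero 2 hne)
    rw [s1, hκ0, e1]; ring
  have hf'' : (f.sub p q r t).disc = D := by rw [disc_sub, hdet1, hf]; ring
  have hne' := Q.th_ne_zero hD hf'
  have t2 : (Q.th (f.sub p q r t)).2.1 = (Q.th f').2.1 := by
    apply mul_left_cancel₀ hne'
    have r1 : (Q.th f').1.1 * (Q.th f').2.1 = (Q.th f').1.2 ^ 2 := theta_rel₁ (Q.sq_eq_disc hf')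
    have r2 : (Q.th (f.sub p q r t)).1.1 * (Q.th (f.sub p q r t)).2.1
      = (Q.th (f.sub p q r t)).1.2 ^ 2 := theta_rel₁ (Q.sq_eq_disc hf'')
    rw [r1, ← t0, r2, t1]
  have t3 : (Q.th (f.sub p q r t)).2.2 = (Q.th f').2.2 := by
    apply mul_left_cancel₀ hne'
    have r1 : (Q.th f').1.1 * (Q.th f').2.2 = (Q.th f').1.2 * (Q.th f').2.1 :=
      theta_rel₂ (Q.sq_eq_disc hf')
    have r2 : (Q.th (f.sub p q r t)).1.1 * (Q.th (f.sub p q r t)).2.2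
      = (Q.th (f.sub p q r t)).1.2 * (Q.th (f.sub p q r t)).2.1 := theta_rel₂ (Q.sq_eq_disc hf'')
    rw [r1, ← t0, r2, t1, t2]
  obtain ⟨x0, x1, x2, x3⟩ := Q.two_mul_th f'
  obtain ⟨y0, y1, y2, y3⟩ := Q.two_mul_th (f.sub p q r t)
  rw [t0, x0] at y0
  rw [t1, x1] at y1
  rw [t2, x2] at y2
  rw [t3, x3] at y3
  exact Prod.ext (Prod.ext (Q.int_coord_unique hD y0).2 (Q.int_coord_unique hD y1).2)
    (Prod.ext (Q.int_coord_unique hD y2).2 (Q.int_coord_unique hD y3).2)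

end QuadField

open NumberField

theorem BCF.theta_sub_diag {K : Type*} [Field K] [CharZero K] {s α β α' β' ε ε' n : K}
    (hs : s ≠ 0) (hε : ε ≠ 0) (hε' : ε' ≠ 0) (hdet : α * β' - β * α' = -n * s)
    (hn : ε * ε' = n ^ 3) :
    theta s (BCF.sub (((ε * s)⁻¹, 0), (0, -(ε' * s)⁻¹)) α β α' β') =
      ((α ^ 3 / ε, α ^ 2 * β / ε), (α * β ^ 2 / ε, β ^ 3 / ε)) ∧
    (BCF.sub (((ε * s)⁻¹, 0), (0, -(ε' * s)⁻¹)) α β α' β').disc = s ^ 2 := by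
  constructor
  · rw [theta, cov_sub, hdet]
    have h : (-n * s) ^ 3 = -(ε * ε' * s ^ 3) := by rw [hn]; ring
    rw [h]
    ext <;> simp [sub, ev, cov, g₀, g₁, g₂, g₃] <;> field_simp <;> ring
  · rw [disc_sub, hdet]
    have h : (-n * s) ^ 6 = (ε * ε') ^ 2 * s ^ 6 := by rw [hn]; ring
    rw [h]
    simp only [disc]
    field_simp
    ring

namespace QuadField

open BCF

variable {K : Type*} [Field K] [NumberField K] {D : ℤ} (Q : QuadField K D)
variable (hD : IsFundamentalDiscriminant D)
include hD

theorem exists_form_of_ideal {M : Ideal (𝓞 K)} (hM : M ≠ ⊥) {ε : K}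
    (hε : (M : FractionalIdeal (𝓞 K)⁰ K) ^ 3 = FractionalIdeal.spanSingleton _ ε)
    (hN : ε * Q.conj ε = (Ideal.absNorm M : K) ^ 3) :
    ∃ f : BCF ℤ, f.disc = D ∧ ∃ α : K, α ≠ 0 ∧ (Q.th f).1.1 = α ^ 3 / ε ∧
      Q.thIdeal f = FractionalIdeal.spanSingleton _ (α ^ 2 / ε) * (M : FractionalIdeal (𝓞 K)⁰ K) := by
  obtain ⟨β, α, hmem, hdet⟩ := Q.exists_oriented_basis hD hM
  have hs := Q.s_ne_zero hD
  have hn : (Ideal.absNorm M : K) ≠ 0 := by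
    exact_mod_cast Ideal.absNorm_ne_zero_iff_mem_nonZeroDivisors.2
      (mem_nonZeroDivisors_iff_ne_zero.2 hM)
  have hεε : ε * Q.conj ε ≠ 0 := by rw [hN]; positivity
  have hε0 := left_ne_zero_of_mul hεε
  have hε0' := right_ne_zero_of_mul hεε
  have hα0 : α ≠ 0 := by
    rintro rfl
    simp only [map_zero, mul_zero, sub_self] at hdet
    exact mul_ne_zero (by exact_mod_cast hn) hs hdet.symm
  have hα : α ∈ (M : FractionalIdeal (𝓞 K)⁰ K) := by
    obtain ⟨y, hy, e⟩ := (hmem α).2 ⟨0, 1, by simp⟩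
    rw [← e]; exact FractionalIdeal.mem_coeIdeal_of_mem _ hy
  have hβ : β ∈ (M : FractionalIdeal (𝓞 K)⁰ K) := by
    obtain ⟨y, hy, e⟩ := (hmem β).2 ⟨1, 0, by simp⟩
    rw [← e]; exact FractionalIdeal.mem_coeIdeal_of_mem _ hy
  have hcube : ∀ x y z : K, x ∈ (M : FractionalIdeal (𝓞 K)⁰ K) →
      y ∈ (M : FractionalIdeal (𝓞 K)⁰ K) → z ∈ (M : FractionalIdeal (𝓞 K)⁰ K) →
      ∃ m n : ℤ, 2 * (x * y * z / ε) = m + n * Q.s := by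
    intro x y z hx hy hz
    have h : x * y * z ∈ (M : FractionalIdeal (𝓞 K)⁰ K) ^ 3 := by
      rw [pow_succ, pow_two]
      exact FractionalIdeal.mul_mem_mul (FractionalIdeal.mul_mem_mul hx hy) hz
    rw [hε, FractionalIdeal.mem_spanSingleton] at h
    obtain ⟨w, hw⟩ := h
    rw [Algebra.smul_def] at hw
    have : x * y * z / ε = w := by rw [← hw]; field_simp
    rw [this]
    obtain ⟨m, n, h, -⟩ := (Q.isIntegral_iff hD).1 w.isIntegral_coe
    exact ⟨m, n, h⟩
  obtain ⟨m0, a0, e0⟩ := hcube α α α hα hα hα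
  obtain ⟨m1, a1, e1⟩ := hcube α α β hα hα hβ
  obtain ⟨m2, a2, e2⟩ := hcube α β β hα hβ hβ
  obtain ⟨m3, a3, e3⟩ := hcube β β β hβ hβ hβ
  have hdet' : α * Q.conj β - β * Q.conj α = -(Ideal.absNorm M : K) * Q.s := by
    push_cast at hdet; linear_combination -hdet
  obtain ⟨hth, hdisc⟩ := theta_sub_diag hs hε0 hε0' hdet' hN
  set f : BCF ℤ := ((a0, a1), (a2, a3)) with hf
  have key : ∀ (x y z : K) (m n : ℤ), 2 * (x * y * z / ε) = m + n * Q.s →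
      (n : K) = (x * y * z * (ε * Q.s)⁻¹ - Q.conj x * Q.conj y * Q.conj z *
        (Q.conj ε * Q.s)⁻¹) := by
    intro x y z m n h
    have hc := congrArg Q.conj h
    simp only [map_mul, map_div₀, map_add, map_ofNat, map_intCast, Q.conj_s] at hc
    apply mul_right_cancel₀ hs
    apply mul_left_cancel₀ (two_ne_zero : (2 : K) ≠ 0)
    field_simp at h hc ⊢
    linear_combination -(Q.conj ε / 2) * h + ε / 2 * hc
  have hmap : f.map (Int.castRingHom K) =
      BCF.sub (((ε * Q.s)⁻¹, 0), (0, -(Q.conj ε * Q.s)⁻¹)) α β (Q.conj α) (Q.conj β) := by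
    ext <;> simp only [hf, BCF.map, sub, ev, eq_intCast]
    · rw [key _ _ _ _ _ e0]; ring
    · rw [key _ _ _ _ _ e1]; ring
    · rw [key _ _ _ _ _ e2]; ring
    · rw [key _ _ _ _ _ e3]; ring
  rw [← hmap] at hth hdisc
  have hfD : f.disc = D := by
    rw [disc_map, Q.sq, eq_intCast] at hdisc
    exact_mod_cast hdisc
  have t0 : (Q.th f).1.1 = α ^ 3 / ε := by rw [th, hth]
  have t1 : (Q.th f).1.2 = α ^ 2 * β / ε := by rw [th, hth]
  refine ⟨f, hfD, α, hα0, t0, ?_⟩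
  have hMspan : (M : FractionalIdeal (𝓞 K)⁰ K) =
      FractionalIdeal.spanSingleton _ α + FractionalIdeal.spanSingleton _ β := by
    apply le_antisymm
    · intro x hx
      obtain ⟨y, hy, rfl⟩ := (FractionalIdeal.mem_coeIdeal _).1 hx
      obtain ⟨m, n, e⟩ := (hmem (y : K)).1 ⟨y, hy, rfl⟩
      rw [FractionalIdeal.mem_add]
      simp only [FractionalIdeal.mem_spanSingleton, Algebra.smul_def]
      refine ⟨_, ⟨n, rfl⟩, _, ⟨m, rfl⟩, ?_⟩
      simp only [map_intCast]
      exact (add_comm _ _).trans e.symm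
    · rw [← FractionalIdeal.sup_eq_add]
      exact sup_le (FractionalIdeal.spanSingleton_le_iff_mem.2 hα)
        (FractionalIdeal.spanSingleton_le_iff_mem.2 hβ)
  rw [show Q.thIdeal f = _ + _ from rfl, t0, t1, hMspan, mul_add, FractionalIdeal.spanSingleton_mul_spanSingleton,
    FractionalIdeal.spanSingleton_mul_spanSingleton]
  congr 2 <;> ring

theorem exists_form_of_cube {δ : K} (hδ : δ ≠ 0) {I : (FractionalIdeal (𝓞 K)⁰ K)ˣ}
    (hI : (I : FractionalIdeal (𝓞 K)⁰ K) ^ 3 = FractionalIdeal.spanSingleton _ δ) :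
    ∃ f : BCF ℤ, f.disc = D ∧ ∃ κ : K, κ ≠ 0 ∧ (Q.th f).1.1 = δ * κ ^ 3 ∧
      FractionalIdeal.spanSingleton _ κ * (I : FractionalIdeal (𝓞 K)⁰ K) * Q.thIdeal f =
        FractionalIdeal.spanSingleton _ (Q.th f).1.1 := by
  have main : ∀ c : K, c ≠ 0 → ∀ M : Ideal (𝓞 K),
      (M : FractionalIdeal (𝓞 K)⁰ K) = FractionalIdeal.spanSingleton _ c * ((I⁻¹ : (_)ˣ) : FractionalIdeal (𝓞 K)⁰ K) →
      (∀ ν : ℚ, c ^ 3 / δ * Q.conj (c ^ 3 / δ) = ν → 0 < ν) →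
      ∃ f : BCF ℤ, f.disc = D ∧ ∃ κ : K, κ ≠ 0 ∧ (Q.th f).1.1 = δ * κ ^ 3 ∧
      FractionalIdeal.spanSingleton _ κ * (I : FractionalIdeal (𝓞 K)⁰ K) * Q.thIdeal f =
        FractionalIdeal.spanSingleton _ (Q.th f).1.1 := by
    intro c hc M hM hpos
    have hM0 : M ≠ ⊥ := by
      rintro rfl
      rw [FractionalIdeal.coeIdeal_bot] at hM
      have := congrArg (· * (I : FractionalIdeal (𝓞 K)⁰ K)) hM
      simp only [zero_mul, mul_assoc, Units.inv_mul, mul_one] at this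
      exact hc (FractionalIdeal.spanSingleton_eq_zero_iff.1 this.symm)
    have hI' : ((I⁻¹ : (_)ˣ) : FractionalIdeal (𝓞 K)⁰ K) ^ 3 =
        FractionalIdeal.spanSingleton _ δ⁻¹ := by
      have h1 : ((I⁻¹ : (_)ˣ) : FractionalIdeal (𝓞 K)⁰ K) ^ 3 * (I : FractionalIdeal (𝓞 K)⁰ K) ^ 3
        = 1 := by rw [← mul_pow, Units.inv_mul, one_pow]
      calc _ = ((I⁻¹ : (_)ˣ) : FractionalIdeal (𝓞 K)⁰ K) ^ 3 *
          (FractionalIdeal.spanSingleton _ δ * FractionalIdeal.spanSingleton _ δ⁻¹) := by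
            rw [FractionalIdeal.spanSingleton_mul_spanSingleton, mul_inv_cancel₀ hδ,
              FractionalIdeal.spanSingleton_one, mul_one]
        _ = _ := by rw [← mul_assoc, ← hI, h1, one_mul]
    have hε : (M : FractionalIdeal (𝓞 K)⁰ K) ^ 3 =
        FractionalIdeal.spanSingleton _ (c ^ 3 / δ) := by
      rw [hM, mul_pow, hI', FractionalIdeal.spanSingleton_pow,
        FractionalIdeal.spanSingleton_mul_spanSingleton, div_eq_mul_inv]
    have hN : c ^ 3 / δ * Q.conj (c ^ 3 / δ) = (Ideal.absNorm M : K) ^ 3 := by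
      have hε0 : c ^ 3 / δ ≠ 0 := by positivity
      have hmem : c ^ 3 / δ ∈ (M : FractionalIdeal (𝓞 K)⁰ K) ^ 3 := by
        rw [hε]; exact FractionalIdeal.mem_spanSingleton_self _ _
      rw [← FractionalIdeal.coeIdeal_pow, FractionalIdeal.mem_coeIdeal] at hmem
      obtain ⟨e, -, he⟩ := hmem
      rw [← he] at hε hε0 hpos ⊢
      have he0 : e ≠ 0 := by rintro rfl; simp at hε0
      have hspan : M ^ 3 = Ideal.span {e} := by
        apply FractionalIdeal.coeIdeal_injective (K := K)
        show ((M ^ 3 : Ideal (𝓞 K)) : FractionalIdeal (𝓞 K)⁰ K) = _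
        rw [FractionalIdeal.coeIdeal_pow, hε]
        exact (FractionalIdeal.coeIdeal_span_singleton _).symm
      obtain ⟨n, hn, h⟩ := Q.absNorm_span_singleton hD he0
      have hnpos : (0 : ℚ) < n := hpos n (by rw [h]; simp)
      rw [← hspan, map_pow] at hn
      have : n = (Ideal.absNorm M : ℤ) ^ 3 := by
        have : 0 < n := by exact_mod_cast hnpos
        rw [← Int.natAbs_of_nonneg this.le, hn]; push_cast; rfl
      rw [h, this]; push_cast; rfl
    obtain ⟨f, hf, α, hα, h1, h2⟩ := Q.exists_form_of_ideal hD hM0 hε hN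
    refine ⟨f, hf, α / c, by positivity, ?_, ?_⟩
    · rw [h1]; field_simp
    · rw [h2, hM, h1]
      calc _ = FractionalIdeal.spanSingleton _ (α / c) * FractionalIdeal.spanSingleton _
            (α ^ 2 / (c ^ 3 / δ)) * FractionalIdeal.spanSingleton _ c *
            ((I : FractionalIdeal (𝓞 K)⁰ K) * ((I⁻¹ : (_)ˣ) : FractionalIdeal (𝓞 K)⁰ K)) := by ring
        _ = _ := by
          rw [Units.mul_inv, mul_one]
          simp only [FractionalIdeal.spanSingleton_mul_spanSingleton]
          congr 1
          field_simp
  obtain ⟨a, M, ha, hM⟩ := FractionalIdeal.exists_eq_spanSingleton_mul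
    ((I⁻¹ : (_)ˣ) : FractionalIdeal (𝓞 K)⁰ K)
  have ha' : (a : K) ≠ 0 := by simpa using ha
  have hM' : (M : FractionalIdeal (𝓞 K)⁰ K) =
      FractionalIdeal.spanSingleton _ (a : K) * ((I⁻¹ : (_)ˣ) : FractionalIdeal (𝓞 K)⁰ K) := by
    rw [hM, ← mul_assoc, FractionalIdeal.spanSingleton_mul_spanSingleton, mul_inv_cancel₀ ha',
      FractionalIdeal.spanSingleton_one, one_mul]
  obtain ⟨ν, hν0, hν, hνD⟩ := Q.norm_pos_or hD (x := (a : K) ^ 3 / δ) (by positivity)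
  rcases lt_or_gt_of_ne hν0 with h | h
  · have hs := Q.s_ne_zero hD
    have hsi : IsIntegral ℤ Q.s := (Q.isIntegral_iff hD).2 ⟨0, 2, by simp, by omega⟩
    obtain ⟨s, hs'⟩ : ∃ s : 𝓞 K, (s : K) = Q.s := ⟨⟨Q.s, hsi⟩, rfl⟩
    refine main (a * Q.s) (mul_ne_zero ha' hs) (Ideal.span {s} * M) ?_ ?_
    · rw [FractionalIdeal.coeIdeal_mul, hM', FractionalIdeal.coeIdeal_span_singleton,
        ← mul_assoc, FractionalIdeal.spanSingleton_mul_spanSingleton, mul_comm (a : K), ← hs']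
    · intro μ hμ
      have : (μ : K) = ((-D) ^ 3 * ν : ℚ) := by
        push_cast
        rw [← hμ, ← hν, mul_pow, mul_div_right_comm, map_mul, map_pow Q.conj Q.s, Q.conj_s]
        linear_combination -((a : K) ^ 3 / δ * Q.conj (a ^ 3 / δ)) *
          (Q.s ^ 4 + Q.s ^ 2 * D + D ^ 2) * Q.sq
      have : μ = (-D) ^ 3 * ν := by exact_mod_cast this
      have hDpos : (0 : ℚ) < D := by exact_mod_cast hνD h
      rw [this]
      have h3 : (0 : ℚ) < D ^ 3 := by positivity
      nlinarith
  · refine main a ha' M hM' ?_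
    intro μ hμ
    rw [hν] at hμ
    have : ν = μ := by exact_mod_cast hμ
    rwa [← this]

end QuadField

open NumberField

theorem coe_mul_cubeGroupOfUnit_snd {R K : Type*} [CommRing R] [IsDomain R] [Field K] [Algebra R K]
    [IsFractionRing R K] (p : cubeGroup R K) (κ : Kˣ) :
    ((p * cubeGroupOfUnit R K κ).1.2 : FractionalIdeal R⁰ K) =
      (p.1.2 : FractionalIdeal R⁰ K) * FractionalIdeal.spanSingleton _ (κ : K) := by
  rw [← coe_toPrincipalIdeal]; rfl

namespace QuadField

open BCF

variable {K : Type*} [Field K] [NumberField K] {D : ℤ} (Q : QuadField K D)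
variable (hD : IsFundamentalDiscriminant D)
include hD

/-- The element of `cubeGroup` attached to a form of discriminant `D`. -/
theorem exists_thPair (f : {f : BCF ℤ // f.disc = D}) : ∃ p : cubeGroup (𝓞 K) K,
    (p.1.1 : K) = (Q.th f.1).1.1 ∧ (p.1.2 : FractionalIdeal (𝓞 K)⁰ K) * Q.thIdeal f.1 =
      FractionalIdeal.spanSingleton _ (Q.th f.1).1.1 := by
  obtain ⟨f, hf⟩ := f
  have h0 := Q.th_ne_zero hD hf
  have h3 := Q.thIdeal_pow hD hf
  have hJ0 : Q.thIdeal f ≠ 0 := by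
    intro h
    rw [h, zero_pow (by norm_num), eq_comm, FractionalIdeal.spanSingleton_eq_zero_iff] at h3
    exact pow_ne_zero 2 h0 h3
  set x := Units.mk0 _ h0
  set J := Units.mk0 _ hJ0
  have hJ : J ^ 3 = toPrincipalIdeal (𝓞 K) K (x ^ 2) := by
    symm
    rw [toPrincipalIdeal_eq_iff]
    exact h3.symm
  refine ⟨⟨(x, toPrincipalIdeal (𝓞 K) K x * J⁻¹), ?_⟩, rfl, ?_⟩
  · rw [mem_cubeGroup, mul_pow, inv_pow, hJ, ← map_pow, ← map_inv, ← map_mul]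
    congr 1
    group
  · have : toPrincipalIdeal (𝓞 K) K x * J⁻¹ * J = toPrincipalIdeal (𝓞 K) K x := by group
    have := congrArg Units.val this
    rw [Units.val_mul, coe_toPrincipalIdeal] at this
    exact this

/-- The element of `cubeGroup` attached to a form of discriminant `D`. -/
noncomputable def thPair (f : {f : BCF ℤ // f.disc = D}) : cubeGroup (𝓞 K) K :=
  (Q.exists_thPair hD f).choose

theorem thPair_fst (f : {f : BCF ℤ // f.disc = D}) :
    ((Q.thPair hD f).1.1 : K) = (Q.th f.1).1.1 := (Q.exists_thPair hD f).choose_spec.1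

theorem thPair_snd (f : {f : BCF ℤ // f.disc = D}) :
    ((Q.thPair hD f).1.2 : FractionalIdeal (𝓞 K)⁰ K) * Q.thIdeal f.1 =
      FractionalIdeal.spanSingleton _ (Q.th f.1).1.1 := (Q.exists_thPair hD f).choose_spec.2

/-- The class in `cubeGroup` modulo trivial pairs attached to a form of discriminant `D`. -/
noncomputable def thClass (f : {f : BCF ℤ // f.disc = D}) :
    cubeGroup (𝓞 K) K ⧸ (cubeGroupOfUnit (𝓞 K) K).range :=
  QuotientGroup.mk (Q.thPair hD f)

theorem thClass_surjective : Function.Surjective (Q.thClass hD) := by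
  intro p
  induction p using QuotientGroup.induction_on with | _ p
  obtain ⟨⟨δ, I⟩, hp⟩ := p
  have hI : (I : FractionalIdeal (𝓞 K)⁰ K) ^ 3 = FractionalIdeal.spanSingleton _ (δ : K) := by
    have := congrArg Units.val (mem_cubeGroup.1 hp)
    rwa [coe_toPrincipalIdeal] at this
  obtain ⟨f, hf, κ, hκ, h1, h2⟩ := Q.exists_form_of_cube hD δ.ne_zero hI
  refine ⟨⟨f, hf⟩, ?_⟩
  symm
  rw [thClass, QuotientGroup.eq]
  refine ⟨Units.mk0 κ hκ, ?_⟩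
  rw [eq_inv_mul_iff_mul_eq]
  apply Subtype.ext
  apply Prod.ext
  · apply Units.ext
    exact h1.symm.trans (Q.thPair_fst hD ⟨f, hf⟩).symm
  · apply Units.ext
    have h3 := Q.thPair_snd hD ⟨f, hf⟩
    have hJ0 : Q.thIdeal f ≠ 0 := by
      rintro h
      rw [h, mul_zero, eq_comm, FractionalIdeal.spanSingleton_eq_zero_iff] at h3
      exact Q.th_ne_zero hD hf h3
    apply mul_right_cancel₀ hJ0
    rw [h3, ← h2, mul_comm (FractionalIdeal.spanSingleton _ κ), coe_mul_cubeGroupOfUnit_snd]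
    rfl

theorem thClass_eq_iff (f f' : {f : BCF ℤ // f.disc = D}) :
    Q.thClass hD f = Q.thClass hD f' ↔ Equivalent f.1 f'.1 := by
  have h3 := Q.thPair_snd hD f
  have h3' := Q.thPair_snd hD f'
  have hJ0 : Q.thIdeal f.1 ≠ 0 := by
    rintro h
    rw [h, mul_zero, eq_comm, FractionalIdeal.spanSingleton_eq_zero_iff] at h3
    exact Q.th_ne_zero hD f.2 h3
  have hJ0' : Q.thIdeal f'.1 ≠ 0 := by
    rintro h
    rw [h, mul_zero, eq_comm, FractionalIdeal.spanSingleton_eq_zero_iff] at h3'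
    exact Q.th_ne_zero hD f'.2 h3'
  rw [thClass, thClass, QuotientGroup.eq]
  have hs0 : FractionalIdeal.spanSingleton (𝓞 K)⁰ (Q.th f.1).1.1 ≠ 0 := fun h =>
    Q.th_ne_zero hD f.2 (FractionalIdeal.spanSingleton_eq_zero_iff.1 h)
  constructor
  · rintro ⟨κ, hκ⟩
    rw [eq_inv_mul_iff_mul_eq] at hκ
    have e1 : ((Q.thPair hD f).1.1 : K) * (κ : K) ^ 3 = (Q.thPair hD f').1.1 :=
      congrArg (fun p : cubeGroup (𝓞 K) K => (p.1.1 : K)) hκ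
    have e2 : ((Q.thPair hD f).1.2 : FractionalIdeal (𝓞 K)⁰ K) *
        FractionalIdeal.spanSingleton _ (κ : K) = ((Q.thPair hD f').1.2 : FractionalIdeal (𝓞 K)⁰ K) :=
      (coe_mul_cubeGroupOfUnit_snd _ κ).symm.trans
        (congrArg (fun p : cubeGroup (𝓞 K) K => (p.1.2 : FractionalIdeal (𝓞 K)⁰ K)) hκ)
    rw [thPair_fst, thPair_fst] at e1
    refine Q.equivalent_of_scaling hD f.2 f'.2 κ.ne_zero (by rw [← e1]; ring) ?_
    rw [← e2, ← e1] at h3'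
    apply mul_left_cancel₀ (Units.ne_zero (Q.thPair hD f).1.2)
    have hκ0 : FractionalIdeal.spanSingleton (𝓞 K)⁰ (κ : K) ≠ 0 := fun h =>
      κ.ne_zero (FractionalIdeal.spanSingleton_eq_zero_iff.1 h)
    apply mul_left_cancel₀ hκ0
    simp only [← FractionalIdeal.spanSingleton_mul_spanSingleton,
      ← FractionalIdeal.spanSingleton_pow] at h3' ⊢
    rw [← h3] at h3'
    calc _ = ((Q.thPair hD f).1.2 : FractionalIdeal (𝓞 K)⁰ K) *
          FractionalIdeal.spanSingleton (𝓞 K)⁰ (κ : K) * Q.thIdeal f'.1 := by ring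
      _ = _ := by rw [h3']; ring
  · rintro ⟨p, q, r, t, hdet, hsub⟩
    obtain ⟨κ, hκ, h1, h2⟩ := Q.exists_scaling_of_sub hD f.2 hdet
    rw [← hsub] at h1 h2
    refine ⟨Units.mk0 κ hκ, ?_⟩
    rw [eq_inv_mul_iff_mul_eq]
    apply Subtype.ext
    apply Prod.ext
    · apply Units.ext
      refine Eq.trans ?_ (Q.thPair_fst hD f').symm
      rw [h1, mul_comm, ← Q.thPair_fst hD f]
      rfl
    · apply Units.ext
      apply mul_right_cancel₀ hJ0'
      rw [h3', h2, h1]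
      rw [coe_mul_cubeGroupOfUnit_snd, Units.val_mk0]
      simp only [← FractionalIdeal.spanSingleton_mul_spanSingleton,
        ← FractionalIdeal.spanSingleton_pow]
      rw [← h3]
      ring

include Q in
/-- The number of classes of forms of discriminant `D`. -/
theorem ncard_cls : Set.ncard (cls '' {f : BCF ℤ | f.disc = D}) =
    Nat.card {x : ClassGroup (𝓞 K) // x ^ 3 = 1} *
      Nat.card ((𝓞 K)ˣ ⧸ (powMonoidHom 3 : (𝓞 K)ˣ →* (𝓞 K)ˣ).range) := by
  rw [← card_cubeGroup_quotient (𝓞 K) K, ← Nat.card_coe_set_eq]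
  have hex : ∀ x : cls '' {f : BCF ℤ | f.disc = D}, ∃ f : {f : BCF ℤ // f.disc = D},
      cls f.1 = x.1 := fun ⟨x, f, hf, h⟩ => ⟨⟨f, hf⟩, h⟩
  choose F hF using hex
  refine Nat.card_congr (Equiv.ofBijective (fun x => Q.thClass hD (F x)) ⟨?_, ?_⟩)
  · intro x y hxy
    have := (Q.thClass_eq_iff hD _ _).1 hxy
    rw [← cls_eq_iff, hF, hF] at this
    exact Subtype.ext this
  · intro p
    obtain ⟨f, rfl⟩ := Q.thClass_surjective hD p
    refine ⟨⟨cls f.1, f.1, f.2, rfl⟩, ?_⟩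
    rw [thClass_eq_iff, ← cls_eq_iff, hF]

end QuadField

open IntermediateField NumberField

theorem isIntegral_sqrtD (d : ℤ) : IsIntegral ℚ (sqrtD d) :=
  IsIntegral.of_pow two_pos (by
    rw [sqrtD_sq, ← Rat.cast_intCast]
    exact isIntegral_algebraMap (A := ℂ) (x := (d : ℚ)))

theorem minpoly_sqrtD {d : ℤ} (hd : IsFundamentalDiscriminant d) :
    minpoly ℚ (sqrtD d) = Polynomial.X ^ 2 - Polynomial.C (d : ℚ) :=
  (minpoly.eq_of_irreducible_of_monic (X_pow_sub_C_irreducible_of_prime Nat.prime_two hd.not_sq)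
    (by simp [sqrtD_sq d]) (Polynomial.monic_X_pow_sub_C _ two_ne_zero)).symm

theorem exists_coord_of_mem_Kd {d : ℤ} {x : ℂ} (hx : x ∈ Kd d) :
    ∃ u v : ℚ, x = u + v * sqrtD d := by
  have h : x ∈ Algebra.adjoin ℚ {sqrtD d} := by
    rw [← IntermediateField.adjoin_simple_toSubalgebra_of_isAlgebraic
      (isIntegral_sqrtD d).isAlgebraic]
    exact hx
  clear hx
  induction h using Algebra.adjoin_induction with
  | mem x hx => exact ⟨0, 1, by simp [Set.mem_singleton_iff.1 hx]⟩
  | algebraMap r => exact ⟨r, 0, by simp⟩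
  | add x y _ _ h1 h2 =>
    obtain ⟨u, v, rfl⟩ := h1
    obtain ⟨u', v', rfl⟩ := h2
    exact ⟨u + u', v + v', by push_cast; ring⟩
  | mul x y _ _ h1 h2 =>
    obtain ⟨u, v, rfl⟩ := h1
    obtain ⟨u', v', rfl⟩ := h2
    refine ⟨u * u' + d * v * v', u * v' + v * u', ?_⟩
    push_cast
    linear_combination (v * v' : ℂ) * sqrtD_sq d

/-- The quadratic field structure on `Kd d`. -/
theorem nonempty_quadField {d : ℤ} (hd : IsFundamentalDiscriminant d) :
    Nonempty (QuadField (Kd d) d) := by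
  let s : Kd d := AdjoinSimple.gen ℚ (sqrtD d)
  have hs : s ^ 2 = d := by
    apply Subtype.ext
    push_cast
    exact sqrtD_sq d
  obtain ⟨φ, hφ⟩ : ∃ φ : Kd d →ₐ[ℚ] Kd d, φ s = -s := by
    have hroot : -s ∈ (minpoly ℚ (sqrtD d)).aroots (Kd d) := by
      rw [minpoly_sqrtD hd, Polynomial.mem_aroots]
      refine ⟨(Polynomial.monic_X_pow_sub_C _ two_ne_zero).ne_zero, ?_⟩
      simp [hs]
    exact ⟨(algHomAdjoinIntegralEquiv ℚ (isIntegral_sqrtD d)).symm ⟨-s, hroot⟩,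
      algHomAdjoinIntegralEquiv_symm_apply_gen ℚ (isIntegral_sqrtD d) ⟨-s, hroot⟩⟩
  refine ⟨⟨s, hs, φ, hφ, ?_⟩⟩
  rintro ⟨x, hx⟩
  obtain ⟨u, v, h⟩ := exists_coord_of_mem_Kd hx
  refine ⟨u, v, ?_⟩
  apply Subtype.ext
  push_cast
  exact h

namespace QuadField

variable {K : Type*} [Field K] [NumberField K] {D : ℤ} (Q : QuadField K D)
variable (hD : IsFundamentalDiscriminant D)
include Q hD

theorem eq_one_or_neg_one_of_lt (hD4 : D < -4) (u : (𝓞 K)ˣ) : u = 1 ∨ u = -1 := by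
  obtain ⟨n, hn, h⟩ := Q.absNorm_span_singleton hD (ε := (u : 𝓞 K)) u.ne_zero
  rw [Ideal.span_singleton_eq_top.2 u.isUnit, Ideal.absNorm_top] at hn
  obtain ⟨a, b, hab, -⟩ := (Q.isIntegral_iff hD).1 (u : 𝓞 K).isIntegral_coe
  have hc := congrArg Q.conj hab
  simp only [map_mul, map_add, map_ofNat, map_intCast, Q.conj_s] at hc
  have h4 : 4 * n = a ^ 2 - D * b ^ 2 := by
    have : (4 * n : K) = a ^ 2 - D * b ^ 2 := by
      rw [← h]
      linear_combination 2 * Q.conj (u : 𝓞 K) * hab + (a + b * Q.s) * hc - b ^ 2 * Q.sq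
    exact_mod_cast this
  have hb : b = 0 := by
    by_contra hb
    have : 0 < b ^ 2 := by positivity
    have hn' : n ≤ 1 := by omega
    nlinarith [sq_nonneg a]
  subst hb
  have ha : (a - 2) * (a + 2) = 0 := by
    have hn1 : n = 1 := by
      rcases Int.natAbs_eq n with h | h <;> rw [hn] at h
      · exact h
      · push_cast at h; subst h; nlinarith [sq_nonneg a]
    rw [hn1] at h4; linarith
  rcases mul_eq_zero.1 ha with ha | ha
  · left
    obtain rfl : a = 2 := by omega
    apply Units.ext
    apply RingOfIntegers.ext
    apply mul_left_cancel₀ (two_ne_zero : (2 : K) ≠ 0)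
    rw [hab]; simp
  · right
    obtain rfl : a = -2 := by omega
    apply Units.ext
    apply RingOfIntegers.ext
    apply mul_left_cancel₀ (two_ne_zero : (2 : K) ≠ 0)
    rw [hab]; simp

theorem card_units_quotient_of_neg (hD4 : D < -4) :
    Nat.card ((𝓞 K)ˣ ⧸ (powMonoidHom 3 : (𝓞 K)ˣ →* (𝓞 K)ˣ).range) = 1 := by
  have : (powMonoidHom 3 : (𝓞 K)ˣ →* (𝓞 K)ˣ).range = ⊤ := by
    rw [eq_top_iff]
    rintro u -
    refine ⟨u, ?_⟩
    rcases Q.eq_one_or_neg_one_of_lt hD hD4 u with rfl | rfl <;> simp [pow_succ]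
  rw [this]
  exact Subgroup.index_top

omit hD in
theorem embedding_im (hD0 : 0 < D) (φ : K →+* ℂ) (x : K) : (φ x).im = 0 := by
  have hs : (φ Q.s).im = 0 := by
    have h := congrArg φ Q.sq
    rw [map_pow, map_intCast] at h
    have h1 := congrArg Complex.re h
    have h2 := congrArg Complex.im h
    have hD' : (0 : ℝ) < D := by exact_mod_cast hD0
    simp [pow_two] at h1 h2
    have h3 : (φ Q.s).re * (φ Q.s).im = 0 := by linarith
    rcases mul_eq_zero.1 h3 with h3 | h3
    · rw [h3] at h1; nlinarith [sq_nonneg (φ Q.s).im]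
    · exact h3
  obtain ⟨u, v, rfl⟩ := Q.span x
  simp [hs]

omit hD in
theorem isTotallyReal (hD0 : 0 < D) : IsTotallyReal K := by
  constructor
  intro v
  rw [← InfinitePlace.mk_embedding v, InfinitePlace.isReal_mk_iff]
  ext x
  exact Complex.conj_eq_iff_im.2 (Q.embedding_im hD0 _ x)

theorem finrank_eq : Module.finrank ℚ K = 2 := by
  rw [← RingOfIntegers.rank K, Module.finrank_eq_card_basis (Q.basis hD), Fintype.card_fin]

theorem unit_rank_eq_one (hD0 : 0 < D) : Units.rank K = 1 := by
  have := Q.isTotallyReal hD0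
  have h1 := InfinitePlace.card_add_two_mul_card_eq_rank K
  have h2 := IsTotallyReal.nrComplexPlaces_eq_zero (K := K)
  have h3 := InfinitePlace.card_eq_nrRealPlaces_add_nrComplexPlaces K
  rw [Q.finrank_eq hD] at h1
  rw [Units.rank]
  omega

omit hD in
theorem torsion_eq (hD0 : 0 < D) {u : (𝓞 K)ˣ} (hu : u ∈ Units.torsion K) : u = 1 ∨ u = -1 := by
  obtain ⟨φ⟩ : Nonempty (K →+* ℂ) := inferInstance
  have h1 := (Units.mem_torsion K).1 hu (InfinitePlace.mk φ)
  rw [InfinitePlace.apply] at h1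
  have him := Q.embedding_im hD0 φ (u : 𝓞 K)
  have hre : φ (u : 𝓞 K) = ((φ (u : 𝓞 K)).re : ℂ) := Complex.ext rfl (by simpa using him)
  rw [hre, Complex.norm_real, Real.norm_eq_abs] at h1
  rcases (abs_eq zero_le_one).1 h1 with h | h
  · left
    rw [h] at hre
    apply Units.ext; apply RingOfIntegers.ext; apply φ.injective
    rw [hre]; simp
  · right
    rw [h] at hre
    apply Units.ext; apply RingOfIntegers.ext; apply φ.injective
    rw [hre]; simp

theorem card_units_quotient_of_pos (hD0 : 0 < D) :
    Nat.card ((𝓞 K)ˣ ⧸ (powMonoidHom 3 : (𝓞 K)ˣ →* (𝓞 K)ˣ).range) = 3 := by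
  have hr := Q.unit_rank_eq_one hD hD0
  let i0 : Fin (Units.rank K) := ⟨0, by omega⟩
  have huniv : (Finset.univ : Finset (Fin (Units.rank K))) = {i0} := by
    ext i
    simp only [Finset.mem_univ, Finset.mem_singleton, true_iff, i0, Fin.ext_iff]
    omega
  set e := Units.fundSystem K i0
  have hprod : ∀ k : Fin (Units.rank K) → ℤ, ∏ i, Units.fundSystem K i ^ k i = e ^ k i0 := by
    intro k; rw [huniv, Finset.prod_singleton]
  have hcube : ∀ {ζ : (𝓞 K)ˣ}, ζ ∈ Units.torsion K →
      ζ ∈ (powMonoidHom 3 : (𝓞 K)ˣ →* (𝓞 K)ˣ).range := by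
    intro ζ hζ
    refine ⟨ζ, ?_⟩
    rcases Q.torsion_eq hD0 hζ with rfl | rfl <;> simp [pow_succ]
  let π := QuotientGroup.mk' (powMonoidHom 3 : (𝓞 K)ˣ →* (𝓞 K)ˣ).range
  have hgen : ∀ x, x ∈ Subgroup.zpowers (π e) := by
    intro x
    obtain ⟨u, rfl⟩ := QuotientGroup.mk'_surjective _ x
    obtain ⟨⟨ζ, k⟩, h, -⟩ := Units.exist_unique_eq_mul_prod K u
    refine ⟨k i0, ?_⟩
    have : π ζ = 1 := (QuotientGroup.eq_one_iff _).2 (hcube ζ.2)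
    change π e ^ k i0 = π u
    rw [h, hprod, map_mul]
    simp only [this, map_zpow]
    exact (one_mul (π e ^ k i0)).symm
  rw [← orderOf_eq_card_of_forall_mem_zpowers hgen]
  have : Fact (Nat.Prime 3) := ⟨Nat.prime_three⟩
  refine orderOf_eq_prime ?_ ?_
  · rw [← map_pow]
    exact (QuotientGroup.eq_one_iff _).2 ⟨e, rfl⟩
  · intro h
    obtain ⟨w, hw⟩ := (QuotientGroup.eq_one_iff _).1 h
    obtain ⟨⟨ζ, k⟩, hk, -⟩ := Units.exist_unique_eq_mul_prod K w
    have huq := (Units.exist_unique_eq_mul_prod K e).unique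
      (y₁ := (1, fun _ => 1)) (y₂ := (ζ ^ 3, fun i => 3 * k i)) (by
        simp only [hprod]; simp) (by
        simp only [hprod] at hk ⊢
        conv_lhs => rw [← hw, hk]
        simp only [powMonoidHom_apply, mul_pow, SubmonoidClass.coe_pow]
        rw [← zpow_natCast (e ^ k i0), ← zpow_mul, mul_comm (3 : ℤ)]; rfl)
    have := congrFun (congrArg Prod.snd huq) i0
    simp only at this
    omega

end QuadField

open IntermediateField NumberField

namespace BCF

/-- A zero of a form can be moved to `(1, 0)`. -/
theorem exists_equivalent_of_ev_eq_zero {f : BCF ℤ} {x y : ℤ} (h : f.ev x y = 0)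
    (hxy : ¬(x = 0 ∧ y = 0)) : ∃ f', Equivalent f f' ∧ f'.1.1 = 0 := by
  have hg : 0 < Int.gcd x y := by
    rw [Nat.pos_iff_ne_zero]; intro h0; exact hxy (Int.gcd_eq_zero_iff.1 h0)
  obtain ⟨x', y', hc, hx, hy⟩ := Int.exists_gcd_one hg
  obtain ⟨u, v, huv⟩ := Int.isCoprime_iff_gcd_eq_one.2 hc
  refine ⟨f.sub x' (-v) y' u, ⟨x', -v, y', u, by linear_combination huv, rfl⟩, ?_⟩
  have hg' : ((Int.gcd x y : ℕ) : ℤ) ≠ 0 := by positivity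
  apply mul_left_cancel₀ (pow_ne_zero 3 hg')
  rw [mul_zero, ← h]
  have e : ∀ g : ℤ, x = x' * g → y = y' * g →
      g ^ 3 * (f.sub x' (-v) y' u).1.1 = f.ev x y := by
    rintro g rfl rfl
    simp only [sub, ev]; ring
  exact e _ hx hy

theorem not_irr_iff {f : BCF ℤ} : ¬f.Irr ↔ ∃ f', Equivalent f f' ∧ f'.1.1 = 0 := by
  constructor
  · intro h
    unfold Irr at h
    push Not at h
    obtain ⟨x, y, h, hxy⟩ := h
    exact exists_equivalent_of_ev_eq_zero h (fun h' => hxy h'.1 h'.2)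
  · rintro ⟨f', h, h0⟩ hf
    exact (hf.equivalent h).leading_ne_zero h0

theorem sq_eq_one_of_fundamental {D : ℤ} (hD : IsFundamentalDiscriminant D) {b c d : ℤ}
    (h : D = b ^ 2 * (4 * b * d - 3 * c ^ 2)) : b = 1 ∨ b = -1 := by
  have key : ∀ e : ℤ, Squarefree e → ∀ b k : ℤ, e = b ^ 2 * k → b = 1 ∨ b = -1 := fun e he b k h =>
    Int.isUnit_iff.1 (he b ⟨k, by rw [h]; ring⟩)
  obtain ⟨-, ⟨-, h2⟩ | ⟨m, h1, h2, h3⟩⟩ := hD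
  · exact key D h2 b _ h
  · rcases Int.even_or_odd' b with ⟨b, rfl | rfl⟩
    · have hm : m = b ^ 2 * (8 * b * d - 3 * c ^ 2) := by
        have : 4 * m = 4 * (b ^ 2 * (8 * b * d - 3 * c ^ 2)) := by rw [← h1, h]; ring
        omega
      exfalso
      have hb : b ^ 2 = 1 := by rcases key m h3 b _ hm with rfl | rfl <;> norm_num
      rw [hb, one_mul] at hm
      obtain ⟨l, hl⟩ : ∃ l, 8 * b * d = 8 * l := ⟨b * d, by ring⟩
      rcases Int.even_or_odd' c with ⟨c, rfl | rfl⟩ <;> ring_nf at hm hl <;> omega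
    · obtain ⟨k, hk⟩ : (4 : ℤ) ∣ 4 * (2 * b + 1) * d - 3 * c ^ 2 := by
        have h4 : (4 : ℤ) ∣ (2 * b + 1) ^ 2 * (4 * (2 * b + 1) * d - 3 * c ^ 2) := by
          rw [← h, h1]; exact dvd_mul_right _ _
        refine IsCoprime.dvd_of_dvd_mul_left ?_ h4
        exact ⟨-b ^ 2 - b, 1, by ring⟩
      refine key m h3 _ k ?_
      have : 4 * m = 4 * ((2 * b + 1) ^ 2 * k) := by rw [← h1, h, hk]; ring
      omega

theorem exists_reducible_normal_form {D : ℤ} (hD : IsFundamentalDiscriminant D) :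
    ∃ f₀ : BCF ℤ, f₀.disc = D ∧ ¬f₀.Irr ∧ ∀ f : BCF ℤ, f.disc = D → ¬f.Irr → Equivalent f f₀ := by
  obtain ⟨c₀, d₀, hc₀, hd⟩ : ∃ c₀ d₀ : ℤ, (c₀ = 0 ∨ c₀ = 1) ∧ D = 4 * d₀ - 3 * c₀ ^ 2 := by
    rcases hD.emod_four with h | h
    · exact ⟨0, D / 4, by simp, by omega⟩
    · exact ⟨1, (D + 3) / 4, by simp, by omega⟩
  refine ⟨((0, 1), (c₀, d₀)), by simp [disc, hd], ?_, ?_⟩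
  · rw [not_irr_iff]
    exact ⟨_, Equivalent.refl _, rfl⟩
  · intro f hf hirr
    obtain ⟨f', hE, h0⟩ := not_irr_iff.1 hirr
    refine hE.trans ?_
    have hf' : f'.disc = D := by rw [hE.disc_eq, hf]
    clear hE hirr hf
    have key : ∀ g : BCF ℤ, g.disc = D → g.1.1 = 0 → g.1.2 = 1 →
        Equivalent g ((0, 1), (c₀, d₀)) := by
      rintro ⟨⟨a, b⟩, ⟨c, d⟩⟩ hg ha hb
      simp only at ha hb
      subst ha hb
      simp only [disc] at hg
      obtain ⟨n, hn⟩ : ∃ n, c₀ = c + 2 * n := by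
        have hp : Even (c - c₀) := by
          have h : 3 * (c ^ 2 - c₀ ^ 2) = 4 * (d - d₀) := by linarith
          have h2 : Even (c ^ 2 - c₀ ^ 2) := by
            rw [even_iff_two_dvd]; omega
          simpa [Int.even_sub, Int.even_pow] using h2
        obtain ⟨k, hk⟩ := hp
        exact ⟨-k, by linarith⟩
      refine ⟨1, n, 0, 1, by ring, ?_⟩
      simp only [sub, ev]
      ext <;> simp only <;> ring_nf
      · linarith
      · rw [hd, hn] at hg
        nlinarith
    have hb : f'.1.2 = 1 ∨ f'.1.2 = -1 := sq_eq_one_of_fundamental hD (c := f'.2.1) (d := f'.2.2) (by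
      rw [← hf', disc, h0]; ring)
    rcases hb with hb | hb
    · exact key f' hf' h0 hb
    · have hneg : Equivalent f' (f'.sub (-1) 0 0 (-1)) := ⟨-1, 0, 0, -1, by norm_num, rfl⟩
      refine hneg.trans (key _ (by rw [hneg.disc_eq, hf']) ?_ ?_)
      · simp [sub, ev, h0]
      · simp [sub, hb]

/-- The set of classes of irreducible forms of discriminant `D`. -/
def irrCls (D : ℤ) : Set (Quotient equivSetoid) := cls '' {f : BCF ℤ | f.disc = D ∧ f.Irr}

end BCF

/-- `|U/U³|` for the unit group of a quadratic field. -/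
def unitIndex (d : ℤ) : ℕ := if 0 < d then 3 else 1

theorem card_class_group_eq {d : ℤ} (hd : IsFundamentalDiscriminant d) (hd' : 0 < d ∨ d < -4) :
    Nat.card {x : ClassGroup (Od d) // x ^ 3 = 1} * unitIndex d = (BCF.irrCls d).ncard + 1 := by
  obtain ⟨Q⟩ := nonempty_quadField hd
  have hcard := Q.ncard_cls hd
  have hk : Nat.card ((Od d)ˣ ⧸ (powMonoidHom 3 : (Od d)ˣ →* (Od d)ˣ).range) = unitIndex d := by
    unfold unitIndex
    split_ifs with h
    · exact Q.card_units_quotient_of_pos hd h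
    · exact Q.card_units_quotient_of_neg hd (by omega)
  rw [hk] at hcard
  obtain ⟨f₀, h1, h2, h3⟩ := BCF.exists_reducible_normal_form hd
  have hset : BCF.cls '' {f : BCF ℤ | f.disc = d} = insert (BCF.cls f₀) (BCF.irrCls d) := by
    ext x
    constructor
    · rintro ⟨f, hf, rfl⟩
      by_cases h : f.Irr
      · exact Or.inr ⟨f, ⟨hf, h⟩, rfl⟩
      · exact Or.inl (BCF.cls_eq_iff.2 (h3 f hf h))
    · rintro (rfl | ⟨f, ⟨hf, -⟩, rfl⟩)
      · exact ⟨f₀, h1, rfl⟩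
      · exact ⟨f, hf, rfl⟩
  have hnot : BCF.cls f₀ ∉ BCF.irrCls d := by
    rintro ⟨f, ⟨-, hf⟩, h⟩
    exact h2 (hf.equivalent (BCF.cls_eq_iff.1 h))
  have hfin : (BCF.cls '' {f : BCF ℤ | f.disc = d}).Finite := by
    apply Set.finite_of_ncard_pos
    rw [hcard]
    have : Nonempty {x : ClassGroup (Od d) // x ^ 3 = 1} := ⟨⟨1, one_pow 3⟩⟩
    refine Nat.mul_pos Nat.card_pos ?_
    unfold unitIndex; split_ifs <;> norm_num
  rw [← hcard, hset, Set.ncard_insert_of_notMem hnot (hfin.subset (by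
      rw [hset]; exact Set.subset_insert _ _))]

/-! ### Counting lattice points in dilated regions -/

namespace BCF

open MeasureTheory
open scoped Pointwise

/-- The real form underlying an integral form. -/
def toReal (f : BCF ℤ) : BCF ℝ := f.map (Int.castRingHom ℝ)

/-- The reduction of an integral form modulo `m`. -/
def red (m : ℕ) (f : BCF ℤ) : BCF (ZMod m) := f.map (Int.castRingHom (ZMod m))

/-- The half-open cube of side `m` with lower corner `x`. -/
def cube (m : ℕ) (x : BCF ℝ) : Set (BCF ℝ) :=
  (Set.Ico x.1.1 (x.1.1 + m) ×ˢ Set.Ico x.1.2 (x.1.2 + m)) ×ˢ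
    (Set.Ico x.2.1 (x.2.1 + m) ×ˢ Set.Ico x.2.2 (x.2.2 + m))

theorem measurableSet_cube (m : ℕ) (x : BCF ℝ) : MeasurableSet (cube m x) :=
  (measurableSet_Ico.prod measurableSet_Ico).prod (measurableSet_Ico.prod measurableSet_Ico)

theorem volume_cube (m : ℕ) (x : BCF ℝ) : volume (cube m x) = ENNReal.ofReal ((m : ℝ) ^ 4) := by
  unfold cube
  simp only [Measure.volume_eq_prod, Measure.prod_prod, Real.volume_Ico, add_sub_cancel_left]
  rw [← ENNReal.ofReal_mul (by positivity), ← ENNReal.ofReal_mul (by positivity)]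
  congr 1; ring

theorem exists_int_mem_Ico {m : ℕ} (hm : 0 < m) (α : ZMod m) (y : ℝ) :
    ∃ n : ℤ, (n : ZMod m) = α ∧ y ∈ Set.Ico (n : ℝ) (n + m) := by
  obtain ⟨k, rfl⟩ := ZMod.intCast_surjective α
  have hm' : (0 : ℝ) < m := by exact_mod_cast hm
  refine ⟨k + m * ⌊(y - k) / m⌋, by simp, ?_, ?_⟩
  · have := Int.floor_le ((y - k) / m)
    rw [le_div_iff₀ hm'] at this
    push_cast; linarith
  · have := Int.lt_floor_add_one ((y - k) / m)
    rw [div_lt_iff₀ hm'] at this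
    push_cast; linarith

theorem int_eq_of_mem_Ico {m : ℕ} {n n' : ℤ} (h : (n : ZMod m) = n') {y : ℝ}
    (hy : y ∈ Set.Ico (n : ℝ) (n + m)) (hy' : y ∈ Set.Ico (n' : ℝ) (n' + m)) : n = n' := by
  rw [ZMod.intCast_eq_intCast_iff_dvd_sub] at h
  have h1 : |n' - n| < (m : ℤ) := by
    rw [abs_lt]
    constructor
    · have : (n : ℝ) < n' + m := hy.1.trans_lt hy'.2
      have : n < n' + m := by exact_mod_cast this
      linarith
    · have : (n' : ℝ) < n + m := hy'.1.trans_lt hy.2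
      have : n' < n + m := by exact_mod_cast this
      linarith
  have := Int.eq_zero_of_abs_lt_dvd h h1
  linarith

theorem exists_mem_cube {m : ℕ} (hm : 0 < m) (α : BCF (ZMod m)) (y : BCF ℝ) :
    ∃ f : BCF ℤ, f.red m = α ∧ y ∈ cube m f.toReal := by
  obtain ⟨a, ha, ha'⟩ := exists_int_mem_Ico hm α.1.1 y.1.1
  obtain ⟨b, hb, hb'⟩ := exists_int_mem_Ico hm α.1.2 y.1.2
  obtain ⟨c, hc, hc'⟩ := exists_int_mem_Ico hm α.2.1 y.2.1
  obtain ⟨d, hd, hd'⟩ := exists_int_mem_Ico hm α.2.2 y.2.2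
  refine ⟨((a, b), (c, d)), ?_, ⟨ha', hb'⟩, hc', hd'⟩
  ext <;> simpa [red, map]

theorem eq_of_mem_cube {m : ℕ} {f g : BCF ℤ} (h : f.red m = g.red m) {y : BCF ℝ}
    (hf : y ∈ cube m f.toReal) (hg : y ∈ cube m g.toReal) : f = g := by
  simp only [red, map, Prod.mk.injEq, eq_intCast] at h
  ext
  · exact int_eq_of_mem_Ico h.1.1 hf.1.1 hg.1.1
  · exact int_eq_of_mem_Ico h.1.2 hf.1.2 hg.1.2
  · exact int_eq_of_mem_Ico h.2.1 hf.2.1 hg.2.1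
  · exact int_eq_of_mem_Ico h.2.2 hf.2.2 hg.2.2

theorem dist_le_of_mem_cube {m : ℕ} {x y : BCF ℝ} (h : y ∈ cube m x) : dist x y ≤ m := by
  obtain ⟨⟨h1, h2⟩, h3, h4⟩ := h
  have key : ∀ s t : ℝ, t ∈ Set.Ico s (s + m) → dist s t ≤ m := by
    intro s t ⟨h, h'⟩
    rw [Real.dist_eq, abs_le]; constructor <;> linarith
  simp only [Prod.dist_eq, sup_le_iff]
  exact ⟨⟨key _ _ h1, key _ _ h2⟩, key _ _ h3, key _ _ h4⟩

theorem finite_of_norm_le (C : ℝ) : {f : BCF ℤ | ‖f.toReal‖ ≤ C}.Finite := by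
  have h : (Set.Icc (-⌈C⌉) ⌈C⌉).Finite := Set.finite_Icc _ _
  refine ((h.prod h).prod (h.prod h)).subset ?_
  intro f hf
  have key : ∀ n : ℤ, ‖(n : ℝ)‖ ≤ C → n ∈ Set.Icc (-⌈C⌉) ⌈C⌉ := by
    intro n hn
    have := abs_le.1 ((Real.norm_eq_abs _).symm.trans_le hn |>.trans (Int.le_ceil C))
    exact ⟨by exact_mod_cast this.1, by exact_mod_cast this.2⟩
  simp only [Set.mem_ofPred_eq, toReal, map, Prod.norm_def, sup_le_iff, eq_intCast] at hf
  exact ⟨⟨key _ hf.1.1, key _ hf.1.2⟩, key _ hf.2.1, key _ hf.2.2⟩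

theorem volume_smul {r : ℝ} (hr : 0 < r) (S : Set (BCF ℝ)) :
    volume (r • S) = ENNReal.ofReal (r ^ 4) * volume S := by
  have : Measure.IsAddHaarMeasure (volume : Measure (BCF ℝ)) :=
    Measure.prod.instIsAddHaarMeasure (volume : Measure (ℝ × ℝ)) (volume : Measure (ℝ × ℝ))
  rw [Measure.addHaar_smul]
  congr 2
  have : Module.finrank ℝ (BCF ℝ) = 4 := by simp [BCF]
  rw [this, abs_of_nonneg (by positivity)]

/-- Lower bound for the number of lattice points in dilates of an open set. -/
theorem exists_finset_card_ge {U : Set (BCF ℝ)} (hU : IsOpen U) {c : ℝ}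
    (hc : ENNReal.ofReal c < volume U) :
    ∃ R : ℝ, 0 < R ∧ ∀ {m : ℕ}, 0 < m →
      ∃ r₀ : ℝ, 0 < r₀ ∧ ∀ r ≥ r₀, ∀ α : BCF (ZMod m), ∃ T : Finset (BCF ℤ),
      (∀ f ∈ T, f.red m = α ∧ r⁻¹ • f.toReal ∈ U ∧ ‖f.toReal‖ ≤ R * r) ∧
      c * (r / m) ^ 4 ≤ T.card := by
  obtain ⟨K, hKU, hK, hKc⟩ := hU.exists_lt_isCompact hc
  obtain ⟨δ, hδ, hδU⟩ := hK.exists_thickening_subset_open hU hKU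
  obtain ⟨R, hR⟩ := hK.isBounded.exists_norm_le
  refine ⟨max R 0 + 1, by positivity, fun {m} hm => ?_⟩
  have hm' : (0 : ℝ) < m := by exact_mod_cast hm
  refine ⟨max ((m : ℝ) / δ + m) 1, by positivity, ?_⟩
  intro r hr α
  have hr1 : (m : ℝ) / δ + m ≤ r := (le_max_left _ _).trans hr
  have hr0 : 0 < r := zero_lt_one.trans_le ((le_max_right _ _).trans hr)
  have hrm : (m : ℝ) ≤ r := le_trans (by have := div_pos hm' hδ; linarith) hr1
  have hrδ : (m : ℝ) / r < δ := by
    rw [div_lt_iff₀ hr0]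
    have : (m : ℝ) / δ < r := by linarith
    rwa [div_lt_iff₀ hδ, mul_comm] at this
  have hbound : ∀ f : BCF ℤ, ∀ y ∈ K, r • y ∈ cube m f.toReal →
      dist (r⁻¹ • f.toReal) y < δ ∧ ‖f.toReal‖ ≤ (max R 0 + 1) * r := by
    intro f y hy hf
    have h1 := dist_le_of_mem_cube hf
    constructor
    · have h2 : dist (r⁻¹ • f.toReal) y = r⁻¹ * dist f.toReal (r • y) := by
        rw [← Real.norm_of_nonneg (inv_nonneg.2 hr0.le), ← dist_smul₀, smul_smul,
          inv_mul_cancel₀ hr0.ne', one_smul, Real.norm_of_nonneg (inv_nonneg.2 hr0.le)]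
      rw [h2]
      refine lt_of_le_of_lt ?_ hrδ
      rw [div_eq_inv_mul]
      gcongr
    · have h2 : ‖f.toReal‖ ≤ ‖r • y‖ + dist f.toReal (r • y) := by
        rw [dist_eq_norm]
        have := norm_add_le (r • y) (f.toReal - r • y)
        rwa [add_sub_cancel] at this
      rw [norm_smul, Real.norm_of_nonneg hr0.le] at h2
      have h3 : ‖y‖ ≤ max R 0 := (hR y hy).trans (le_max_left _ _)
      nlinarith
  set S : Set (BCF ℤ) := {f | f.red m = α ∧ ∃ y ∈ K, r • y ∈ cube m f.toReal} with hS
  have hSfin : S.Finite := (finite_of_norm_le ((max R 0 + 1) * r)).subset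
    fun f ⟨_, y, hy, hf⟩ => (hbound f y hy hf).2
  refine ⟨hSfin.toFinset, ?_, ?_⟩
  · intro f hf
    obtain ⟨hα, y, hy, hfy⟩ := hSfin.mem_toFinset.1 hf
    refine ⟨hα, hδU ?_, (hbound f y hy hfy).2⟩
    exact Metric.mem_thickening_iff.2 ⟨y, hy, (hbound f y hy hfy).1⟩
  · have h1 : r • K ⊆ ⋃ f ∈ hSfin.toFinset, cube m f.toReal := by
      rintro _ ⟨y, hy, rfl⟩
      obtain ⟨f, hf, hfy⟩ := exists_mem_cube hm α (r • y)
      simp only [Set.mem_iUnion]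
      exact ⟨f, hSfin.mem_toFinset.2 ⟨hf, y, hy, hfy⟩, hfy⟩
    have h2 := (measure_mono h1).trans (measure_biUnion_finset_le (μ := volume) _ _)
    simp only [volume_cube, Finset.sum_const, nsmul_eq_mul] at h2
    rw [volume_smul hr0] at h2
    have h3 : ENNReal.ofReal (r ^ 4) * ENNReal.ofReal c ≤
        hSfin.toFinset.card * ENNReal.ofReal ((m : ℝ) ^ 4) :=
      le_trans (by gcongr) h2
    rw [← ENNReal.ofReal_mul (by positivity), ← ENNReal.ofReal_natCast,
      ← ENNReal.ofReal_mul (by positivity), ENNReal.ofReal_le_ofReal_iff (by positivity)] at h3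
    rw [div_pow, ← mul_div_assoc, div_le_iff₀ (by positivity)]
    linarith

/-- Upper bound for the number of lattice points in dilates of a compact set. -/
theorem ncard_le_of_isCompact {K : Set (BCF ℝ)} (hK : IsCompact K) {c : ℝ} (hc0 : 0 ≤ c)
    (hc : volume K < ENNReal.ofReal c) {m : ℕ} (hm : 0 < m) :
    ∃ r₀ : ℝ, 0 < r₀ ∧ ∀ r ≥ r₀, ∀ α : BCF (ZMod m), ∀ T : Finset (BCF ℤ),
      (∀ f ∈ T, f.red m = α ∧ r⁻¹ • f.toReal ∈ K) → T.card ≤ c * (r / m) ^ 4 := by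
  have hm' : (0 : ℝ) < m := by exact_mod_cast hm
  have ht := tendsto_measure_cthickening_of_isCompact (μ := volume) hK
  have hev := (ht.mono_left (nhdsWithin_le_nhds (s := Set.Ioi 0))).eventually_lt_const hc
  obtain ⟨δ, hδc, hδ⟩ := (hev.and self_mem_nhdsWithin).exists
  have hδ : 0 < δ := hδ
  refine ⟨(m : ℝ) / δ, by positivity, ?_⟩
  intro r hr α T hT
  have hr0 : 0 < r := lt_of_lt_of_le (by positivity) hr
  have hrδ : (m : ℝ) / r ≤ δ := by
    rw [div_le_iff₀ hr0]
    have : (m : ℝ) / δ ≤ r := hr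
    rwa [div_le_iff₀ hδ, mul_comm] at this
  have h1 : (⋃ f ∈ T, cube m f.toReal) ⊆ r • Metric.cthickening δ K := by
    intro y hy
    simp only [Set.mem_iUnion] at hy
    obtain ⟨f, hf, hfy⟩ := hy
    refine ⟨r⁻¹ • y, ?_, by simp [smul_smul, hr0.ne']⟩
    refine Metric.mem_cthickening_of_dist_le _ _ _ _ (hT f hf).2 ?_
    rw [dist_smul₀, Real.norm_of_nonneg (inv_nonneg.2 hr0.le), dist_comm]
    refine le_trans ?_ hrδ
    rw [div_eq_inv_mul]
    gcongr
    exact dist_le_of_mem_cube hfy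
  have h2 := measure_mono (μ := volume) h1
  rw [measure_biUnion_finset (fun f hf g hg hfg => ?_) (fun f _ => measurableSet_cube _ _)] at h2
  · simp only [volume_cube, Finset.sum_const, nsmul_eq_mul] at h2
    rw [volume_smul hr0] at h2
    have h3 := h2.trans (mul_le_mul_right hδc.le _)
    rw [← ENNReal.ofReal_mul (by positivity), ← ENNReal.ofReal_natCast,
      ← ENNReal.ofReal_mul (by positivity), ENNReal.ofReal_le_ofReal_iff (by positivity)] at h3
    rw [div_pow, ← mul_div_assoc, le_div_iff₀ (by positivity)]
    linarith
  · refine Set.disjoint_left.2 fun y hy hy' => hfg ?_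
    exact eq_of_mem_cube ((hT f hf).1.trans (hT g hg).1.symm) hy hy'

end BCF

/-! ### The point of the upper half plane attached to a real binary cubic form -/

namespace BCF

/-- For `σ = -1` (resp. `σ = 1/3`) this says that `u + i v` is a root of the Hessian `H(x, 1)`
(resp. of `f(x, 1)`), as soon as `f` has negative (resp. positive) reduced discriminant. -/
def Rel (σ : ℝ) (f : BCF ℝ) (u v : ℝ) : Prop :=
  0 < v ∧ f.2.1 + 2 * f.1.2 * u + f.1.1 * u ^ 2 = σ * f.1.1 * v ^ 2 ∧
    σ * (f.2.2 + 3 * f.2.1 * u + 3 * f.1.2 * u ^ 2 + f.1.1 * u ^ 3) =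
      (f.1.2 + f.1.1 * u) * v ^ 2

/-- The two admissible values of the parameter, one for each sign of the discriminant. -/
def Adm (σ : ℝ) : Prop := σ = -1 ∨ σ = 1 / 3

theorem Adm.quad {σ : ℝ} (h : Adm σ) : 3 * σ ^ 2 + 2 * σ = 1 := by
  rcases h with rfl | rfl <;> norm_num

theorem Adm.ne_zero {σ : ℝ} (h : Adm σ) : σ ≠ 0 := by
  rcases h with rfl | rfl <;> norm_num

theorem Rel.eq_c {σ : ℝ} {f : BCF ℝ} {u v : ℝ} (h : Rel σ f u v) :
    f.2.1 = σ * f.1.1 * v ^ 2 - 2 * f.1.2 * u - f.1.1 * u ^ 2 := by linear_combination h.2.1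

theorem Rel.disc_eq {σ : ℝ} (hσ : Adm σ) {f : BCF ℝ} {u v : ℝ} (h : Rel σ f u v) :
    f.disc = 4 * σ ^ 3 * v ^ 2 * (f.1.1 ^ 2 * v ^ 2 + ((f.1.2 + f.1.1 * u) / σ) ^ 2) ^ 2 := by
  obtain ⟨⟨a, b⟩, c, d⟩ := f
  obtain ⟨hv, h1, h2⟩ := h
  simp only at h1 h2
  have hc : c = σ * a * v ^ 2 - 2 * b * u - a * u ^ 2 := by linear_combination h1
  simp only [disc]
  rcases hσ with rfl | rfl
  · have hd : d = -(b + a * u) * v ^ 2 - 3 * c * u - 3 * b * u ^ 2 - a * u ^ 3 := by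
      linear_combination -h2
    rw [hd, hc]; ring
  · have hd : d = 3 * (b + a * u) * v ^ 2 - 3 * c * u - 3 * b * u ^ 2 - a * u ^ 3 := by
      linear_combination 3 * h2
    rw [hd, hc]; ring

theorem Rel.sub_T {σ : ℝ} {f : BCF ℝ} {u v : ℝ} (h : Rel σ f u v) (n : ℝ) :
    Rel σ (f.sub 1 n 0 1) (u - n) v := by
  obtain ⟨hv, h1, h2⟩ := h
  refine ⟨hv, ?_, ?_⟩
  · simp only [sub, ev]; linear_combination h1
  · simp only [sub, ev]; linear_combination h2

theorem Rel.sub_S {σ : ℝ} (hσ : Adm σ) {f : BCF ℝ} {u v : ℝ} (h : Rel σ f u v) :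
    Rel σ (f.sub 0 (-1) 1 0) (-u / (u ^ 2 + v ^ 2)) (v / (u ^ 2 + v ^ 2)) := by
  obtain ⟨⟨a, b⟩, c, d⟩ := f
  obtain ⟨hv, h1, h2⟩ := h
  simp only at h1 h2
  have hn : 0 < u ^ 2 + v ^ 2 := by positivity
  have hc : c = σ * a * v ^ 2 - 2 * b * u - a * u ^ 2 := by linear_combination h1
  refine ⟨by positivity, ?_, ?_⟩
  · simp only [sub, ev]
    field_simp
    rcases hσ with rfl | rfl
    · have hd : d = -(b + a * u) * v ^ 2 - 3 * c * u - 3 * b * u ^ 2 - a * u ^ 3 := by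
        linear_combination -h2
      rw [hd, hc]; ring
    · have hd : d = 3 * (b + a * u) * v ^ 2 - 3 * c * u - 3 * b * u ^ 2 - a * u ^ 3 := by
        linear_combination 3 * h2
      rw [hd, hc]; ring
  · simp only [sub, ev]
    field_simp
    rcases hσ with rfl | rfl
    · have hd : d = -(b + a * u) * v ^ 2 - 3 * c * u - 3 * b * u ^ 2 - a * u ^ 3 := by
        linear_combination -h2
      rw [hd, hc]; ring
    · have hd : d = 3 * (b + a * u) * v ^ 2 - 3 * c * u - 3 * b * u ^ 2 - a * u ^ 3 := by
        linear_combination 3 * h2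
      rw [hd, hc]; ring

theorem Rel.unique {σ : ℝ} (hσ : Adm σ) {f : BCF ℝ} {u v u' v' : ℝ} (ha : f.1.1 ≠ 0)
    (h : Rel σ f u v) (h' : Rel σ f u' v') : u = u' ∧ v = v' := by
  obtain ⟨⟨a, b⟩, c, d⟩ := f
  obtain ⟨hv, h1, h2⟩ := h
  obtain ⟨hv', h1', h2'⟩ := h'
  simp only at h1 h2 h1' h2' ha
  have hc : c = σ * a * v ^ 2 - 2 * b * u - a * u ^ 2 := by linear_combination h1
  set B := b + a * u with hB
  set w := u' - u with hw
  have hbr : 0 < 2 * B ^ 2 + (3 - 3 * σ ^ 2) * a * B * w + (1 - σ ^ 2) * a ^ 2 * w ^ 2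
      + 2 * σ ^ 2 * a ^ 2 * v ^ 2 := by
    have h3 : 0 < a ^ 2 * v ^ 2 := by positivity
    rcases hσ with rfl | rfl
    · nlinarith [sq_nonneg B]
    · nlinarith [sq_nonneg (3 * B + 2 * a * w)]
  have huu : w = 0 := by
    have : w * (2 * B ^ 2 + (3 - 3 * σ ^ 2) * a * B * w + (1 - σ ^ 2) * a ^ 2 * w ^ 2
      + 2 * σ ^ 2 * a ^ 2 * v ^ 2) = 0 := by
      have h5 : c = σ * a * v' ^ 2 - 2 * b * u' - a * u' ^ 2 := by linear_combination h1'
      have e1 : σ * a * (v' ^ 2 - v ^ 2) = 2 * B * w + a * w ^ 2 := by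
        rw [hB, hw]; linear_combination hc - h5
      have e2 : σ * (3 * c * w + 3 * b * (u' ^ 2 - u ^ 2) + a * (u' ^ 3 - u ^ 3)) =
          (B + a * w) * v' ^ 2 - B * v ^ 2 := by
        rw [hB, hw]; linear_combination h2' - h2
      have e3 : 3 * c * w + 3 * b * (u' ^ 2 - u ^ 2) + a * (u' ^ 3 - u ^ 3) =
          3 * σ * a * v ^ 2 * w + 3 * B * w ^ 2 + a * w ^ 3 := by
        rw [hc, hB, hw]; ring
      rw [e3] at e2
      have hq := hσ.quad
      have := hσ.ne_zero
      linear_combination -(B + a * w) * e1 - σ * a * e2 + a ^ 2 * v ^ 2 * w * σ * hq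
    rcases mul_eq_zero.1 this with h | h
    · exact h
    · exact absurd h hbr.ne'
  have hu : u' = u := by linarith
  refine ⟨hu.symm, ?_⟩
  rw [hu] at h1'
  have h6 : σ * a * (v ^ 2 - v' ^ 2) = 0 := by linear_combination h1' - h1
  have h7 : v ^ 2 - v' ^ 2 = 0 := by
    rcases mul_eq_zero.1 h6 with h | h
    · exact absurd h (mul_ne_zero hσ.ne_zero ha)
    · exact h
  nlinarith

end BCF

/-! ### Reduction of binary cubic forms to the standard fundamental domain -/

namespace BCF

open Matrix.SpecialLinearGroup UpperHalfPlane ModularGroup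
open scoped MatrixGroups

theorem Rel.neg_iff {σ : ℝ} {f : BCF ℝ} {u v : ℝ} : Rel σ (-f) u v ↔ Rel σ f u v := by
  unfold Rel
  simp only [Prod.fst_neg, Prod.snd_neg]
  refine and_congr_right fun _ => and_congr ?_ ?_
  · constructor <;> intro h <;> linear_combination -h
  · constructor <;> intro h <;> linear_combination -h

/-- The right action of `SL₂(ℤ)` on real forms. -/
def act (f : BCF ℝ) (g : SL(2, ℤ)) : BCF ℝ :=
  f.sub (g 0 0 : ℤ) (g 0 1 : ℤ) (g 1 0 : ℤ) (g 1 1 : ℤ)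

theorem act_mul (f : BCF ℝ) (g h : SL(2, ℤ)) : f.act (g * h) = (f.act g).act h := by
  unfold act
  rw [sub_sub]
  simp [Matrix.mul_apply, Fin.sum_univ_two]

theorem act_one (f : BCF ℝ) : f.act 1 = f := by
  simp [act, sub_one]

theorem rel_act_iff {σ : ℝ} (hσ : Adm σ) (g : SL(2, ℤ)) :
    ∀ (f : BCF ℝ) (z : ℍ), Rel σ (f.act g) z.re z.im ↔ Rel σ f (g • z).re (g • z).im := by
  have : g ∈ Subgroup.closure {S, T} := by simp [SpecialLinearGroup.SL2Z_generators]
  induction this using Subgroup.closure_induction with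
  | one => intro f z; simp [act_one]
  | mul g h _ _ ig ih => intro f z; rw [act_mul, ih, ig, mul_smul]
  | inv g _ ig =>
    intro f z
    have := ig (f.act g⁻¹) (g⁻¹ • z)
    rw [← act_mul, inv_mul_cancel, act_one, smul_inv_smul] at this
    exact this.symm
  | mem g hg =>
    simp only [Set.mem_insert_iff, Set.mem_singleton_iff] at hg
    intro f z
    rcases hg with rfl | rfl
    · have h1 : ∀ z : ℍ, (S • z).re = -z.re / (z.re ^ 2 + z.im ^ 2) := by
        intro z
        rw [modular_S_smul]; simp [Complex.inv_re, Complex.normSq_apply, pow_two, neg_div]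
      have h2 : ∀ z : ℍ, (S • z).im = z.im / (z.re ^ 2 + z.im ^ 2) := by
        intro z
        rw [modular_S_smul]; simp [Complex.inv_im, Complex.normSq_apply, pow_two, neg_div]
      have hS : f.act S = f.sub 0 (-1) 1 0 := by simp [act, S]
      have key : ∀ (f : BCF ℝ) (z : ℍ), Rel σ f z.re z.im →
          Rel σ (f.sub 0 (-1) 1 0) (S • z).re (S • z).im := by
        intro f z h
        rw [h1, h2]
        exact h.sub_S hσ
      rw [hS]
      constructor
      · intro h
        have := key _ _ h
        rw [sub_sub, show (0 : ℝ) * 0 + -1 * 1 = -1 by norm_num,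
          show (0 : ℝ) * -1 + -1 * 0 = 0 by norm_num, show (1 : ℝ) * 0 + 0 * 1 = 0 by norm_num,
          show (1 : ℝ) * -1 + 0 * 0 = -1 by norm_num, sub_neg_one, Rel.neg_iff] at this
        exact this
      · intro h
        have := key _ _ h
        rw [← mul_smul] at this
        have hSS : S * S = -1 := by ext i j; fin_cases i <;> fin_cases j <;> rfl
        rwa [hSS, SL_neg_smul, one_smul] at this
    · rw [re_T_smul, im_T_smul]
      have hT : f.act T = f.sub 1 1 0 1 := by simp [act, T]
      rw [hT]
      constructor
      · intro h
        have := h.sub_T (-1)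
        rw [sub_sub] at this
        norm_num [sub_one] at this
        exact this
      · intro h
        have := h.sub_T 1
        rwa [add_sub_cancel_right] at this

theorem exists_rel_of_hess {f : BCF ℝ} (ha : f.1.1 ≠ 0) (hD : f.disc < 0) :
    ∃ u v, Rel (-1) f u v := by
  have hA0 : f.hA ≠ 0 := by
    intro h
    have := f.syzygy
    rw [h] at this
    nlinarith [sq_nonneg f.g₀, mul_pos_of_neg_of_neg hD (neg_lt_zero.2 (sq_pos_of_ne_zero ha)),
      sq_pos_of_ne_zero ha]
  obtain ⟨⟨a, b⟩, c, d⟩ := f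
  set A := BCF.hA ((a, b), (c, d)) with hAd
  have hA' : A = b ^ 2 - a * c := rfl
  set D := disc ((a, b), (c, d)) with hDd
  have hD' : D = (b * c - a * d) ^ 2 - 4 * A * (c ^ 2 - b * d) := by
    rw [hDd, BCF.disc_eq]; rfl
  set s := Real.sqrt (-D) with hs
  have hs0 : 0 < s := Real.sqrt_pos.2 (by linarith)
  have hs2 : s ^ 2 = -D := Real.sq_sqrt (by linarith)
  have hv : (s / (2 * |A|)) ^ 2 = -D / (4 * A ^ 2) := by
    rw [div_pow, mul_pow, sq_abs, hs2]; norm_num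
  refine ⟨-(b * c - a * d) / (2 * A), s / (2 * |A|), by positivity, ?_, ?_⟩
  · simp only
    rw [hv]
    field_simp
    rw [hD', hA']; ring
  · simp only
    rw [hv]
    field_simp
    rw [hD', hA']; ring

theorem exists_real_root {a b c d : ℝ} (ha : a ≠ 0) :
    ∃ x : ℝ, a * x ^ 3 + 3 * b * x ^ 2 + 3 * c * x + d = 0 := by
  wlog h : 0 < a generalizing a b c d
  · obtain ⟨x, hx⟩ := this (a := -a) (b := -b) (c := -c) (d := -d) (neg_ne_zero.2 ha)
      (by rcases lt_or_gt_of_ne ha with h' | h'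
          · linarith
          · exact absurd h' h)
    exact ⟨x, by linear_combination -hx⟩
  set F : ℝ → ℝ := fun x => a * x ^ 3 + 3 * b * x ^ 2 + 3 * c * x + d with hF
  have hcont : Continuous F := by fun_prop
  set N : ℝ := 1 + (3 * |b| + 3 * |c| + |d|) / a with hN
  have hN1 : 1 ≤ N := by
    have : 0 ≤ (3 * |b| + 3 * |c| + |d|) / a := by positivity
    linarith
  have haN : a * N = a + (3 * |b| + 3 * |c| + |d|) := by rw [hN]; field_simp
  have hbd : ∀ x : ℝ, |x| = N → |3 * b * x ^ 2 + 3 * c * x + d| ≤ (3 * |b| + 3 * |c| + |d|) * N ^ 2 := by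
    intro x hx
    have h1 : |3 * b * x ^ 2 + 3 * c * x + d| ≤ |3 * b * x ^ 2| + |3 * c * x| + |d| :=
      abs_add_three _ _ _
    rw [abs_mul, abs_mul, abs_mul, abs_mul, abs_pow, hx] at h1
    norm_num at h1
    have h2 : N ≤ N ^ 2 := by nlinarith
    have h3 : 1 ≤ N ^ 2 := by nlinarith
    nlinarith [mul_nonneg (abs_nonneg c) (sub_nonneg.2 h2),
      mul_nonneg (abs_nonneg d) (sub_nonneg.2 h3)]
  have hpos : 0 ≤ F N := by
    have := (abs_le.1 (hbd N (abs_of_nonneg (by linarith)))).1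
    simp only [hF]
    have h5 : a * N ^ 3 = a * N ^ 2 + (3 * |b| + 3 * |c| + |d|) * N ^ 2 := by
      linear_combination N ^ 2 * haN
    nlinarith [mul_pos h (show 0 < N ^ 2 by positivity)]
  have hneg : F (-N) ≤ 0 := by
    have := (abs_le.1 (hbd (-N) (by rw [abs_neg, abs_of_nonneg (by linarith)]))).2
    simp only [hF]
    have h5 : a * N ^ 3 = a * N ^ 2 + (3 * |b| + 3 * |c| + |d|) * N ^ 2 := by
      linear_combination N ^ 2 * haN
    nlinarith [mul_pos h (show 0 < N ^ 2 by positivity)]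
  obtain ⟨x, _, hx⟩ := intermediate_value_Icc (show -N ≤ N by linarith) hcont.continuousOn
    ⟨hneg, hpos⟩
  exact ⟨x, hx⟩

theorem exists_rel_of_pos {f : BCF ℝ} (ha : f.1.1 ≠ 0) (hD : 0 < f.disc) :
    ∃ u v, Rel (1 / 3) f u v := by
  obtain ⟨⟨a, b⟩, c, d⟩ := f
  simp only at ha
  obtain ⟨l, hl⟩ := exists_real_root (b := b) (c := c) (d := d) ha
  obtain ⟨e, he⟩ : ∃ e, e = 3 * b + a * l := ⟨_, rfl⟩
  obtain ⟨g, hg⟩ : ∃ g, g = 3 * c + e * l := ⟨_, rfl⟩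
  have hb : b = (e - a * l) / 3 := by rw [he]; ring
  have hc : c = (g - e * l) / 3 := by rw [hg]; ring
  have hd : d = -(g * l) := by rw [hg, he]; linear_combination hl
  have hdisc : disc ((a, b), (c, d)) =
      (a * l ^ 2 + e * l + g) ^ 2 * (4 * a * g - e ^ 2) / 27 := by
    simp only [disc]; rw [hb, hc, hd]; ring
  have hpos : 0 < 4 * a * g - e ^ 2 := by
    rw [hdisc] at hD
    by_contra h
    push Not at h
    nlinarith [mul_nonneg (sq_nonneg (a * l ^ 2 + e * l + g)) (sub_nonneg.2 h)]
  set s := Real.sqrt (4 * a * g - e ^ 2) with hs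
  have hs0 : 0 < s := Real.sqrt_pos.2 hpos
  have hs2 : s ^ 2 = 4 * a * g - e ^ 2 := Real.sq_sqrt hpos.le
  have hv : (s / (2 * |a|)) ^ 2 = (4 * a * g - e ^ 2) / (4 * a ^ 2) := by
    rw [div_pow, mul_pow, sq_abs, hs2]; norm_num
  refine ⟨-e / (2 * a), s / (2 * |a|), by positivity, ?_, ?_⟩
  · simp only
    rw [hv, hb, hc]
    field_simp
    ring
  · simp only
    rw [hv, hb, hc, hd]
    field_simp
    ring

theorem exists_rel {σ : ℝ} (hσ : Adm σ) {f : BCF ℝ} (ha : f.1.1 ≠ 0) (hD : 0 < σ * f.disc) :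
    ∃ u v, Rel σ f u v := by
  rcases hσ with rfl | rfl
  · exact exists_rel_of_hess ha (by linarith)
  · exact exists_rel_of_pos ha (by linarith)

theorem toReal_sub (f : BCF ℤ) (p q r t : ℤ) :
    (f.sub p q r t).toReal = f.toReal.sub p q r t := by
  rw [toReal, ← sub_map]; rfl

theorem disc_toReal (f : BCF ℤ) : f.toReal.disc = f.disc := by
  rw [toReal, disc_map]; rfl

theorem toReal_injective : Function.Injective toReal := by
  intro f g h
  simp only [toReal, map, Prod.mk.injEq, eq_intCast, Int.cast_inj] at h
  ext
  exacts [h.1.1, h.1.2, h.2.1, h.2.2]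

theorem equivalent_iff {f f' : BCF ℤ} :
    Equivalent f f' ↔ ∃ g : SL(2, ℤ), f'.toReal = f.toReal.act g := by
  constructor
  · rintro ⟨p, q, r, t, h, rfl⟩
    refine ⟨⟨!![p, q; r, t], by simp [Matrix.det_fin_two, h]⟩, ?_⟩
    rw [toReal_sub]; simp [act]
  · rintro ⟨g, hg⟩
    refine ⟨g 0 0, g 0 1, g 1 0, g 1 1, ?_, ?_⟩
    · rw [← Matrix.det_fin_two]; exact g.2
    · apply toReal_injective
      rw [toReal_sub, hg]; rfl

theorem exists_reduced {σ : ℝ} (hσ : Adm σ) {f : BCF ℤ} (ha : f.1.1 ≠ 0) (hD : 0 < σ * f.disc) :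
    ∃ f' : BCF ℤ, Equivalent f f' ∧ ∃ u v, Rel σ f'.toReal u v ∧ 1 ≤ u ^ 2 + v ^ 2 ∧
      |u| ≤ 1 / 2 := by
  obtain ⟨u, v, h⟩ := exists_rel hσ (f := f.toReal) (by simpa [toReal, map] using ha)
    (by rwa [disc_toReal])
  set z : ℍ := ⟨⟨u, v⟩, h.1⟩
  obtain ⟨g, hg⟩ := exists_smul_mem_fd z
  have hf : f.toReal.act g⁻¹ = (f.sub (g⁻¹ 0 0) (g⁻¹ 0 1) (g⁻¹ 1 0) (g⁻¹ 1 1)).toReal :=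
    (toReal_sub ..).symm
  refine ⟨_, equivalent_iff.2 ⟨g⁻¹, hf.symm⟩, (g • z).re, (g • z).im, ?_, ?_, hg.2⟩
  · rw [← hf, rel_act_iff hσ, inv_smul_smul]
    exact h
  · have := hg.1
    rw [Complex.normSq_apply] at this
    simpa [pow_two] using this

theorem eq_or_eq_neg_of_equivalent {σ : ℝ} (hσ : Adm σ) {f f' : BCF ℤ} (h : Equivalent f f')
    (ha : f.1.1 ≠ 0) {u v u' v' : ℝ} (hr : Rel σ f.toReal u v) (hr' : Rel σ f'.toReal u' v')
    (h1 : 1 < u ^ 2 + v ^ 2) (h1' : 1 < u' ^ 2 + v' ^ 2) (h2 : |u| < 1 / 2)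
    (h2' : |u'| < 1 / 2) : f' = f ∨ f' = -f := by
  obtain ⟨g, hg⟩ := equivalent_iff.1 h
  set z : ℍ := ⟨⟨u, v⟩, hr.1⟩ with hz
  set z' : ℍ := ⟨⟨u', v'⟩, hr'.1⟩ with hz'
  have h3 : Rel σ f.toReal (g • z').re (g • z').im := by
    rw [← rel_act_iff hσ, ← hg]; exact hr'
  have h4 := Rel.unique hσ (by simpa [toReal, map] using ha) h3 hr
  have h5 : g • z' = z := by
    apply UpperHalfPlane.ext
    exacts [Complex.ext h4.1 h4.2]
  have hf : z ∈ fdo := by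
    refine ⟨?_, h2⟩
    rw [Complex.normSq_apply]
    simpa [pow_two, hz] using h1
  have hf' : z' ∈ fdo := by
    refine ⟨?_, h2'⟩
    rw [Complex.normSq_apply]
    simpa [pow_two, hz'] using h1'
  rcases eq_one_or_neg_one_of_mem_fdo_mem_fdo hf' (h5 ▸ hf) with rfl | rfl
  · left
    rw [act_one] at hg
    exact toReal_injective hg
  · right
    apply toReal_injective
    rw [hg]
    have : f.toReal.act (-1) = f.toReal.sub (-1) 0 0 (-1) := by simp [act]
    rw [this, sub_neg_one]
    simp [toReal, map]

end BCF

/-! ### Change of variables -/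

namespace BCF

open MeasureTheory

/-- The last two coefficients of the form with given first two coefficients `x = (a, b)` and given
point `p = (u, v)`. -/
noncomputable def tail (σ : ℝ) (x p : ℝ × ℝ) : ℝ × ℝ :=
  (σ * x.1 * p.2 ^ 2 - 2 * x.2 * p.1 - x.1 * p.1 ^ 2,
    σ⁻¹ * (x.2 + x.1 * p.1) * p.2 ^ 2
      - 3 * (σ * x.1 * p.2 ^ 2 - 2 * x.2 * p.1 - x.1 * p.1 ^ 2) * p.1
      - 3 * x.2 * p.1 ^ 2 - x.1 * p.1 ^ 3)

theorem rel_iff_tail {σ : ℝ} (hσ : Adm σ) {f : BCF ℝ} {u v : ℝ} :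
    Rel σ f u v ↔ 0 < v ∧ f.2 = tail σ f.1 (u, v) := by
  obtain ⟨⟨a, b⟩, c, d⟩ := f
  have h0 := hσ.ne_zero
  simp only [Rel, tail, Prod.mk.injEq]
  refine and_congr_right fun _ => ?_
  constructor
  · rintro ⟨h1, h2⟩
    have hc : c = σ * a * v ^ 2 - 2 * b * u - a * u ^ 2 := by linear_combination h1
    refine ⟨hc, ?_⟩
    rw [← hc]
    field_simp
    linear_combination h2
  · rintro ⟨h1, h2⟩
    rw [← h1] at h2
    refine ⟨by linear_combination h1, ?_⟩
    rw [h2]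
    field_simp
    ring

/-- The quadratic quantity controlling the discriminant. -/
noncomputable def qf (σ : ℝ) (x p : ℝ × ℝ) : ℝ :=
  x.1 ^ 2 * p.2 ^ 2 + ((x.2 + x.1 * p.1) / σ) ^ 2

theorem qf_nonneg (σ : ℝ) (x p : ℝ × ℝ) : 0 ≤ qf σ x p := by unfold qf; positivity

/-- The absolute value of the discriminant, in terms of the point of the upper half plane. -/
noncomputable def ad (σ : ℝ) (x p : ℝ × ℝ) : ℝ := 4 * |σ| ^ 3 * p.2 ^ 2 * qf σ x p ^ 2

theorem Rel.abs_disc {σ : ℝ} (hσ : Adm σ) {f : BCF ℝ} {u v : ℝ} (h : Rel σ f u v) :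
    |f.disc| = ad σ f.1 (u, v) := by
  rw [h.disc_eq hσ, abs_mul, abs_mul, abs_mul, abs_pow, abs_of_nonneg (sq_nonneg v),
    abs_of_nonneg (sq_nonneg (_ : ℝ))]
  simp [ad, qf]

theorem Rel.sign_disc {σ : ℝ} (hσ : Adm σ) {f : BCF ℝ} {u v : ℝ} (h : Rel σ f u v) :
    σ * f.disc = |σ| * |f.disc| := by
  rw [h.disc_eq hσ, abs_mul, abs_mul, abs_mul, abs_pow, abs_of_nonneg (sq_nonneg v),
    abs_of_nonneg (sq_nonneg (_ : ℝ)), abs_of_nonneg (by norm_num : (0 : ℝ) ≤ 4)]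
  have : σ * σ ^ 3 = |σ| * |σ| ^ 3 := by
    rw [← pow_succ', ← pow_succ']; norm_num [abs_of_nonneg, Even.pow_abs (show Even 4 by decide)]
  linear_combination (4 * v ^ 2 * (f.1.1 ^ 2 * v ^ 2 + ((f.1.2 + f.1.1 * u) / σ) ^ 2) ^ 2) * this

/-- The derivative of `tail` in its second argument. -/
noncomputable def tailDeriv (σ : ℝ) (x p : ℝ × ℝ) : ℝ × ℝ →L[ℝ] ℝ × ℝ :=
  (Matrix.toLin (.finTwoProd ℝ) (.finTwoProd ℝ)
    !![-2 * (x.2 + x.1 * p.1), 2 * σ * x.1 * p.2;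
      σ⁻¹ * x.1 * p.2 ^ 2 - 3 * σ * x.1 * p.2 ^ 2 + 6 * (x.2 + x.1 * p.1) * p.1,
      2 * σ⁻¹ * (x.2 + x.1 * p.1) * p.2 - 6 * σ * x.1 * p.2 * p.1]).toContinuousLinearMap

theorem hasFDerivAt_tail (σ : ℝ) (x p : ℝ × ℝ) :
    HasFDerivAt (tail σ x) (tailDeriv σ x p) p := by
  unfold tailDeriv
  rw [Matrix.toLin_finTwoProd_toContinuousLinearMap]
  have hX : HasFDerivAt (fun p : ℝ × ℝ => p.1) (ContinuousLinearMap.fst ℝ ℝ ℝ) p := hasFDerivAt_fst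
  have hY : HasFDerivAt (fun p : ℝ × ℝ => p.2) (ContinuousLinearMap.snd ℝ ℝ ℝ) p := hasFDerivAt_snd
  have hc := (((hY.pow 2).const_mul (σ * x.1)).sub (hX.const_mul (2 * x.2))).sub
    ((hX.pow 2).const_mul x.1)
  have hd := ((((((hX.const_mul x.1).const_add x.2).const_mul σ⁻¹).mul (hY.pow 2)).sub
    ((hc.const_mul 3).mul hX)).sub ((hX.pow 2).const_mul (3 * x.2))).sub
    ((hX.pow 3).const_mul x.1)
  refine (hc.prodMk hd).congr_fderiv ?_
  ext <;> simp <;> ring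

theorem det_tailDeriv {σ : ℝ} (hσ : Adm σ) (x p : ℝ × ℝ) :
    (tailDeriv σ x p).det = -(4 * p.2 * σ * qf σ x p) := by
  have h0 := hσ.ne_zero
  unfold tailDeriv qf
  rw [LinearMap.det_toContinuousLinearMap, LinearMap.det_toLin, Matrix.det_fin_two_of]
  field_simp
  linear_combination (2 * x.1 ^ 2 * p.2 ^ 3 * σ) * hσ.quad

theorem abs_det_tailDeriv {σ : ℝ} (hσ : Adm σ) (x : ℝ × ℝ) {p : ℝ × ℝ} (hp : 0 < p.2) :
    |(tailDeriv σ x p).det| = 4 * p.2 * |σ| * qf σ x p := by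
  rw [det_tailDeriv hσ, abs_neg, abs_mul, abs_mul, abs_mul, abs_of_pos hp,
    abs_of_nonneg (qf_nonneg _ _ _), abs_of_pos (by norm_num : (0 : ℝ) < 4)]

theorem injOn_tail {σ : ℝ} (hσ : Adm σ) {x : ℝ × ℝ} (hx : x.1 ≠ 0) :
    Set.InjOn (tail σ x) {p | 0 < p.2} := by
  intro p hp p' hp' h
  have h1 : Rel σ (x, tail σ x p) p.1 p.2 := (rel_iff_tail hσ).2 ⟨hp, rfl⟩
  have h2 : Rel σ (x, tail σ x p) p'.1 p'.2 := (rel_iff_tail hσ).2 ⟨hp', h⟩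
  have := Rel.unique hσ hx h1 h2
  exact Prod.ext this.1 this.2

/-- The set of real forms with point in `F` whose discriminant has absolute value in `B`. -/
def region (σ : ℝ) (F : Set (ℝ × ℝ)) (B : Set ℝ) : Set (BCF ℝ) :=
  {f | ∃ p ∈ F, f.2 = tail σ f.1 p ∧ ad σ f.1 p ∈ B}

theorem continuous_tail (σ : ℝ) : Continuous fun w : (ℝ × ℝ) × (ℝ × ℝ) => tail σ w.1 w.2 := by
  unfold tail; fun_prop

theorem continuous_ad (σ : ℝ) : Continuous fun w : (ℝ × ℝ) × (ℝ × ℝ) => ad σ w.1 w.2 := by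
  unfold ad qf; fun_prop

theorem region_eq_image (σ : ℝ) (F : Set (ℝ × ℝ)) (B : Set ℝ) :
    region σ F B = (fun w : (ℝ × ℝ) × (ℝ × ℝ) => (w.1, tail σ w.1 w.2)) ''
      {w | w.2 ∈ F ∧ ad σ w.1 w.2 ∈ B} := by
  ext f
  constructor
  · rintro ⟨p, hp, h1, h2⟩
    exact ⟨(f.1, p), ⟨hp, h2⟩, Prod.ext rfl h1.symm⟩
  · rintro ⟨w, ⟨h1, h2⟩, rfl⟩
    exact ⟨w.2, h1, rfl, h2⟩

theorem isCompact_region {σ : ℝ} (hσ : Adm σ) {F : Set (ℝ × ℝ)} (hF : IsCompact F)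
    (hF0 : ∀ p ∈ F, 0 < p.2) : IsCompact (region σ F (Set.Iic 1)) := by
  rw [region_eq_image]
  refine IsCompact.image ?_ (continuous_fst.prodMk (continuous_tail σ))
  have h0 : 0 < |σ| := abs_pos.2 hσ.ne_zero
  rcases F.eq_empty_or_nonempty with rfl | hne
  · simp
  obtain ⟨q, hq, hqmin⟩ := hF.exists_isMinOn hne (continuous_snd.continuousOn)
  obtain ⟨R, hR⟩ := hF.isBounded.exists_norm_le
  set v₀ := q.2 with hv₀
  have hv0 : 0 < v₀ := hF0 q hq
  obtain ⟨T, hT⟩ : ∃ T : ℝ, T = 1 + 1 / (4 * |σ| ^ 3 * v₀ ^ 2) := ⟨_, rfl⟩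
  have hT0 : 1 ≤ T := by rw [hT]; have : 0 < 1 / (4 * |σ| ^ 3 * v₀ ^ 2) := by positivity
                         linarith
  obtain ⟨A, hA⟩ : ∃ A : ℝ, A = T / v₀ + T := ⟨_, rfl⟩
  have hA0 : 0 ≤ A := by rw [hA]; positivity
  have hc : IsCompact ((Set.Icc (-A) A ×ˢ Set.Icc (-(T * |σ| + A * R)) (T * |σ| + A * R)) ×ˢ F) :=
    (isCompact_Icc.prod isCompact_Icc).prod hF
  refine hc.of_isClosed_subset ?_ ?_
  · exact (hF.isClosed.preimage continuous_snd).inter (isClosed_Iic.preimage (continuous_ad σ))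
  · rintro ⟨⟨a, b⟩, ⟨u, v⟩⟩ ⟨h1, h2⟩
    have hv : v₀ ≤ v := hqmin h1
    have hv1 : 0 < v := hv0.trans_le hv
    have hu : |u| ≤ R := by
      have := hR _ h1
      rw [Prod.norm_def] at this
      exact (le_max_left _ _).trans this
    simp only [ad, Set.mem_Iic] at h2
    have hQ0 := qf_nonneg σ (a, b) (u, v)
    have hQ : qf σ (a, b) (u, v) ^ 2 ≤ T := by
      have h3 : 4 * |σ| ^ 3 * v₀ ^ 2 * qf σ (a, b) (u, v) ^ 2 ≤ 1 :=
        le_trans (by gcongr) h2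
      have h4 : qf σ (a, b) (u, v) ^ 2 ≤ 1 / (4 * |σ| ^ 3 * v₀ ^ 2) := by
        rw [le_div_iff₀ (by positivity)]; linarith
      linarith
    have hQ' : qf σ (a, b) (u, v) ≤ T := by nlinarith
    have hTT : T ≤ T ^ 2 := by nlinarith
    simp only [qf] at hQ'
    have ha : |a| ≤ A := by
      have h5 : (a * v) ^ 2 ≤ T ^ 2 := by nlinarith [sq_nonneg ((b + a * u) / σ)]
      have h6 : |a * v| ≤ T := abs_le_of_sq_le_sq h5 (by linarith)
      rw [abs_mul, abs_of_pos hv1, ← le_div_iff₀ hv1] at h6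
      have h7 : T / v ≤ T / v₀ := by gcongr
      rw [hA]; linarith
    have hb : |b| ≤ T * |σ| + A * R := by
      have h5 : ((b + a * u) / σ) ^ 2 ≤ T ^ 2 := by nlinarith [sq_nonneg (a * v)]
      have h6 : |(b + a * u) / σ| ≤ T := abs_le_of_sq_le_sq h5 (by linarith)
      rw [abs_div, div_le_iff₀ h0] at h6
      have h7 : |b| ≤ |b + a * u| + |a * u| := by
        have := abs_sub (b + a * u) (a * u)
        rwa [add_sub_cancel_right] at this
      rw [abs_mul] at h7
      have h8 : |a| * |u| ≤ A * R := by gcongr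
      linarith
    exact ⟨⟨abs_le.1 ha, abs_le.1 hb⟩, h1⟩

end BCF

/-! ### Volumes as double integrals -/

namespace BCF

open MeasureTheory Topology

/-- The integrand of the volume computation. -/
noncomputable def dens (σ : ℝ) (B : Set ℝ) (x p : ℝ × ℝ) : ENNReal :=
  Set.indicator {w : (ℝ × ℝ) × (ℝ × ℝ) | ad σ w.1 w.2 ∈ B}
    (fun w => ENNReal.ofReal (4 * w.2.2 * |σ| * qf σ w.1 w.2)) (x, p)

theorem measurable_dens (σ : ℝ) {B : Set ℝ} (hB : MeasurableSet B) :
    Measurable fun w : (ℝ × ℝ) × (ℝ × ℝ) => dens σ B w.1 w.2 := by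
  have h : Measurable fun w : (ℝ × ℝ) × (ℝ × ℝ) => ENNReal.ofReal (4 * w.2.2 * |σ| * qf σ w.1 w.2) := by
    unfold qf; fun_prop
  exact h.indicator ((continuous_ad σ).measurable hB)

theorem preimage_region (σ : ℝ) (F : Set (ℝ × ℝ)) (B : Set ℝ) (x : ℝ × ℝ) :
    Prod.mk x ⁻¹' region σ F B = tail σ x '' {p ∈ F | ad σ x p ∈ B} := by
  ext y
  constructor
  · rintro ⟨p, hp, h1, h2⟩; exact ⟨p, ⟨hp, h2⟩, h1.symm⟩
  · rintro ⟨p, ⟨hp, h2⟩, h1⟩; exact ⟨p, hp, h1.symm, h2⟩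

theorem measurable_ad (σ : ℝ) (x : ℝ × ℝ) : Measurable (ad σ x) :=
  ((continuous_ad σ).comp (Continuous.prodMk_right x)).measurable

theorem lintegral_det_eq {σ : ℝ} (hσ : Adm σ) {F : Set (ℝ × ℝ)} (hF : MeasurableSet F)
    (hF0 : ∀ p ∈ F, 0 < p.2) {B : Set ℝ} (hB : MeasurableSet B) (x : ℝ × ℝ) :
    ∫⁻ p in {p ∈ F | ad σ x p ∈ B}, ENNReal.ofReal |(tailDeriv σ x p).det| =
      ∫⁻ p in F, dens σ B x p := by
  have hm : MeasurableSet {p | ad σ x p ∈ B} := measurable_ad σ x hB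
  have h1 : {p ∈ F | ad σ x p ∈ B} = {p | ad σ x p ∈ B} ∩ F := by
    ext p; exact and_comm
  rw [h1, ← Measure.restrict_restrict hm, ← lintegral_indicator hm]
  refine setLIntegral_congr_fun hF fun p hp => ?_
  unfold dens
  by_cases h : ad σ x p ∈ B
  · rw [Set.indicator_of_mem (by exact h), Set.indicator_of_mem (by exact h)]
    rw [abs_det_tailDeriv hσ x (hF0 p hp)]
  · rw [Set.indicator_of_notMem (by exact h), Set.indicator_of_notMem (by exact h)]

theorem volume_region_le {σ : ℝ} (hσ : Adm σ) {F : Set (ℝ × ℝ)} (hF : MeasurableSet F)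
    (hF0 : ∀ p ∈ F, 0 < p.2) {B : Set ℝ} (hB : MeasurableSet B)
    (hm : MeasurableSet (region σ F B)) :
    volume (region σ F B) ≤ ∫⁻ p in F, ∫⁻ x, dens σ B x p := by
  rw [show (volume : Measure (BCF ℝ)) = (volume : Measure (ℝ × ℝ)).prod volume from rfl,
    Measure.prod_apply hm]
  rw [← lintegral_lintegral_swap (f := fun x p => dens σ B x p) (measurable_dens σ hB).aemeasurable]
  refine lintegral_mono fun x => ?_
  rw [preimage_region]
  refine (addHaar_image_le_lintegral_abs_det_fderiv volume (f' := tailDeriv σ x) ?_ ?_).trans ?_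
  · exact hF.inter (measurable_ad σ x hB)
  · exact fun p _ => (hasFDerivAt_tail σ x p).hasFDerivWithinAt
  · exact (lintegral_det_eq hσ hF hF0 hB x).le

theorem le_volume_region {σ : ℝ} (hσ : Adm σ) {F : Set (ℝ × ℝ)} (hF : MeasurableSet F)
    (hF0 : ∀ p ∈ F, 0 < p.2) {B : Set ℝ} (hB : MeasurableSet B)
    (hm : MeasurableSet (region σ F B ∩ {f | f.1.1 ≠ 0})) :
    ∫⁻ p in F, ∫⁻ x, dens σ B x p ≤ volume (region σ F B ∩ {f | f.1.1 ≠ 0}) := by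
  rw [show (volume : Measure (BCF ℝ)) = (volume : Measure (ℝ × ℝ)).prod volume from rfl,
    Measure.prod_apply hm]
  rw [← lintegral_lintegral_swap (f := fun x p => dens σ B x p) (measurable_dens σ hB).aemeasurable]
  have hae : ∀ᵐ x : ℝ × ℝ, x.1 ≠ 0 := by
    rw [ae_iff]
    have : {x : ℝ × ℝ | ¬ x.1 ≠ 0} = {0} ×ˢ Set.univ := by ext x; simp
    rw [this, Measure.volume_eq_prod, Measure.prod_prod]; simp
  refine lintegral_mono_ae (hae.mono fun x hx => ?_)
  have h1 : Prod.mk x ⁻¹' (region σ F B ∩ {f | f.1.1 ≠ 0}) =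
      tail σ x '' {p ∈ F | ad σ x p ∈ B} := by
    rw [← preimage_region]
    ext y
    exact ⟨fun h => h.1, fun h => ⟨h, hx⟩⟩
  have h2 := lintegral_abs_det_fderiv_eq_addHaar_image volume (s := {p ∈ F | ad σ x p ∈ B})
    (f' := tailDeriv σ x)
    (hF.inter (measurable_ad σ x hB)) (fun p _ => (hasFDerivAt_tail σ x p).hasFDerivWithinAt)
    ((injOn_tail hσ hx).mono fun p hp => hF0 p hp.1)
  rw [h1, ← lintegral_det_eq hσ hF hF0 hB x, h2]

theorem isOpen_region {σ : ℝ} (hσ : Adm σ) {F : Set (ℝ × ℝ)} (hF : IsOpen F)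
    (hF0 : ∀ p ∈ F, 0 < p.2) : IsOpen (region σ F (Set.Iio 1) ∩ {f | f.1.1 ≠ 0}) := by
  set Φ : (ℝ × ℝ) × (ℝ × ℝ) → (ℝ × ℝ) × (ℝ × ℝ) := fun w => (w.1, tail σ w.1 w.2) with hΦ
  set W : Set ((ℝ × ℝ) × (ℝ × ℝ)) := {w | (w.2 ∈ F ∧ ad σ w.1 w.2 ∈ Set.Iio 1) ∧ w.1.1 ≠ 0}
    with hW
  have hWo : IsOpen W := by
    refine ((hF.preimage continuous_snd).inter (isOpen_Iio.preimage (continuous_ad σ))).inter ?_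
    exact isOpen_ne.preimage (continuous_fst.comp continuous_fst)
  have himg : region σ F (Set.Iio 1) ∩ {f | f.1.1 ≠ 0} = Φ '' W := by
    rw [region_eq_image]
    ext f
    constructor
    · rintro ⟨⟨w, hw, rfl⟩, h⟩; exact ⟨w, ⟨hw, h⟩, rfl⟩
    · rintro ⟨w, ⟨hw, h⟩, rfl⟩; exact ⟨⟨w, hw, rfl⟩, h⟩
  rw [himg, isOpen_iff_mem_nhds]
  rintro _ ⟨w, hw, rfl⟩
  have hcd : ContDiff ℝ 1 Φ := by
    rw [hΦ]; unfold tail; fun_prop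
  have hs : HasStrictFDerivAt Φ (fderiv ℝ Φ w) w := hcd.contDiffAt.hasStrictFDerivAt (by simp)
  have hfst : (ContinuousLinearMap.fst ℝ (ℝ × ℝ) (ℝ × ℝ)).comp (fderiv ℝ Φ w) =
      ContinuousLinearMap.fst ℝ (ℝ × ℝ) (ℝ × ℝ) := by
    have h1 : HasFDerivAt (fun w => (Φ w).1)
        ((ContinuousLinearMap.fst ℝ (ℝ × ℝ) (ℝ × ℝ)).comp (fderiv ℝ Φ w)) w :=
      hs.hasFDerivAt.fst
    have h2 : HasFDerivAt (fun w : (ℝ × ℝ) × (ℝ × ℝ) => w.1)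
        (ContinuousLinearMap.fst ℝ (ℝ × ℝ) (ℝ × ℝ)) w := hasFDerivAt_fst
    exact h1.unique h2
  have hsnd : ((ContinuousLinearMap.snd ℝ (ℝ × ℝ) (ℝ × ℝ)).comp (fderiv ℝ Φ w)).comp
      (ContinuousLinearMap.inr ℝ (ℝ × ℝ) (ℝ × ℝ)) = tailDeriv σ w.1 w.2 := by
    have h1 : HasFDerivAt (fun q => (Φ (w.1, q)).2)
        (((ContinuousLinearMap.snd ℝ (ℝ × ℝ) (ℝ × ℝ)).comp (fderiv ℝ Φ w)).comp
      (ContinuousLinearMap.inr ℝ (ℝ × ℝ) (ℝ × ℝ))) w.2 := by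
      have h3 : HasFDerivAt (fun w => (Φ w).2)
        ((ContinuousLinearMap.snd ℝ (ℝ × ℝ) (ℝ × ℝ)).comp (fderiv ℝ Φ w)) (w.1, w.2) :=
        hs.hasFDerivAt.snd
      exact h3.comp w.2 (hasFDerivAt_prodMk_right w.1 w.2)
    exact h1.unique (hasFDerivAt_tail σ w.1 w.2)
  have hdet : (tailDeriv σ w.1 w.2).det ≠ 0 := by
    have hp := hF0 _ hw.1.1
    have h0 := hw.2
    rw [det_tailDeriv hσ, neg_ne_zero]
    have : 0 < qf σ w.1 w.2 := by unfold qf; positivity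
    have := hσ.ne_zero
    positivity
  have hsurj : (fderiv ℝ Φ w).range = ⊤ := by
    rw [LinearMap.range_eq_top]
    rintro ⟨y, z⟩
    have hM : Function.Surjective (tailDeriv σ w.1 w.2) := by
      have := (LinearMap.equivOfDetNeZero (tailDeriv σ w.1 w.2 : ℝ × ℝ →ₗ[ℝ] ℝ × ℝ) hdet).surjective
      exact this
    obtain ⟨q, hq⟩ := hM (z - (fderiv ℝ Φ w (y, 0)).2)
    refine ⟨(y, q), ?_⟩
    have e : ((y, q) : (ℝ × ℝ) × (ℝ × ℝ)) = (y, 0) + (0, q) := by simp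
    have e1 : ∀ t, (fderiv ℝ Φ w t).1 = t.1 := fun t => DFunLike.congr_fun hfst t
    have e2 : (fderiv ℝ Φ w (0, q)).2 = tailDeriv σ w.1 w.2 q := DFunLike.congr_fun hsnd q
    refine Prod.ext (e1 _) ?_
    change (fderiv ℝ Φ w (y, q)).2 = z
    rw [e, map_add, Prod.snd_add, e2, hq, add_sub_cancel]
  rw [← hs.map_nhds_eq_of_surj hsurj]
  exact image_mem_map (hWo.mem_nhds hw)

end BCF

/-! ### Evaluation of the volume integrals -/

namespace BCF

open MeasureTheory Topology

theorem lintegral_dens {σ : ℝ} (hσ : Adm σ) {B : Set ℝ} (hB : B = Set.Iio 1 ∨ B = Set.Iic 1)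
    {p : ℝ × ℝ} (hp : 0 < p.2) :
    ∫⁻ x, dens σ B x p = ENNReal.ofReal (Real.pi / (2 * |σ|) * (p.2 ^ 2)⁻¹) := by
  obtain ⟨u, v⟩ := p
  replace hp : 0 < v := hp
  have h0 := hσ.ne_zero
  have hs : 0 < |σ| := abs_pos.2 h0
  have hBm : MeasurableSet B := by rcases hB with rfl | rfl <;> measurability
  set k : ℝ := 4 * |σ| ^ 3 * v ^ 2 with hk
  have hk0 : 0 < k := by positivity
  set c : ℝ := 4 * v * |σ| with hc
  have hc0 : 0 < c := by positivity
  set g : ℝ × ℝ → ENNReal := Set.indicator {w | k * (w.1 ^ 2 + w.2 ^ 2) ^ 2 ∈ B}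
    (fun w => ENNReal.ofReal (c * (w.1 ^ 2 + w.2 ^ 2))) with hg
  have hgm : Measurable g := by
    refine Measurable.indicator (by fun_prop) ?_
    have : Measurable fun w : ℝ × ℝ => k * (w.1 ^ 2 + w.2 ^ 2) ^ 2 := by fun_prop
    exact this hBm
  set M : Matrix (Fin 2) (Fin 2) ℝ := !![v, 0; u / σ, 1 / σ] with hM
  set T : ℝ × ℝ →ₗ[ℝ] ℝ × ℝ := Matrix.toLin (.finTwoProd ℝ) (.finTwoProd ℝ) M with hT
  have hdet : LinearMap.det T = v / σ := by
    rw [hT, LinearMap.det_toLin, hM, Matrix.det_fin_two_of]; ring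
  have hdet0 : LinearMap.det T ≠ 0 := by rw [hdet]; positivity
  have hTx : ∀ x, T x = (x.1 * v, (x.2 + x.1 * u) / σ) := by
    intro x
    rw [hT, hM, Matrix.toLin_finTwoProd_apply]
    ext <;> simp <;> ring
  have h1 : ∀ x, dens σ B x (u, v) = g (T x) := by
    intro x
    have e : (T x).1 ^ 2 + (T x).2 ^ 2 = qf σ x (u, v) := by
      rw [hTx]; simp only [qf]; ring
    unfold dens
    rw [hg]
    by_cases h : ad σ x (u, v) ∈ B
    · rw [Set.indicator_of_mem (by exact h), Set.indicator_of_mem]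
      · rw [e]
      · rw [Set.mem_ofPred_eq, e]; exact h
    · rw [Set.indicator_of_notMem (by exact h), Set.indicator_of_notMem]
      rw [Set.mem_ofPred_eq, e]; exact h
  have h2 : ∫⁻ x, dens σ B x (u, v) = ENNReal.ofReal |(LinearMap.det T)⁻¹| * ∫⁻ x, g x := by
    simp_rw [h1]
    rw [← lintegral_map hgm T.continuous_of_finiteDimensional.measurable,
      Measure.map_linearMap_addHaar_eq_smul_addHaar volume hdet0, lintegral_smul_measure, smul_eq_mul]
  set ρ : ℝ := Real.sqrt (Real.sqrt k⁻¹) with hρ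
  have hρ0 : 0 < ρ := by positivity
  have hρ4 : ρ ^ 4 = k⁻¹ := by
    rw [show ρ ^ 4 = (ρ ^ 2) ^ 2 by ring, hρ, Real.sq_sqrt (by positivity),
      Real.sq_sqrt (by positivity)]
  have h3 : ∫⁻ x, g x = ENNReal.ofReal (2 * Real.pi) * ENNReal.ofReal (c * ρ ^ 4 / 4) := by
    rw [← lintegral_comp_polarCoord_symm]
    set h : ℝ → ENNReal := Set.indicator {r | k * r ^ 4 ∈ B} (fun r => ENNReal.ofReal (c * r ^ 3))
      with hh
    have hhm : Measurable h := by
      refine Measurable.indicator (by fun_prop) ?_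
      have : Measurable fun r : ℝ => k * r ^ 4 := by fun_prop
      exact this hBm
    have h4 : ∀ w ∈ polarCoord.target, ENNReal.ofReal w.1 • g (polarCoord.symm w) = h w.1 := by
      intro w hw
      rw [polarCoord_target] at hw
      have hw1 : 0 < w.1 := hw.1
      have e : (polarCoord.symm w).1 ^ 2 + (polarCoord.symm w).2 ^ 2 = w.1 ^ 2 := by
        simp only [polarCoord_symm_apply]
        linear_combination w.1 ^ 2 * Real.cos_sq_add_sin_sq w.2
      have e4 : (w.1 ^ 2) ^ 2 = w.1 ^ 4 := by ring
      rw [hg, hh]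
      by_cases h : k * w.1 ^ 4 ∈ B
      · have h' : polarCoord.symm w ∈ {w : ℝ × ℝ | k * (w.1 ^ 2 + w.2 ^ 2) ^ 2 ∈ B} := by
          rw [Set.mem_ofPred_eq, e, e4]; exact h
        rw [Set.indicator_of_mem h', Set.indicator_of_mem (by exact h), e, smul_eq_mul,
          ← ENNReal.ofReal_mul hw1.le]
        congr 1; ring
      · have h' : polarCoord.symm w ∉ {w : ℝ × ℝ | k * (w.1 ^ 2 + w.2 ^ 2) ^ 2 ∈ B} := by
          rw [Set.mem_ofPred_eq, e, e4]; exact h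
        rw [Set.indicator_of_notMem h', Set.indicator_of_notMem (by exact h), smul_zero]
    rw [setLIntegral_congr_fun polarCoord.open_target.measurableSet h4, polarCoord_target,
      Measure.volume_eq_prod, ← Measure.prod_restrict, lintegral_prod _ (by fun_prop)]
    simp only [lintegral_const, Measure.restrict_apply_univ, Real.volume_Ioo]
    rw [lintegral_mul_const _ hhm, mul_comm]
    congr 1
    · congr 1; ring
    have hlt : ∀ r, 0 < r → (k * r ^ 4 < 1 ↔ r < ρ) := by
      intro r hr
      rw [← pow_lt_pow_iff_left₀ hr.le hρ0.le (by norm_num : (4 : ℕ) ≠ 0), hρ4,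
        lt_inv_comm₀ (by positivity) hk0, lt_inv_comm₀ hk0 (by positivity), ← one_div,
        lt_div_iff₀ hk0, mul_comm]
    have hle : ∀ r, 0 < r → (k * r ^ 4 ≤ 1 ↔ r ≤ ρ) := by
      intro r hr
      rw [← pow_le_pow_iff_left₀ hr.le hρ0.le (by norm_num : (4 : ℕ) ≠ 0), hρ4,
        ← one_div, le_div_iff₀ hk0, mul_comm]
    have hset : ∫⁻ r in Set.Ioi 0, h r = ∫⁻ r in Set.Ioc 0 ρ, ENNReal.ofReal (c * r ^ 3) := by
      have hm : MeasurableSet {r : ℝ | k * r ^ 4 ∈ B} := by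
        have : Measurable fun r : ℝ => k * r ^ 4 := by fun_prop
        exact this hBm
      rw [hh, lintegral_indicator hm, Measure.restrict_restrict hm]
      rcases hB with rfl | rfl
      · have : {r : ℝ | k * r ^ 4 ∈ Set.Iio 1} ∩ Set.Ioi 0 = Set.Ioo 0 ρ := by
          ext r
          constructor
          · rintro ⟨h1, h2⟩; exact ⟨h2, (hlt r h2).1 h1⟩
          · rintro ⟨h1, h2⟩; exact ⟨(hlt r h1).2 h2, h1⟩
        rw [this, setLIntegral_congr Ioo_ae_eq_Ioc]
      · have : {r : ℝ | k * r ^ 4 ∈ Set.Iic 1} ∩ Set.Ioi 0 = Set.Ioc 0 ρ := by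
          ext r
          constructor
          · rintro ⟨h1, h2⟩; exact ⟨h2, (hle r h2).1 h1⟩
          · rintro ⟨h1, h2⟩; exact ⟨(hle r h1).2 h2, h1⟩
        rw [this]
    rw [hset, ← ofReal_integral_eq_lintegral_ofReal, ← intervalIntegral.integral_of_le hρ0.le]
    · congr 1
      rw [intervalIntegral.integral_const_mul, integral_pow]; norm_num; ring
    · exact (by fun_prop : Continuous fun r : ℝ => c * r ^ 3).integrableOn_Ioc
    · refine (ae_restrict_iff' measurableSet_Ioc).2 (ae_of_all _ fun r hr => ?_)
      have := hr.1
      simp only [Pi.zero_apply]; positivity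
  rw [h2, h3, hdet, hρ4, ← ENNReal.ofReal_mul (by positivity), ← ENNReal.ofReal_mul (by positivity)]
  congr 1
  rw [inv_div, abs_div, abs_of_pos hp, hc, hk]
  field_simp
  ring

end BCF

/-! ### The volume of the fundamental domain -/

namespace BCF

open MeasureTheory Topology

/-- The open fundamental domain for `SL₂(ℤ)`. -/
def fdOpen : Set (ℝ × ℝ) := {p | |p.1| < 1 / 2 ∧ 1 < p.1 ^ 2 + p.2 ^ 2 ∧ 0 < p.2}

/-- The closed fundamental domain for `SL₂(ℤ)`. -/
def fdClosed : Set (ℝ × ℝ) := {p | |p.1| ≤ 1 / 2 ∧ 1 ≤ p.1 ^ 2 + p.2 ^ 2 ∧ 0 < p.2}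

theorem isOpen_fdOpen : IsOpen fdOpen := by
  have h1 : IsOpen {p : ℝ × ℝ | |p.1| < 1 / 2} := isOpen_lt (by fun_prop) (by fun_prop)
  have h2 : IsOpen {p : ℝ × ℝ | 1 < p.1 ^ 2 + p.2 ^ 2} := isOpen_lt (by fun_prop) (by fun_prop)
  have h3 : IsOpen {p : ℝ × ℝ | 0 < p.2} := isOpen_lt (by fun_prop) (by fun_prop)
  exact h1.inter (h2.inter h3)

theorem measurableSet_fdClosed : MeasurableSet fdClosed := by
  have h1 : IsClosed {p : ℝ × ℝ | |p.1| ≤ 1 / 2} := isClosed_le (by fun_prop) (by fun_prop)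
  have h2 : IsClosed {p : ℝ × ℝ | 1 ≤ p.1 ^ 2 + p.2 ^ 2} := isClosed_le (by fun_prop) (by fun_prop)
  have h3 : IsOpen {p : ℝ × ℝ | 0 < p.2} := isOpen_lt (by fun_prop) (by fun_prop)
  exact h1.measurableSet.inter (h2.measurableSet.inter h3.measurableSet)

theorem lintegral_inv_sq {s : ℝ} (hs : 0 < s) :
    ∫⁻ v in Set.Ioi s, ENNReal.ofReal (v ^ 2)⁻¹ = ENNReal.ofReal s⁻¹ := by
  have e : ∀ v ∈ Set.Ioi s, ENNReal.ofReal (v ^ 2)⁻¹ = ENNReal.ofReal (v ^ (-2 : ℝ)) := by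
    intro v hv
    have : 0 < v := hs.trans hv
    rw [Real.rpow_neg this.le, ← Nat.cast_two (R := ℝ), Real.rpow_natCast]
  rw [setLIntegral_congr_fun measurableSet_Ioi e, ← ofReal_integral_eq_lintegral_ofReal,
    integral_Ioi_rpow_of_lt (by norm_num) hs]
  · congr 1
    rw [show (-2 : ℝ) + 1 = -1 by norm_num, Real.rpow_neg_one]; ring
  · exact integrableOn_Ioi_rpow_of_lt (by norm_num) hs
  · refine (ae_restrict_iff' measurableSet_Ioi).2 (ae_of_all _ fun r hr => ?_)
    have : 0 < r := hs.trans hr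
    simp only [Pi.zero_apply]; positivity

theorem arcsin_half : Real.arcsin (1 / 2) = Real.pi / 6 := by
  have := Real.pi_pos
  refine Real.arcsin_eq_of_sin_eq Real.sin_pi_div_six ⟨by linarith, by linarith⟩

theorem lintegral_inv_sqrt :
    ∫⁻ u in Set.Ioc (-(1 / 2)) (1 / 2), ENNReal.ofReal (Real.sqrt (1 - u ^ 2))⁻¹ =
      ENNReal.ofReal (Real.pi / 3) := by
  have hpos : ∀ u : ℝ, u ∈ Set.uIcc (-(1 / 2)) (1 / 2) → 0 < 1 - u ^ 2 := by
    intro u hu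
    rw [Set.uIcc_of_le (by norm_num)] at hu
    nlinarith [hu.1, hu.2]
  have hcont : ContinuousOn (fun u : ℝ => (Real.sqrt (1 - u ^ 2))⁻¹)
      (Set.uIcc (-(1 / 2)) (1 / 2)) := by
    refine ContinuousOn.inv₀ (by fun_prop) fun u hu => ?_
    exact (Real.sqrt_pos.2 (hpos u hu)).ne'
  have hmem := hcont.intervalIntegrable (μ := volume)
  rw [← ofReal_integral_eq_lintegral_ofReal, ← intervalIntegral.integral_of_le (by norm_num),
    intervalIntegral.integral_eq_sub_of_hasDerivAt (f := Real.arcsin) ?_ hmem]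
  · rw [Real.arcsin_neg, arcsin_half]; congr 1; ring
  · intro u hu
    have h := hpos u hu
    have := Real.hasDerivAt_arcsin (x := u) (by rintro rfl; norm_num at h)
      (by rintro rfl; norm_num at h)
    simpa using this
  · rw [intervalIntegrable_iff_integrableOn_Ioc_of_le (by norm_num)] at hmem
    exact hmem
  · exact ae_of_all _ fun r => by simp only [Pi.zero_apply]; positivity

theorem lintegral_fd {E : Set (ℝ × ℝ)} (hE : E = fdOpen ∨ E = fdClosed) :
    ∫⁻ p in E, ENNReal.ofReal (p.2 ^ 2)⁻¹ = ENNReal.ofReal (Real.pi / 3) := by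
  have hEm : MeasurableSet E := by
    rcases hE with rfl | rfl
    · exact isOpen_fdOpen.measurableSet
    · exact measurableSet_fdClosed
  have hm : Measurable fun p : ℝ × ℝ => ENNReal.ofReal (p.2 ^ 2)⁻¹ := by fun_prop
  rw [← lintegral_indicator hEm, Measure.volume_eq_prod,
    lintegral_prod _ (hm.indicator hEm).aemeasurable, ← lintegral_inv_sqrt,
    ← lintegral_indicator measurableSet_Ioc]
  have hne : ∀ᵐ u : ℝ, u ≠ 1 / 2 ∧ u ≠ -(1 / 2) := by
    refine Filter.Eventually.and ?_ ?_ <;> exact Measure.ae_ne volume _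
  refine lintegral_congr_ae (hne.mono fun u hu => ?_)
  change ∫⁻ v, E.indicator _ (u, v) = _
  by_cases hu' : u ∈ Set.Ioc (-(1 / 2) : ℝ) (1 / 2)
  · have hu1 : -(1 / 2) < u := hu'.1
    have hu2 : u < 1 / 2 := lt_of_le_of_ne hu'.2 hu.1
    have hpos : 0 < 1 - u ^ 2 := by nlinarith
    have hs := Real.sqrt_pos.2 hpos
    rw [Set.indicator_of_mem hu', ← lintegral_inv_sq hs]
    have habs : |u| < 1 / 2 := abs_lt.2 ⟨hu1, hu2⟩
    rcases hE with rfl | rfl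
    · rw [← lintegral_indicator measurableSet_Ioi]
      refine lintegral_congr fun v => ?_
      by_cases hv : Real.sqrt (1 - u ^ 2) < v
      · have hv0 := hs.trans hv
        rw [Set.indicator_of_mem, Set.indicator_of_mem (by exact hv)]
        refine ⟨habs, ?_, hv0⟩
        rw [Real.sqrt_lt' hv0] at hv
        simp only; linarith
      · rw [Set.indicator_of_notMem, Set.indicator_of_notMem (by exact hv)]
        rintro ⟨-, h2, h3⟩
        refine hv ((Real.sqrt_lt' h3).2 ?_)
        simp only at h2; linarith
    · rw [setLIntegral_congr Ioi_ae_eq_Ici, ← lintegral_indicator measurableSet_Ici]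
      refine lintegral_congr fun v => ?_
      by_cases hv : Real.sqrt (1 - u ^ 2) ≤ v
      · have hv0 := hs.trans_le hv
        rw [Set.indicator_of_mem, Set.indicator_of_mem (by exact hv)]
        refine ⟨habs.le, ?_, hv0⟩
        rw [Real.sqrt_le_left hv0.le] at hv
        simp only; linarith
      · rw [Set.indicator_of_notMem, Set.indicator_of_notMem (by exact hv)]
        rintro ⟨-, h2, h3⟩
        refine hv ((Real.sqrt_le_left (le_of_lt h3)).2 ?_)
        simp only at h2; linarith
  · rw [Set.indicator_of_notMem hu']
    have : ∀ v, E.indicator (fun p : ℝ × ℝ => ENNReal.ofReal (p.2 ^ 2)⁻¹) (u, v) = 0 := by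
      intro v
      refine Set.indicator_of_notMem ?_ _
      intro h
      have h1 : |u| ≤ 1 / 2 := by
        rcases hE with rfl | rfl
        · exact h.1.le
        · exact h.1
      rw [abs_le] at h1
      exact hu' ⟨lt_of_le_of_ne h1.1 (Ne.symm hu.2), h1.2⟩
    simp_rw [this]; simp

/-- The volume of the set of forms with `|disc| < 1` in the fundamental domain. -/
noncomputable def vol (σ : ℝ) : ℝ := Real.pi ^ 2 / (6 * |σ|)

theorem lintegral_lintegral_dens {σ : ℝ} (hσ : Adm σ) {B : Set ℝ}
    (hB : B = Set.Iio 1 ∨ B = Set.Iic 1) {E : Set (ℝ × ℝ)} (hE : E = fdOpen ∨ E = fdClosed) :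
    ∫⁻ p in E, ∫⁻ x, dens σ B x p = ENNReal.ofReal (vol σ) := by
  have hEm : MeasurableSet E := by
    rcases hE with rfl | rfl
    · exact isOpen_fdOpen.measurableSet
    · exact measurableSet_fdClosed
  have hE0 : ∀ p ∈ E, 0 < p.2 := by
    rcases hE with rfl | rfl <;> exact fun p hp => hp.2.2
  have h0 : 0 < |σ| := abs_pos.2 hσ.ne_zero
  have e : ∀ p ∈ E, ∫⁻ x, dens σ B x p =
      ENNReal.ofReal (Real.pi / (2 * |σ|)) * ENNReal.ofReal (p.2 ^ 2)⁻¹ := by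
    intro p hp
    rw [lintegral_dens hσ hB (hE0 p hp), ENNReal.ofReal_mul (by positivity)]
  rw [setLIntegral_congr_fun hEm e, lintegral_const_mul _ (by fun_prop), lintegral_fd hE,
    ← ENNReal.ofReal_mul (by positivity), vol]
  congr 1
  field_simp
  norm_num

/-- The part of the closed fundamental domain below height `V`. -/
def fdBelow (V : ℝ) : Set (ℝ × ℝ) := {p | |p.1| ≤ 1 / 2 ∧ 1 ≤ p.1 ^ 2 + p.2 ^ 2 ∧ 0 ≤ p.2 ∧ p.2 ≤ V}

theorem fdBelow_pos {V : ℝ} {p : ℝ × ℝ} (hp : p ∈ fdBelow V) : 0 < p.2 := by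
  obtain ⟨h1, h2, h3, -⟩ := hp
  rcases h3.lt_or_eq with h | h
  · exact h
  · rw [← h] at h2
    rw [abs_le] at h1
    nlinarith [h1.1, h1.2]

theorem isCompact_fdBelow (V : ℝ) : IsCompact (fdBelow V) := by
  have h1 : IsClosed {p : ℝ × ℝ | |p.1| ≤ 1 / 2} := isClosed_le (by fun_prop) (by fun_prop)
  have h2 : IsClosed {p : ℝ × ℝ | 1 ≤ p.1 ^ 2 + p.2 ^ 2} := isClosed_le (by fun_prop) (by fun_prop)
  have h3 : IsClosed {p : ℝ × ℝ | 0 ≤ p.2} := isClosed_le (by fun_prop) (by fun_prop)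
  have h4 : IsClosed {p : ℝ × ℝ | p.2 ≤ V} := isClosed_le (by fun_prop) (by fun_prop)
  have hc : IsClosed (fdBelow V) := h1.inter (h2.inter (h3.inter h4))
  refine (isCompact_Icc (a := ((-(1 / 2) : ℝ), (0 : ℝ))) (b := (1 / 2, V))).of_isClosed_subset hc ?_
  rintro p ⟨h1, -, h3, h4⟩
  rw [abs_le] at h1
  exact ⟨⟨h1.1, h3⟩, ⟨h1.2, h4⟩⟩

theorem volume_region_fdBelow_le {σ : ℝ} (hσ : Adm σ) (V : ℝ) :
    volume (region σ (fdBelow V) (Set.Iic 1)) ≤ ENNReal.ofReal (vol σ) := by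
  have hc := isCompact_fdBelow V
  refine (volume_region_le hσ hc.measurableSet (fun p => fdBelow_pos) measurableSet_Iic
    (isCompact_region hσ hc fun p => fdBelow_pos).measurableSet).trans ?_
  rw [← lintegral_lintegral_dens hσ (Or.inr rfl) (Or.inr rfl)]
  exact lintegral_mono_set fun p hp => ⟨hp.1, hp.2.1, fdBelow_pos hp⟩

theorem le_volume_region_fdOpen {σ : ℝ} (hσ : Adm σ) :
    ENNReal.ofReal (vol σ) ≤ volume (region σ fdOpen (Set.Iio 1) ∩ {f | f.1.1 ≠ 0}) := by
  rw [← lintegral_lintegral_dens hσ (Or.inl rfl) (Or.inl rfl)]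
  exact le_volume_region hσ isOpen_fdOpen.measurableSet (fun p hp => hp.2.2) measurableSet_Iio
    (isOpen_region hσ isOpen_fdOpen fun p hp => hp.2.2).measurableSet

end BCF

/-! ### Bounding the number of forms in the cusp -/

namespace BCF

theorem card_Icc_floor_le {B : ℝ} (hB : 1 ≤ B) : ((Finset.Icc (-⌊B⌋) ⌊B⌋).card : ℝ) ≤ 3 * B := by
  have h0 : 0 ≤ ⌊B⌋ := Int.floor_nonneg.2 (by linarith)
  have h1 : ((Finset.Icc (-⌊B⌋) ⌊B⌋).card : ℤ) = 2 * ⌊B⌋ + 1 := by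
    rw [Int.card_Icc, Int.toNat_of_nonneg (by omega)]; ring
  have h2 : ((Finset.Icc (-⌊B⌋) ⌊B⌋).card : ℝ) = 2 * (⌊B⌋ : ℝ) + 1 := by exact_mod_cast h1
  have := Int.floor_le B
  rw [h2]; linarith

theorem mem_Icc_floor {B : ℝ} {n : ℤ} (h : |(n : ℝ)| ≤ B) : n ∈ Finset.Icc (-⌊B⌋) ⌊B⌋ := by
  rw [abs_le] at h
  rw [Finset.mem_Icc, neg_le]
  refine ⟨Int.le_floor.2 ?_, Int.le_floor.2 h.2⟩
  push_cast; linarith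

theorem Adm.abs_cases {σ : ℝ} (h : Adm σ) : |σ| = 1 ∨ |σ| = 1 / 3 := by
  rcases h with rfl | rfl
  · left; norm_num
  · right; rw [abs_of_pos (by norm_num)]

/-- Bounds for the coefficients of a form whose point has height about `t²` and real part
`O(t²)`. -/
theorem Rel.coeff_bounds {σ : ℝ} (hσ : Adm σ) {f : BCF ℝ} {u v r t : ℝ} (h : Rel σ f u v)
    (hr : 0 < r) (ht : 0 < t) (h1 : t ^ 2 ≤ v) (h2 : v ≤ 4 * t ^ 2) (hu : |u| ≤ 4 * t ^ 2)
    (hD : |f.disc| < r ^ 4) :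
    |f.1.1| ≤ 2 * r / t ^ 3 ∧ |f.1.2| ≤ 9 * r / t ∧ |f.2.1| ≤ 136 * r * t ∧
      |f.2.2| ≤ 2240 * r * t ^ 3 := by
  obtain ⟨⟨a, b⟩, c, d⟩ := f
  have hc := h.eq_c
  have hv := h.1
  have hd := h.2.2
  rw [h.abs_disc hσ] at hD
  simp only at hc hd ⊢
  set β := b + a * u with hβ
  have hs1 : 1 / 3 ≤ |σ| := by rcases hσ.abs_cases with h | h <;> rw [h]; norm_num
  have hs2 : |σ| ≤ 1 := by rcases hσ.abs_cases with h | h <;> rw [h]; norm_num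
  have hs0 : 0 < |σ| := by linarith
  have hσ0 := hσ.ne_zero
  simp only [ad, qf] at hD
  rw [← hβ] at hD
  have hsq : (β / σ) ^ 2 = β ^ 2 / |σ| ^ 2 := by rw [div_pow, sq_abs]
  rw [hsq] at hD
  have hv4 : t ^ 4 ≤ v ^ 2 := by
    calc t ^ 4 = (t ^ 2) ^ 2 := by ring
      _ ≤ v ^ 2 := by gcongr
  have hA : (|a| * t ^ 3) ^ 4 ≤ (2 * r) ^ 4 := by
    have e1 : (|a| * t ^ 3) ^ 4 = a ^ 4 * (t ^ 4) ^ 3 := by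
      rw [mul_pow, (by decide : Even 4).pow_abs]; ring
    have e2 : a ^ 4 * (t ^ 4) ^ 3 ≤ a ^ 4 * (v ^ 2) ^ 3 := by gcongr
    have e3 : 4 * (1 / 3) ^ 3 * v ^ 2 * (a ^ 2 * v ^ 2 + 0) ^ 2 ≤
        4 * |σ| ^ 3 * v ^ 2 * (a ^ 2 * v ^ 2 + β ^ 2 / |σ| ^ 2) ^ 2 := by gcongr; positivity
    rw [e1]
    nlinarith [pow_pos hr 4]
  have hB : (|β| * t) ^ 4 ≤ r ^ 4 := by
    have e1 : (|β| * t) ^ 4 = β ^ 4 * t ^ 4 := by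
      rw [mul_pow, (by decide : Even 4).pow_abs]
    have e2 : β ^ 4 * t ^ 4 ≤ β ^ 4 * v ^ 2 := by gcongr
    have e3 : 4 * |σ| ^ 3 * v ^ 2 * (0 + β ^ 2 / |σ| ^ 2) ^ 2 ≤
        4 * |σ| ^ 3 * v ^ 2 * (a ^ 2 * v ^ 2 + β ^ 2 / |σ| ^ 2) ^ 2 := by gcongr; positivity
    have e4 : 4 * |σ| ^ 3 * v ^ 2 * (0 + β ^ 2 / |σ| ^ 2) ^ 2 = 4 * (β ^ 4 * v ^ 2) / |σ| := by
      field_simp; ring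
    have e5 : β ^ 4 * v ^ 2 ≤ 4 * (β ^ 4 * v ^ 2) / |σ| := by
      rw [le_div_iff₀ hs0]
      have : 0 ≤ β ^ 4 * v ^ 2 := by positivity
      nlinarith
    rw [e1]; linarith
  have hA' : |a| * t ^ 3 ≤ 2 * r := le_of_pow_le_pow_left₀ (by norm_num) (by positivity) hA
  have hB' : |β| * t ≤ r := le_of_pow_le_pow_left₀ (by norm_num) hr.le hB
  have hA1 : |a| ≤ 2 * r / t ^ 3 := (le_div_iff₀ (by positivity)).2 hA'
  have hB1 : |β| ≤ r / t := (le_div_iff₀ ht).2 hB'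
  have hb : |b| ≤ 9 * r / t := by
    have e : b = β - a * u := by rw [hβ]; ring
    calc |b| ≤ |β| + |a| * |u| := by rw [e, ← abs_mul]; exact abs_sub _ _
      _ ≤ r / t + 2 * r / t ^ 3 * (4 * t ^ 2) := by gcongr
      _ = 9 * r / t := by field_simp; ring
  have hc' : |c| ≤ 136 * r * t := by
    calc |c| ≤ |σ| * |a| * v ^ 2 + 2 * |b| * |u| + |a| * |u| ^ 2 := by
          rw [hc]
          refine (abs_sub _ _).trans (add_le_add ((abs_sub _ _).trans (add_le_add ?_ ?_)) ?_)
          · rw [abs_mul, abs_mul, abs_of_nonneg (sq_nonneg v)]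
          · rw [abs_mul, abs_mul, abs_two]
          · rw [abs_mul, abs_pow]
      _ ≤ 1 * (2 * r / t ^ 3) * (4 * t ^ 2) ^ 2 + 2 * (9 * r / t) * (4 * t ^ 2) +
          (2 * r / t ^ 3) * (4 * t ^ 2) ^ 2 := by gcongr
      _ = 136 * r * t := by field_simp; ring
  refine ⟨hA1, hb, hc', ?_⟩
  have hσi : |σ⁻¹| ≤ 3 := by
    rw [abs_inv, inv_le_comm₀ hs0 (by norm_num)]; linarith
  have ed : d = σ⁻¹ * β * v ^ 2 - 3 * c * u - 3 * b * u ^ 2 - a * u ^ 3 := by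
    rw [mul_assoc, ← hd]; field_simp; ring
  calc |d| ≤ |σ⁻¹| * |β| * v ^ 2 + 3 * |c| * |u| + 3 * |b| * |u| ^ 2 + |a| * |u| ^ 3 := by
        rw [ed]
        refine (abs_sub _ _).trans (add_le_add ((abs_sub _ _).trans
          (add_le_add ((abs_sub _ _).trans (add_le_add ?_ ?_)) ?_)) ?_)
        · rw [abs_mul, abs_mul, abs_of_nonneg (sq_nonneg v)]
        · rw [abs_mul, abs_mul, abs_of_pos (by norm_num : (0 : ℝ) < 3)]
        · rw [abs_mul, abs_mul, abs_pow, abs_of_pos (by norm_num : (0 : ℝ) < 3)]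
        · rw [abs_mul, abs_pow]
    _ ≤ 3 * (r / t) * (4 * t ^ 2) ^ 2 + 3 * (136 * r * t) * (4 * t ^ 2) +
        3 * (9 * r / t) * (4 * t ^ 2) ^ 2 + (2 * r / t ^ 3) * (4 * t ^ 2) ^ 3 := by gcongr
    _ = 2240 * r * t ^ 3 := by field_simp; ring

theorem card_strip_le {σ : ℝ} (hσ : Adm σ) {r t : ℝ} (hr : 0 < r) (ht : 0 < t)
    (ht' : 1 / 2 ≤ t ^ 2) (T : Finset (BCF ℤ))
    (hT : ∀ f ∈ T, f.1.1 ≠ 0 ∧ |(f.disc : ℝ)| < r ^ 4 ∧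
      ∃ u v, Rel σ f.toReal u v ∧ |u| ≤ 1 / 2 ∧ t ^ 2 ≤ v ∧ v ≤ 4 * t ^ 2) :
    (T.card : ℝ) * t ^ 2 ≤ 6720 ^ 4 * r ^ 4 := by
  rcases T.eq_empty_or_nonempty with rfl | hne
  · simp; positivity
  set L := ⌈t ^ 2⌉₊ with hL
  have hLt : t ^ 2 ≤ L := Nat.le_ceil _
  have htt : 1 / 2 ≤ t := by nlinarith
  set K : ℝ := 2240
  set A := K * r / t ^ 3 with hA
  set B := K * r / t with hB
  set C := K * r * t with hC
  set D := K * r * t ^ 3 with hD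
  have hshift : ∀ f ∈ T, ∀ n ∈ Finset.range L,
      |((f.sub 1 (2 * n) 0 1).1.1 : ℝ)| ≤ 2 * r / t ^ 3 ∧ |((f.sub 1 (2 * n) 0 1).1.2 : ℝ)| ≤ 9 * r / t ∧
      |((f.sub 1 (2 * n) 0 1).2.1 : ℝ)| ≤ 136 * r * t ∧
      |((f.sub 1 (2 * n) 0 1).2.2 : ℝ)| ≤ 2240 * r * t ^ 3 := by
    intro f hf n hn
    obtain ⟨-, h2, u, v, h3, h4, h5, h6⟩ := hT f hf
    have hn' : (n : ℝ) < t ^ 2 := Nat.lt_ceil.1 (Finset.mem_range.1 hn)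
    have h7 : Rel σ (f.sub 1 (2 * n) 0 1).toReal (u - 2 * n) v := by
      rw [toReal_sub]
      have := h3.sub_T (2 * n)
      push_cast
      exact this
    have hdisc : |(f.sub 1 (2 * n) 0 1).toReal.disc| < r ^ 4 := by
      rw [disc_toReal, disc_sub]
      simpa using h2
    refine h7.coeff_bounds hσ hr ht h5 h6 ?_ hdisc
    have hn0 : (0 : ℝ) ≤ n := Nat.cast_nonneg n
    rw [abs_le] at h4 ⊢
    constructor <;> linarith [h4.1, h4.2]
  set box : Finset (BCF ℤ) := (Finset.Icc (-⌊A⌋) ⌊A⌋ ×ˢ Finset.Icc (-⌊B⌋) ⌊B⌋) ×ˢ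
    (Finset.Icc (-⌊C⌋) ⌊C⌋ ×ˢ Finset.Icc (-⌊D⌋) ⌊D⌋) with hbox
  have hmem : ∀ w ∈ T ×ˢ Finset.range L, w.1.sub 1 (2 * w.2) 0 1 ∈ box := by
    rintro ⟨f, n⟩ hw
    obtain ⟨hf, hn⟩ := Finset.mem_product.1 hw
    obtain ⟨h1, h2, h3, h4⟩ := hshift f hf n hn
    refine Finset.mem_product.2 ⟨Finset.mem_product.2 ⟨mem_Icc_floor (h1.trans ?_),
      mem_Icc_floor (h2.trans ?_)⟩, Finset.mem_product.2 ⟨mem_Icc_floor (h3.trans ?_),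
      mem_Icc_floor (h4.trans ?_)⟩⟩
    · rw [hA]; gcongr; norm_num [K]
    · rw [hB]; gcongr; norm_num [K]
    · rw [hC]; gcongr; norm_num [K]
    · exact le_rfl
  have hinj : Set.InjOn (fun w : BCF ℤ × ℕ => w.1.sub 1 (2 * w.2) 0 1) ↑(T ×ˢ Finset.range L) := by
    rintro ⟨f, n⟩ hw ⟨f', n'⟩ hw' h
    obtain ⟨hf, hn⟩ := Finset.mem_product.1 hw
    obtain ⟨hf', hn'⟩ := Finset.mem_product.1 hw'
    simp only at h hf hf' hn hn'
    obtain ⟨h1, -, u, v, h3, h4, -, -⟩ := hT f hf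
    obtain ⟨h1', -, u', v', h3', h4', -, -⟩ := hT f' hf'
    have h7 : Rel σ (f.sub 1 (2 * n) 0 1).toReal (u - 2 * n) v := by
      rw [toReal_sub]; push_cast; exact h3.sub_T (2 * n)
    have h7' : Rel σ (f'.sub 1 (2 * n') 0 1).toReal (u' - 2 * n') v' := by
      rw [toReal_sub]; push_cast; exact h3'.sub_T (2 * n')
    rw [← h] at h7'
    have ha : (f.sub 1 (2 * n) 0 1).toReal.1.1 ≠ 0 := by
      have : (f.sub 1 (2 * n) 0 1).1.1 = f.1.1 := by simp [sub, ev]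
      change (((f.sub 1 (2 * n) 0 1).1.1 : ℤ) : ℝ) ≠ 0
      rw [this]; exact_mod_cast h1
    have heq := (h7.unique hσ ha h7').1
    have hnn : n = n' := by
      rw [abs_le] at h4 h4'
      have e1 : ((n : ℤ) - n' : ℝ) < 1 := by push_cast; linarith
      have e2 : ((n' : ℤ) - n : ℝ) < 1 := by push_cast; linarith
      have e3 : (n : ℤ) - n' < 1 := by exact_mod_cast e1
      have e4 : (n' : ℤ) - n < 1 := by exact_mod_cast e2
      omega
    subst hnn
    have hinv : ∀ g : BCF ℤ, (g.sub 1 (2 * n) 0 1).sub 1 (-(2 * n)) 0 1 = g := by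
      rintro ⟨⟨a, b⟩, c, d⟩
      simp only [sub, ev, Prod.mk.injEq]
      refine ⟨⟨?_, ?_⟩, ?_, ?_⟩ <;> ring
    rw [← hinv f, h, hinv f']
  have hcard : T.card * L ≤ box.card := by
    have := Finset.card_le_card_of_injOn _ hmem hinj
    rwa [Finset.card_product, Finset.card_range] at this
  obtain ⟨f, hf⟩ := hne
  have ha1 : 1 ≤ 2 * r / t ^ 3 := by
    have hLpos : 0 < L := Nat.ceil_pos.2 (by positivity)
    have h1 := (hshift f hf 0 (Finset.mem_range.2 hLpos)).1
    have h2 : (f.sub 1 (2 * (0 : ℕ)) 0 1).1.1 = f.1.1 := by simp [sub, ev]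
    rw [h2] at h1
    refine le_trans ?_ h1
    exact_mod_cast Int.one_le_abs (hT f hf).1
  rw [le_div_iff₀ (by positivity)] at ha1
  have hA1 : 1 ≤ A := by rw [hA, le_div_iff₀ (by positivity)]; norm_num [K]; nlinarith
  have ht3 : 1 / 4 * t ≤ t ^ 3 := by nlinarith
  have hrt : t ≤ 8 * r := by nlinarith
  have hB1 : 1 ≤ B := by rw [hB, le_div_iff₀ (by positivity)]; norm_num [K]; nlinarith
  have hC1 : 1 ≤ C := by rw [hC]; norm_num [K]; nlinarith
  have hD1 : 1 ≤ D := by rw [hD]; norm_num [K]; nlinarith [pow_pos ht 3]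
  have hbc : (box.card : ℝ) ≤ (3 * A * (3 * B)) * (3 * C * (3 * D)) := by
    rw [hbox, Finset.card_product, Finset.card_product, Finset.card_product]
    push_cast
    gcongr <;> apply card_Icc_floor_le <;> assumption
  calc (T.card : ℝ) * t ^ 2 ≤ T.card * L := by gcongr
    _ ≤ box.card := by exact_mod_cast hcard
    _ ≤ _ := hbc
    _ = 6720 ^ 4 * r ^ 4 := by rw [hA, hB, hC, hD]; field_simp; norm_num [K]

/-- The number of forms in the cusp. -/
theorem card_cusp_le {σ : ℝ} (hσ : Adm σ) {r V : ℝ} (hr : 0 < r) (hV : 1 / 2 ≤ V)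
    (T : Finset (BCF ℤ))
    (hT : ∀ f ∈ T, f.1.1 ≠ 0 ∧ |(f.disc : ℝ)| < r ^ 4 ∧
      ∃ u v, Rel σ f.toReal u v ∧ |u| ≤ 1 / 2 ∧ V ≤ v) :
    (T.card : ℝ) ≤ 2 * 6720 ^ 4 * r ^ 4 / V := by
  classical
  have hV0 : 0 < V := by linarith
  choose! hT1 hT2 u v hT3 hT4 hT5 using hT
  have hpow : ∀ f ∈ T, ∃ j : ℕ, v f < V * 4 ^ (j + 1) ∧ V * 4 ^ j ≤ v f := by
    intro f hf
    obtain ⟨j, h1, h2⟩ := exists_nat_pow_near (x := v f / V) (y := 4)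
      ((one_le_div hV0).2 (hT5 f hf)) (by norm_num)
    rw [le_div_iff₀ hV0] at h1
    rw [div_lt_iff₀ hV0] at h2
    exact ⟨j, by linarith, by linarith⟩
  choose! j hj1 hj2 using hpow
  set J := T.sup j + 1
  have hmaps : ∀ f ∈ T, j f ∈ Finset.range J := fun f hf =>
    Finset.mem_range.2 (Nat.lt_succ_of_le (Finset.le_sup hf))
  rw [Finset.card_eq_sum_card_fiberwise hmaps]
  push_cast
  have hstrip : ∀ i ∈ Finset.range J, ((T.filter fun f => j f = i).card : ℝ) ≤
      (6720 ^ 4 * r ^ 4 / V) * (1 / 4) ^ i := by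
    intro i _
    have hs : Real.sqrt (V * 4 ^ i) ^ 2 = V * 4 ^ i := Real.sq_sqrt (by positivity)
    have h4 : (1 : ℝ) ≤ 4 ^ i := one_le_pow₀ (by norm_num)
    have := card_strip_le hσ hr (t := Real.sqrt (V * 4 ^ i)) (by positivity)
      (by rw [hs]; nlinarith) (T.filter fun f => j f = i) (by
        intro f hf
        obtain ⟨hfT, rfl⟩ := Finset.mem_filter.1 hf
        refine ⟨hT1 f hfT, hT2 f hfT, u f, v f, hT3 f hfT, hT4 f hfT, ?_, ?_⟩
        · rw [hs]; exact hj2 f hfT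
        · rw [hs]; have := hj1 f hfT; rw [pow_succ] at this; linarith)
    rw [hs] at this
    rw [one_div, inv_pow, ← div_eq_mul_inv, div_div, le_div_iff₀ (by positivity)]
    exact this
  refine (Finset.sum_le_sum hstrip).trans ?_
  rw [← Finset.mul_sum]
  have hg : ∑ i ∈ Finset.range J, (1 / 4 : ℝ) ^ i ≤ 2 := by
    have h := geom_sum_eq (show (1 / 4 : ℝ) ≠ 1 by norm_num) J
    rw [h]
    have : (0 : ℝ) < (1 / 4) ^ J := by positivity
    rw [div_le_iff_of_neg (by norm_num)]
    linarith
  calc _ ≤ (6720 ^ 4 * r ^ 4 / V) * 2 := by gcongr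
    _ = _ := by ring

end BCF

/-! ### Counting classes of forms satisfying a congruence condition -/

namespace BCF

open MeasureTheory Topology

theorem Rel.smul {σ : ℝ} {f : BCF ℝ} {u v : ℝ} (h : Rel σ f u v) (s : ℝ) : Rel σ (s • f) u v := by
  obtain ⟨hv, h1, h2⟩ := h
  refine ⟨hv, ?_, ?_⟩
  · simp only [Prod.smul_fst, Prod.smul_snd, smul_eq_mul]; linear_combination s * h1
  · simp only [Prod.smul_fst, Prod.smul_snd, smul_eq_mul]; linear_combination s * h2

theorem disc_smul (s : ℝ) (f : BCF ℝ) : (s • f).disc = s ^ 4 * f.disc := by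
  simp only [disc, Prod.smul_fst, Prod.smul_snd, smul_eq_mul]; ring

theorem mem_region_iff {σ : ℝ} (hσ : Adm σ) {F : Set (ℝ × ℝ)} (hF : ∀ p ∈ F, 0 < p.2) {B : Set ℝ}
    {f : BCF ℝ} :
    f ∈ region σ F B ↔ ∃ u v, (u, v) ∈ F ∧ Rel σ f u v ∧ |f.disc| ∈ B := by
  constructor
  · rintro ⟨⟨u, v⟩, hp, h1, h2⟩
    have h : Rel σ f u v := (rel_iff_tail hσ).2 ⟨hF _ hp, h1⟩
    exact ⟨u, v, hp, h, by rw [h.abs_disc hσ]; exact h2⟩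
  · rintro ⟨u, v, hp, h, h2⟩
    exact ⟨(u, v), hp, ((rel_iff_tail hσ).1 h).2, by rw [← h.abs_disc hσ]; exact h2⟩

theorem Rel.disc_pos {σ : ℝ} (hσ : Adm σ) {f : BCF ℝ} {u v : ℝ} (h : Rel σ f u v)
    (ha : f.1.1 ≠ 0) : 0 < σ * f.disc := by
  have h0 := hσ.ne_zero
  rw [h.sign_disc hσ, h.abs_disc hσ, ad, qf]
  have := h.1
  have : 0 < f.1.1 ^ 2 * v ^ 2 := by positivity
  simp only
  positivity

theorem leading_toReal (f : BCF ℤ) : f.toReal.1.1 = f.1.1 := rfl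

/-- Irreducible forms with discriminant of a given sign, bounded by `X`. -/
def irrForms (σ X : ℝ) : Set (BCF ℤ) :=
  {f | f.Irr ∧ 0 < σ * (f.disc : ℝ) ∧ |(f.disc : ℝ)| < X}

theorem equivalent_neg (f : BCF ℤ) : Equivalent f (-f) :=
  ⟨-1, 0, 0, -1, by norm_num, (sub_neg_one f).symm⟩

theorem exists_reduced_pos {σ : ℝ} (hσ : Adm σ) {X : ℝ} {f : BCF ℤ} (hf : f ∈ irrForms σ X) :
    ∃ f' : BCF ℤ, Equivalent f f' ∧ 0 < f'.1.1 ∧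
      ∃ u v, Rel σ f'.toReal u v ∧ (u, v) ∈ fdClosed := by
  obtain ⟨f', h, u, v, h1, h2, h3⟩ := exists_reduced hσ hf.1.leading_ne_zero hf.2.1
  have ha := (hf.1.equivalent h).leading_ne_zero
  rcases ha.lt_or_gt with ha | ha
  · refine ⟨-f', h.trans (equivalent_neg f'), by simpa using ha, u, v, ?_, h3, h2, h1.1⟩
    have : (-f').toReal = -f'.toReal := by
      ext <;> simp [toReal, map]
    rw [this, Rel.neg_iff]; exact h1
  · exact ⟨f', h, ha, u, v, h1, h3, h2, h1.1⟩

/-- Each class of irreducible forms has at least two representatives in the fundamental domain. -/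
theorem exists_reps {σ : ℝ} (hσ : Adm σ) {X : ℝ} (C : Finset (Quotient equivSetoid))
    (hC : ∀ x ∈ C, x ∈ cls '' irrForms σ X) :
    ∃ T : Finset (BCF ℤ), T.card = 2 * C.card ∧ ∀ f ∈ T, f.1.1 ≠ 0 ∧ cls f ∈ C ∧
      |(f.disc : ℝ)| < X ∧ ∃ u v, Rel σ f.toReal u v ∧ (u, v) ∈ fdClosed := by
  classical
  have hex : ∀ x ∈ C, ∃ f : BCF ℤ, cls f = x ∧ 0 < f.1.1 ∧ |(f.disc : ℝ)| < X ∧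
      ∃ u v, Rel σ f.toReal u v ∧ (u, v) ∈ fdClosed := by
    intro x hx
    obtain ⟨f, hf, rfl⟩ := hC x hx
    obtain ⟨f', h, h1, h2⟩ := exists_reduced_pos hσ hf
    exact ⟨f', cls_eq_iff.2 h.symm, h1, by rw [h.disc_eq]; exact hf.2.2, h2⟩
  choose! g hg1 hg2 hg3 hg4 using hex
  have hinj : Set.InjOn g C := fun x hx y hy h => by rw [← hg1 x hx, h, hg1 y hy]
  have hinj' : Set.InjOn (fun x => -g x) C := fun x hx y hy h => hinj hx hy (neg_injective h)
  refine ⟨C.image g ∪ C.image (fun x => -g x), ?_, ?_⟩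
  · rw [Finset.card_union_of_disjoint, Finset.card_image_of_injOn hinj,
      Finset.card_image_of_injOn hinj', two_mul]
    rw [Finset.disjoint_left]
    intro f hf hf'
    obtain ⟨x, hx, rfl⟩ := Finset.mem_image.1 hf
    obtain ⟨y, hy, h⟩ := Finset.mem_image.1 hf'
    have h1 := hg2 x hx
    have h2 := hg2 y hy
    rw [← h] at h1
    simp only [Prod.fst_neg] at h1
    omega
  · intro f hf
    rcases Finset.mem_union.1 hf with hf | hf
    · obtain ⟨x, hx, rfl⟩ := Finset.mem_image.1 hf
      exact ⟨(hg2 x hx).ne', by rw [hg1 x hx]; exact hx, hg3 x hx, hg4 x hx⟩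
    · obtain ⟨x, hx, rfl⟩ := Finset.mem_image.1 hf
      refine ⟨?_, ?_, ?_, ?_⟩
      · simpa using (hg2 x hx).ne'
      · rw [cls_eq_iff.2 (equivalent_neg (g x)).symm, hg1 x hx]; exact hx
      · rw [(equivalent_neg (g x)).disc_eq]; exact hg3 x hx
      · obtain ⟨u, v, h1, h2⟩ := hg4 x hx
        refine ⟨u, v, ?_, h2⟩
        have : (-g x).toReal = -(g x).toReal := by
          ext <;> simp [toReal, map]
        rw [this, Rel.neg_iff]; exact h1

theorem half_le_of_mem_fdClosed {p : ℝ × ℝ} (hp : p ∈ fdClosed) : 1 / 2 ≤ p.2 := by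
  obtain ⟨h1, h2, h3⟩ := hp
  rw [abs_le] at h1
  by_contra h
  push Not at h
  nlinarith [h1.1, h1.2]

/-- The number of classes of irreducible forms is at most linear in the discriminant bound. -/
theorem card_classes_le {σ : ℝ} (hσ : Adm σ) {r : ℝ} (hr : 0 < r)
    (C : Finset (Quotient equivSetoid)) (hC : ∀ x ∈ C, x ∈ cls '' irrForms σ (r ^ 4)) :
    (C.card : ℝ) ≤ 2 * 6720 ^ 4 * r ^ 4 := by
  obtain ⟨T, hT, h⟩ := exists_reps hσ C hC
  have := card_cusp_le hσ hr le_rfl T (fun f hf => by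
    obtain ⟨h1, -, h3, u, v, h4, h5⟩ := h f hf
    exact ⟨h1, h3, u, v, h4, h5.1, half_le_of_mem_fdClosed h5⟩)
  rw [hT] at this
  push_cast at this
  linarith

theorem finite_classes {σ : ℝ} (hσ : Adm σ) (X : ℝ) : (cls '' irrForms σ X).Finite := by
  have hr : ∃ r : ℝ, 0 < r ∧ X ≤ r ^ 4 := by
    refine ⟨max 1 X, by positivity, (le_max_right 1 X).trans ?_⟩
    exact le_self_pow₀ (le_max_left _ _) (by norm_num)
  obtain ⟨r, hr, hX⟩ := hr
  have h : (cls '' irrForms σ (r ^ 4)).Finite := by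
    by_contra hinf
    obtain ⟨n, hn⟩ := exists_nat_gt (2 * 6720 ^ 4 * r ^ 4)
    obtain ⟨C, hC, hc⟩ := Set.Infinite.exists_subset_card_eq hinf n
    have := card_classes_le hσ hr C fun x hx => hC hx
    rw [hc] at this
    linarith
  exact h.subset (Set.image_mono fun f hf => ⟨hf.1, hf.2.1, hf.2.2.trans_le hX⟩)

/-- The upper bound for the number of classes all of whose members satisfy a congruence
condition. -/
theorem card_classes_congr_le {σ : ℝ} (hσ : Adm σ) {m : ℕ} (hm : 0 < m)
    (S : Finset (BCF (ZMod m))) {c : ℝ} (hc : vol σ * (S.card / (m : ℝ) ^ 4) < c) :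
    ∃ r₀ : ℝ, 0 < r₀ ∧ ∀ r ≥ r₀, ∀ C : Finset (Quotient equivSetoid),
      (∀ x ∈ C, x ∈ cls '' irrForms σ (r ^ 4) ∧ ∀ f, cls f = x → f.red m ∈ S) →
      2 * (C.card : ℝ) ≤ c * r ^ 4 := by
  classical
  have hm' : (0 : ℝ) < m := by exact_mod_cast hm
  set ε := c - vol σ * (S.card / (m : ℝ) ^ 4) with hε
  have hε0 : 0 < ε := by linarith
  have hvol : 0 ≤ vol σ := by unfold vol; positivity
  set K : ℝ := 2 * 6720 ^ 4
  have hK : 0 < K := by norm_num [K]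
  set δ := ε / 2 * ((m : ℝ) ^ 4 / (S.card + 1)) with hδ
  have hδ0 : 0 < δ := by positivity
  set V := 1 + 2 * K / ε with hV
  have hV1 : 1 ≤ V := by
    have : 0 ≤ 2 * K / ε := by positivity
    linarith
  have hKV : K / V ≤ ε / 2 := by
    rw [div_le_iff₀ (by linarith), hV]
    field_simp
    linarith
  obtain ⟨r₀, hr₀, hlow⟩ := ncard_le_of_isCompact (isCompact_region hσ (isCompact_fdBelow V)
    (fun p => fdBelow_pos)) (c := vol σ + δ) (by linarith)
    ((volume_region_fdBelow_le hσ V).trans_lt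
      ((ENNReal.ofReal_lt_ofReal_iff (by linarith)).2 (by linarith))) hm
  refine ⟨r₀, hr₀, fun r hr C hC => ?_⟩
  have hr0 : 0 < r := hr₀.trans_le hr
  obtain ⟨T, hT, h⟩ := exists_reps hσ C fun x hx => (hC x hx).1
  set P : BCF ℤ → Prop := fun f => ∃ u v, Rel σ f.toReal u v ∧ |u| ≤ 1 / 2 ∧ V ≤ v with hP
  have h1 := card_cusp_le hσ hr0 (by linarith : 1 / 2 ≤ V) (T.filter P) (fun f hf => by
    obtain ⟨hf, hf'⟩ := Finset.mem_filter.1 hf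
    exact ⟨(h f hf).1, (h f hf).2.2.1, hf'⟩)
  have h2 : ((T.filter fun f => ¬ P f).card : ℝ) ≤ S.card * ((vol σ + δ) * (r / m) ^ 4) := by
    have hmaps : ∀ f ∈ T.filter fun f => ¬ P f, f.red m ∈ S := fun f hf =>
      (hC _ (h f (Finset.mem_filter.1 hf).1).2.1).2 f rfl
    rw [Finset.card_eq_sum_card_fiberwise hmaps, ← nsmul_eq_mul]
    push_cast
    refine Finset.sum_le_card_nsmul _ _ _ fun α _ => hlow r hr α _ fun f hf => ?_
    obtain ⟨hf, hα⟩ := Finset.mem_filter.1 hf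
    obtain ⟨hfT, hf'⟩ := Finset.mem_filter.1 hf
    refine ⟨hα, ?_⟩
    obtain ⟨-, -, h3, u, v, h4, h5⟩ := h f hfT
    rw [mem_region_iff hσ (fun p => fdBelow_pos)]
    refine ⟨u, v, ⟨h5.1, h5.2.1, h5.2.2.le, ?_⟩, h4.smul _, ?_⟩
    · by_contra hlt
      exact hf' ⟨u, v, h4, h5.1, (not_le.1 hlt).le⟩
    · rw [disc_smul, disc_toReal, abs_mul, abs_of_pos (by positivity), inv_pow, Set.mem_Iic,
        inv_mul_le_iff₀ (by positivity), mul_one]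
      exact h3.le
  have h3 : (T.card : ℝ) = (T.filter P).card + (T.filter fun f => ¬ P f).card := by
    rw [← Finset.card_filter_add_card_filter_not (s := T) P]; push_cast; rfl
  rw [hT] at h3
  push_cast at h3
  rw [h3]
  have h4 : (S.card : ℝ) * ((vol σ + δ) * (r / m) ^ 4) ≤ (c - ε / 2) * r ^ 4 := by
    have e : (S.card : ℝ) * ((vol σ + δ) * (r / m) ^ 4) =
        (vol σ * (S.card / (m : ℝ) ^ 4) + ε / 2 * (S.card / (S.card + 1))) * r ^ 4 := by
      rw [hδ]; field_simp
    rw [e]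
    gcongr
    have : (S.card : ℝ) / (S.card + 1) ≤ 1 := by
      rw [div_le_one (by positivity)]; linarith
    nlinarith
  have h5 : 2 * 6720 ^ 4 * r ^ 4 / V ≤ ε / 2 * r ^ 4 := by
    rw [mul_div_right_comm]
    gcongr
  linarith

/-- The form is in the interior of the fundamental domain. -/
def InFd (σ : ℝ) (f : BCF ℤ) : Prop := f.1.1 ≠ 0 ∧ ∃ u v, Rel σ f.toReal u v ∧ (u, v) ∈ fdOpen

/-- Many forms in the fundamental domain satisfying a congruence condition. -/
theorem exists_many_forms {σ : ℝ} (hσ : Adm σ) {c : ℝ} (hc : c < vol σ) :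
    ∃ R : ℝ, 0 < R ∧ ∀ {m : ℕ}, 0 < m → ∀ S : Finset (BCF (ZMod m)),
      ∃ r₀ : ℝ, 0 < r₀ ∧ ∀ r ≥ r₀, ∃ T : Finset (BCF ℤ),
      (∀ f ∈ T, InFd σ f ∧ 0 < σ * (f.disc : ℝ) ∧ |(f.disc : ℝ)| < r ^ 4 ∧ f.red m ∈ S ∧
        ‖f.toReal‖ ≤ R * r) ∧
      c * (S.card / (m : ℝ) ^ 4) * r ^ 4 ≤ T.card := by
  classical
  have hF0 : ∀ p ∈ fdOpen, 0 < p.2 := fun p hp => hp.2.2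
  obtain ⟨R, hR, h⟩ := exists_finset_card_ge
    (isOpen_region hσ isOpen_fdOpen hF0) (c := c)
    (((ENNReal.ofReal_lt_ofReal_iff (by unfold vol; have := abs_pos.2 hσ.ne_zero; positivity)).2
      hc).trans_le (le_volume_region_fdOpen hσ))
  refine ⟨R, hR, fun {m} hm S => ?_⟩
  obtain ⟨r₀, hr₀, h⟩ := h hm
  refine ⟨r₀, hr₀, fun r hr => ?_⟩
  have hr0 : 0 < r := hr₀.trans_le hr
  choose T hT1 hT2 using h r hr
  refine ⟨S.biUnion T, fun f hf => ?_, ?_⟩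
  · obtain ⟨α, hα, hf⟩ := Finset.mem_biUnion.1 hf
    obtain ⟨h1, ⟨h2, h3⟩, h4⟩ := hT1 α f hf
    obtain ⟨u, v, h5, h6, h7⟩ := (mem_region_iff hσ hF0).1 h2
    have hrel : Rel σ f.toReal u v := by
      have := h6.smul r
      rwa [smul_smul, mul_inv_cancel₀ hr0.ne', one_smul] at this
    have ha : f.1.1 ≠ 0 := by
      rintro h0
      refine h3 ?_
      simp [leading_toReal, h0]
    have hpos := hrel.disc_pos hσ (by rw [leading_toReal]; exact_mod_cast ha)
    rw [disc_toReal] at hpos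
    refine ⟨⟨ha, u, v, hrel, h5⟩, hpos, ?_, by rw [h1]; exact hα, h4⟩
    rw [disc_smul, disc_toReal, abs_mul, abs_of_pos (by positivity), inv_pow, Set.mem_Iio,
        inv_mul_lt_iff₀ (by positivity), mul_one] at h7
    exact h7
  · rw [Finset.card_biUnion]
    · push_cast
      have : ∑ _α ∈ S, c * (r / m) ^ 4 ≤ ∑ α ∈ S, ((T α).card : ℝ) :=
        Finset.sum_le_sum fun α _ => hT2 α
      refine le_trans (le_of_eq ?_) this
      rw [Finset.sum_const, nsmul_eq_mul]
      ring
    · intro α _ β _ hne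
      rw [Function.onFun, Finset.disjoint_left]
      intro f hf hf'
      exact hne ((hT1 α f hf).1.symm.trans (hT1 β f hf').1)

/-- Passing to classes is at most two-to-one on the interior of the fundamental domain. -/
theorem card_le_two_mul_card_image {σ : ℝ} (hσ : Adm σ) [DecidableEq (Quotient equivSetoid)]
    (T : Finset (BCF ℤ)) (hT : ∀ f ∈ T, InFd σ f) : T.card ≤ 2 * (T.image cls).card := by
  classical
  refine Finset.card_le_mul_card_image T 2 fun x hx => ?_
  obtain ⟨f, hf, rfl⟩ := Finset.mem_image.1 hx
  refine (Finset.card_le_card (t := {f, -f}) fun f' hf' => ?_).trans Finset.card_le_two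
  obtain ⟨hf', he⟩ := Finset.mem_filter.1 hf'
  obtain ⟨ha, u, v, h1, h2⟩ := hT f hf
  obtain ⟨-, u', v', h1', h2'⟩ := hT f' hf'
  rcases eq_or_eq_neg_of_equivalent hσ (cls_eq_iff.1 he.symm) ha h1 h1' h2.2.1 h2'.2.1 h2.1 h2'.1
    with h | h <;> simp [h]

end BCF

/-! ### Forms in a box whose Hessian is divisible by a large prime -/

namespace BCF

/-- Integers of absolute value at most `N`. -/
noncomputable def seg (N : ℕ) : Finset ℤ := Finset.Icc (-(N : ℤ)) N

theorem mem_seg {N : ℕ} {x : ℤ} : x ∈ seg N ↔ |x| ≤ N := by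
  rw [seg, Finset.mem_Icc, abs_le]

theorem card_seg (N : ℕ) : (seg N).card = 2 * N + 1 := by
  rw [seg, Int.card_Icc]; omega

/-- Integral forms with all coefficients at most `N` in absolute value. -/
noncomputable def box (N : ℕ) : Finset (BCF ℤ) := (seg N ×ˢ seg N) ×ˢ (seg N ×ˢ seg N)

theorem mem_box {N : ℕ} {f : BCF ℤ} :
    f ∈ box N ↔ (|f.1.1| ≤ N ∧ |f.1.2| ≤ N) ∧ (|f.2.1| ≤ N ∧ |f.2.2| ≤ N) := by
  simp only [box, Finset.mem_product, mem_seg]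

theorem card_seg_modEq_le (N : ℕ) {p : ℕ} (hp : 0 < p) (x₀ : ℤ) :
    ((seg N).filter fun x => x ≡ x₀ [ZMOD p]).card ≤ 2 * N / p + 1 := by
  have hp' : (0 : ℤ) < p := by exact_mod_cast hp
  have h := Int.Ioc_filter_modEq_card (-(N : ℤ) - 1) N hp' x₀
  have e : Finset.Ioc (-(N : ℤ) - 1) N = seg N := by
    ext x; rw [seg, Finset.mem_Icc, Finset.mem_Ioc]; omega
  rw [e] at h
  rw [← Int.ofNat_le, h]
  refine max_le ?_ (by positivity)
  have h1 := Int.floor_le (((N : ℤ) - x₀ : ℚ) / (p : ℤ))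
  have h2 := Int.lt_floor_add_one (((-(N : ℤ) - 1 : ℤ) - x₀ : ℚ) / (p : ℤ))
  have h3 : ((2 * N / p : ℕ) : ℤ) = (2 * N : ℤ) / p := by push_cast; rfl
  set A := ⌊((N : ℤ) - x₀ : ℚ) / (p : ℤ)⌋
  set B := ⌊((-(N : ℤ) - 1 : ℤ) - x₀ : ℚ) / (p : ℤ)⌋
  have hpq : (0 : ℚ) < (p : ℤ) := by exact_mod_cast hp'
  rw [le_div_iff₀ hpq] at h1
  rw [div_lt_iff₀ hpq] at h2
  have h1' : A * p ≤ N - x₀ := by exact_mod_cast h1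
  have h2' : -N - 1 - x₀ < (B + 1) * p := by exact_mod_cast h2
  push_cast
  have : (A - B - 1) * p ≤ 2 * N := by linarith
  have := (Int.le_ediv_iff_mul_le hp').2 this
  linarith

theorem dvd_of_hess {p : ℕ} (hp : p.Prime) {f : BCF ℤ} (hA : (p : ℤ) ∣ f.hA) (hC : (p : ℤ) ∣ f.hC)
    (h : (p : ℤ) ∣ f.1.1) : (p : ℤ) ∣ f.1.2 ∧ (p : ℤ) ∣ f.2.1 := by
  have hp' : Prime (p : ℤ) := Nat.prime_iff_prime_int.1 hp
  obtain ⟨⟨a, b⟩, c, d⟩ := f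
  simp only [BCF.hA, BCF.hC] at *
  have hb : (p : ℤ) ∣ b := by
    refine hp'.dvd_of_dvd_pow (n := 2) ?_
    have := dvd_add hA (h.mul_right c)
    ring_nf at this ⊢
    exact this
  refine ⟨hb, hp'.dvd_of_dvd_pow (n := 2) ?_⟩
  have := dvd_add hC (hb.mul_right d)
  ring_nf at this ⊢
  exact this

theorem card_filter_hess_not_dvd {p N : ℕ} (hp : p.Prime) :
    ((box N).filter fun f => ¬ (p : ℤ) ∣ f.1.1 ∧ (p : ℤ) ∣ f.hA ∧ (p : ℤ) ∣ f.hB).card ≤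
      (2 * N / p + 1) ^ 2 * (2 * N + 1) ^ 2 := by
  classical
  have hp' : Prime (p : ℤ) := Nat.prime_iff_prime_int.1 hp
  set T := (box N).filter fun f => ¬ (p : ℤ) ∣ f.1.1 ∧ (p : ℤ) ∣ f.hA ∧ (p : ℤ) ∣ f.hB with hT
  have himg : (T.image Prod.fst).card ≤ (2 * N + 1) ^ 2 := by
    refine (Finset.card_le_card (t := seg N ×ˢ seg N) fun x hx => ?_).trans ?_
    · obtain ⟨f, hf, rfl⟩ := Finset.mem_image.1 hx
      exact (Finset.mem_product.1 (Finset.mem_filter.1 hf).1).1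
    · rw [Finset.card_product, card_seg, sq]
  refine (Finset.card_le_mul_card_image (f := Prod.fst) T ((2 * N / p + 1) ^ 2) ?_).trans
    (Nat.mul_le_mul_left _ himg)
  intro x hx
  obtain ⟨f₀, hf₀, rfl⟩ := Finset.mem_image.1 hx
  refine (Finset.card_le_card_of_injOn (t := ((seg N).filter fun x => x ≡ f₀.2.1 [ZMOD p]) ×ˢ
    ((seg N).filter fun x => x ≡ f₀.2.2 [ZMOD p])) Prod.snd ?_ ?_).trans ?_
  · intro f hf
    obtain ⟨hf, he⟩ := Finset.mem_filter.1 hf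
    obtain ⟨hb, h1, h2, h3⟩ := Finset.mem_filter.1 hf
    obtain ⟨-, h1', h2', h3'⟩ := Finset.mem_filter.1 hf₀
    have hb' := Finset.mem_product.1 (Finset.mem_product.1 hb).2
    obtain ⟨⟨a, b⟩, c, d⟩ := f
    obtain ⟨⟨a', b'⟩, c', d'⟩ := f₀
    simp only [Prod.mk.injEq] at he
    obtain ⟨rfl, rfl⟩ := he
    simp only [BCF.hA, BCF.hB] at *
    have hc : (p : ℤ) ∣ c' - c := by
      refine (hp'.dvd_or_dvd (a := a) ?_).resolve_left h1
      have := dvd_sub h2 h2'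
      ring_nf at this ⊢
      rw [sub_eq_add_neg, add_comm] at *
      exact this
    have hd : (p : ℤ) ∣ d' - d := by
      refine (hp'.dvd_or_dvd (a := a) ?_).resolve_left h1
      have := dvd_add (dvd_sub h3 h3') (hc.mul_left b)
      ring_nf at this ⊢
      rw [sub_eq_add_neg, add_comm] at *
      exact this
    exact Finset.mem_product.2 ⟨Finset.mem_filter.2 ⟨hb'.1, Int.modEq_iff_dvd.2 hc⟩,
      Finset.mem_filter.2 ⟨hb'.2, Int.modEq_iff_dvd.2 hd⟩⟩
  · intro f hf f' hf' h
    exact Prod.ext ((Finset.mem_filter.1 hf).2.trans (Finset.mem_filter.1 hf').2.symm) h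
  · rw [Finset.card_product, sq]
    exact Nat.mul_le_mul (card_seg_modEq_le N hp.pos _) (card_seg_modEq_le N hp.pos _)

theorem card_filter_hess_dvd {p N : ℕ} (hp : p.Prime) :
    ((box N).filter fun f => (p : ℤ) ∣ f.1.1 ∧ (p : ℤ) ∣ f.hA ∧ (p : ℤ) ∣ f.hC).card ≤
      (2 * N / p + 1) ^ 3 * (2 * N + 1) := by
  set S := (seg N).filter fun x => x ≡ 0 [ZMOD p] with hS
  have hSc : S.card ≤ 2 * N / p + 1 := card_seg_modEq_le N hp.pos 0
  refine (Finset.card_le_card (t := (S ×ˢ S) ×ˢ (S ×ˢ seg N)) fun f hf => ?_).trans ?_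
  · obtain ⟨hb, h1, h2, h3⟩ := Finset.mem_filter.1 hf
    obtain ⟨h4, h5⟩ := dvd_of_hess hp h2 h3 h1
    simp only [box, Finset.mem_product] at hb
    simp only [hS, Finset.mem_product, Finset.mem_filter, Int.modEq_zero_iff_dvd]
    exact ⟨⟨⟨hb.1.1, h1⟩, hb.1.2, h4⟩, ⟨hb.2.1, h5⟩, hb.2.2⟩
  · rw [Finset.card_product, Finset.card_product, Finset.card_product, card_seg]
    calc S.card * S.card * (S.card * (2 * N + 1)) = S.card ^ 3 * (2 * N + 1) := by ring
      _ ≤ _ := by gcongr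

theorem card_filter_hA_eq_zero (N : ℕ) :
    ((box N).filter fun f => f.1.1 ≠ 0 ∧ f.hA = 0).card ≤ (2 * N + 1) ^ 3 := by
  refine (Finset.card_le_card_of_injOn (t := (seg N ×ˢ seg N) ×ˢ seg N)
    (fun f => (f.1, f.2.2)) ?_ ?_).trans ?_
  · intro f hf
    have hb := (Finset.mem_filter.1 hf).1
    simp only [box, Finset.mem_product] at hb
    simp only [Finset.coe_product, Set.mem_prod, Finset.mem_coe]
    exact ⟨hb.1, hb.2.2⟩
  · intro f hf f' hf' h
    obtain ⟨-, h1, h2⟩ := Finset.mem_filter.1 hf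
    obtain ⟨-, h1', h2'⟩ := Finset.mem_filter.1 hf'
    obtain ⟨⟨a, b⟩, c, d⟩ := f
    obtain ⟨⟨a', b'⟩, c', d'⟩ := f'
    simp only [Prod.mk.injEq, BCF.hA] at *
    obtain ⟨⟨rfl, rfl⟩, rfl⟩ := h
    refine ⟨⟨rfl, rfl⟩, mul_left_cancel₀ h1 ?_, rfl⟩
    linear_combination h2' - h2
  · rw [Finset.card_product, Finset.card_product, card_seg]; exact le_of_eq (by ring)

theorem card_filter_large_prime {N : ℕ} (T : Finset (BCF ℤ)) (hT : T ⊆ box N)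
    (h : ∀ f ∈ T, f.1.1 ≠ 0 ∧ f.hA ≠ 0 ∧
      ∃ p : ℕ, p.Prime ∧ 2 * N < p ∧ (p : ℤ) ∣ f.hA ∧ (p : ℤ) ∣ f.hB) :
    T.card ≤ (2 * N + 1) ^ 3 := by
  refine (Finset.card_le_card_of_injOn (t := (seg N ×ˢ seg N) ×ˢ seg N)
    (fun f => (f.1, f.2.1)) ?_ ?_).trans ?_
  · intro f hf
    have hb := hT hf
    simp only [box, Finset.mem_product] at hb
    simp only [Finset.coe_product, Set.mem_prod, Finset.mem_coe]
    exact ⟨hb.1, hb.2.1⟩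
  · intro f hf f' hf' heq
    have hb := mem_box.1 (hT hf)
    have hb' := mem_box.1 (hT hf')
    obtain ⟨h1, h2, p, hp, h3, h4, h5⟩ := h f hf
    obtain ⟨h1', h2', p', hp', h3', h4', h5'⟩ := h f' hf'
    obtain ⟨⟨a, b⟩, c, d⟩ := f
    obtain ⟨⟨a', b'⟩, c', d'⟩ := f'
    simp only [Prod.mk.injEq, BCF.hA, BCF.hB] at *
    obtain ⟨⟨rfl, rfl⟩, rfl⟩ := heq
    have hpp : p = p' := by
      by_contra hne
      have hcop : IsCoprime (p : ℤ) p' := Nat.isCoprime_iff_coprime.2 ((Nat.coprime_primes hp hp').2 hne)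
      have hdvd := Int.le_of_dvd (abs_pos.2 h2) ((dvd_abs _ _).2 (hcop.mul_dvd h4 h4'))
      have hle : |b ^ 2 - a * c| ≤ N * N + N * N := by
        refine (abs_sub _ _).trans ?_
        rw [sq, abs_mul, abs_mul]
        gcongr <;> tauto
      have : (2 * N + 1 : ℤ) * (2 * N + 1) ≤ p * p' := by
        gcongr <;> omega
      nlinarith
    subst hpp
    have hdiv : (p : ℤ) ∣ d - d' := by
      have hpr : Prime (p : ℤ) := Nat.prime_iff_prime_int.1 hp
      refine (hpr.dvd_or_dvd (a := a) ?_).resolve_left fun hd => ?_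
      · have := dvd_sub h5' h5
        ring_nf at this ⊢
        exact this
      · have := Int.le_of_dvd (abs_pos.2 h1) ((dvd_abs _ _).2 hd)
        omega
    have : d - d' = 0 := by
      refine Int.eq_zero_of_abs_lt_dvd hdiv ?_
      have := abs_sub d d'
      omega
    exact ⟨⟨rfl, rfl⟩, rfl, by linarith⟩
  · rw [Finset.card_product, Finset.card_product, card_seg]; exact le_of_eq (by ring)

/-- Few forms in a box have a Hessian divisible by a large prime. -/
theorem card_hess_le {N M : ℕ} (hN : 0 < N) (hM : 0 < M) (T : Finset (BCF ℤ)) (hT : T ⊆ box N)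
    (h : ∀ f ∈ T, f.1.1 ≠ 0 ∧
      ∃ p : ℕ, p.Prime ∧ M < p ∧ (p : ℤ) ∣ f.hA ∧ (p : ℤ) ∣ f.hB ∧ (p : ℤ) ∣ f.hC) :
    (T.card : ℝ) ≤ 336 * N ^ 4 / M + 54 * N ^ 3 := by
  classical
  set T₁ := (box N).filter fun f => f.1.1 ≠ 0 ∧ f.hA = 0 with hT₁
  set T₂ := T.filter fun f => f.hA ≠ 0 ∧ ∃ p : ℕ, p.Prime ∧ 2 * N < p ∧ (p : ℤ) ∣ f.hA ∧
    (p : ℤ) ∣ f.hB with hT₂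
  set U : ℕ → Finset (BCF ℤ) := fun p =>
    (box N).filter fun f => ¬ (p : ℤ) ∣ f.1.1 ∧ (p : ℤ) ∣ f.hA ∧ (p : ℤ) ∣ f.hB with hU
  set W : ℕ → Finset (BCF ℤ) := fun p =>
    (box N).filter fun f => (p : ℤ) ∣ f.1.1 ∧ (p : ℤ) ∣ f.hA ∧ (p : ℤ) ∣ f.hC with hW
  set Pr := (Finset.Ioc M (2 * N)).filter Nat.Prime with hPr
  have hsub : T ⊆ (T₁ ∪ T₂) ∪ Pr.biUnion fun p => U p ∪ W p := by
    intro f hf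
    obtain ⟨h1, p, hp, hMp, h2, h3, h4⟩ := h f hf
    rw [Finset.mem_union, Finset.mem_union]
    by_cases h0 : f.hA = 0
    · exact Or.inl (Or.inl (Finset.mem_filter.2 ⟨hT hf, h1, h0⟩))
    by_cases hpN : 2 * N < p
    · exact Or.inl (Or.inr (Finset.mem_filter.2 ⟨hf, h0, p, hp, hpN, h2, h3⟩))
    · refine Or.inr (Finset.mem_biUnion.2 ⟨p, Finset.mem_filter.2
        ⟨Finset.mem_Ioc.2 ⟨hMp, not_lt.1 hpN⟩, hp⟩, ?_⟩)
      by_cases ha : (p : ℤ) ∣ f.1.1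
      · exact Finset.mem_union_right _ (Finset.mem_filter.2 ⟨hT hf, ha, h2, h4⟩)
      · exact Finset.mem_union_left _ (Finset.mem_filter.2 ⟨hT hf, ha, h2, h3⟩)
  have hc1 : (T₁.card : ℝ) ≤ 27 * N ^ 3 := by
    have h1 : (T₁.card : ℝ) ≤ (2 * N + 1) ^ 3 := by exact_mod_cast card_filter_hA_eq_zero N
    have h2 : (1 : ℝ) ≤ N := by exact_mod_cast hN
    calc _ ≤ (2 * (N : ℝ) + 1) ^ 3 := h1
      _ ≤ (2 * N + N) ^ 3 := by gcongr
      _ = _ := by ring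
  have hc2 : (T₂.card : ℝ) ≤ 27 * N ^ 3 := by
    have h1 : (T₂.card : ℝ) ≤ (2 * N + 1) ^ 3 := by
      exact_mod_cast card_filter_large_prime (N := N) T₂ ((Finset.filter_subset _ _).trans hT)
        fun f hf => ⟨(h f (Finset.mem_filter.1 hf).1).1, (Finset.mem_filter.1 hf).2⟩
    have h2 : (1 : ℝ) ≤ N := by exact_mod_cast hN
    calc _ ≤ (2 * (N : ℝ) + 1) ^ 3 := h1
      _ ≤ (2 * N + N) ^ 3 := by gcongr
      _ = _ := by ring
  have hc3 : ∀ p ∈ Pr, (((U p ∪ W p).card : ℕ) : ℝ) ≤ 336 * N ^ 4 * ((p : ℝ) ^ 2)⁻¹ := by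
    intro p hp
    obtain ⟨hp1, hp⟩ := Finset.mem_filter.1 hp
    have hp2 : (p : ℝ) ≤ 2 * N := by exact_mod_cast (Finset.mem_Ioc.1 hp1).2
    have hp0 : (1 : ℝ) ≤ p := by exact_mod_cast hp.one_le
    have hN1 : (1 : ℝ) ≤ N := by exact_mod_cast hN
    have hk : ((2 * N / p + 1 : ℕ) : ℝ) ≤ 4 * N / p := by
      push_cast
      have : ((2 * N / p : ℕ) : ℝ) ≤ (2 * N : ℕ) / (p : ℕ) := Nat.cast_div_le
      push_cast at this
      have h2 : 1 ≤ 2 * N / (p : ℝ) := (one_le_div (by linarith)).2 hp2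
      calc _ ≤ 2 * N / (p : ℝ) + 2 * N / p := add_le_add this h2
        _ = _ := by ring
    have h3 : (2 * N + 1 : ℝ) ≤ 3 * N := by linarith
    have hU' : ((U p).card : ℝ) ≤ (4 * N / p) ^ 2 * (3 * N) ^ 2 := by
      have : ((U p).card : ℝ) ≤ ((2 * N / p + 1 : ℕ) : ℝ) ^ 2 * (2 * N + 1) ^ 2 := by
        exact_mod_cast card_filter_hess_not_dvd (N := N) hp
      refine this.trans ?_
      gcongr
    have hW' : ((W p).card : ℝ) ≤ (4 * N / p) ^ 3 * (3 * N) := by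
      have : ((W p).card : ℝ) ≤ ((2 * N / p + 1 : ℕ) : ℝ) ^ 3 * (2 * N + 1) := by
        exact_mod_cast card_filter_hess_dvd (N := N) hp
      refine this.trans ?_
      gcongr
    have h4 : ((U p ∪ W p).card : ℝ) ≤ (U p).card + (W p).card := by
      exact_mod_cast Finset.card_union_le _ _
    have h5 : (4 * N / p : ℝ) ^ 3 * (3 * N) ≤ 192 * N ^ 4 * ((p : ℝ) ^ 2)⁻¹ := by
      rw [div_pow, div_mul_eq_mul_div, ← div_eq_mul_inv,
        show (4 * N : ℝ) ^ 3 * (3 * N) = 192 * N ^ 4 by ring]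
      gcongr
      · norm_num
    calc _ ≤ _ := h4
      _ ≤ (4 * N / p) ^ 2 * (3 * N) ^ 2 + 192 * N ^ 4 * ((p : ℝ) ^ 2)⁻¹ :=
          add_le_add hU' (hW'.trans h5)
      _ = _ := by field_simp; ring
  have hsum : ∑ p ∈ Pr, ((p : ℝ) ^ 2)⁻¹ ≤ (M : ℝ)⁻¹ := by
    refine (Finset.sum_le_sum_of_subset_of_nonneg (Finset.filter_subset _ _)
      fun _ _ _ => by positivity).trans ?_
    rcases le_total M (2 * N) with hle | hle
    · refine (sum_Ioc_inv_sq_le_sub hM.ne' hle).trans ?_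
      have : (0 : ℝ) ≤ ((2 * N : ℕ) : ℝ)⁻¹ := by positivity
      linarith
    · rw [Finset.Ioc_eq_empty (by omega), Finset.sum_empty]; positivity
  have hcard : (T.card : ℝ) ≤ (T₁.card + T₂.card) + ∑ p ∈ Pr, ((U p ∪ W p).card : ℝ) := by
    have h1 := Finset.card_le_card hsub
    have h2 := Finset.card_union_le (T₁ ∪ T₂) (Pr.biUnion fun p => U p ∪ W p)
    have h3 := Finset.card_union_le T₁ T₂
    have h4 := Finset.card_biUnion_le (s := Pr) (t := fun p => U p ∪ W p)
    have : T.card ≤ (T₁.card + T₂.card) + ∑ p ∈ Pr, (U p ∪ W p).card := by omega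
    exact_mod_cast this
  calc _ ≤ _ := hcard
    _ ≤ (27 * N ^ 3 + 27 * N ^ 3) + ∑ p ∈ Pr, 336 * N ^ 4 * ((p : ℝ) ^ 2)⁻¹ :=
        add_le_add (add_le_add hc1 hc2) (Finset.sum_le_sum hc3)
    _ ≤ (27 * N ^ 3 + 27 * N ^ 3) + 336 * N ^ 4 * (M : ℝ)⁻¹ := by
        rw [← Finset.mul_sum]; gcongr
    _ = _ := by ring

end BCF

/-! ### Reducible forms in a box -/

namespace BCF

theorem exists_coprime_root {f : BCF ℤ} (hf : ¬f.Irr) :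
    ∃ p q : ℤ, IsCoprime p q ∧ f.ev p q = 0 := by
  unfold Irr at hf
  push Not at hf
  obtain ⟨x, y, h, hxy⟩ := hf
  have hg : Int.gcd x y ≠ 0 := by
    rw [Ne, Int.gcd_eq_zero_iff]
    exact fun h' => hxy h'.1 h'.2
  have hg' : (Int.gcd x y : ℤ) ≠ 0 := by exact_mod_cast hg
  obtain ⟨p, hp⟩ := Int.gcd_dvd_left x y
  obtain ⟨q, hq⟩ := Int.gcd_dvd_right x y
  refine ⟨p, q, ?_, ?_⟩
  · rw [Int.isCoprime_iff_gcd_eq_one]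
    have h1 := Int.gcd_mul_left (Int.gcd x y : ℤ) p q
    rw [← hp, ← hq, Int.natAbs_natCast] at h1
    exact mul_left_cancel₀ hg (by rw [mul_one]; exact h1.symm)
  · have e : f.ev x y = (Int.gcd x y : ℤ) ^ 3 * f.ev p q := by
      generalize (Int.gcd x y : ℤ) = g at hp hq
      rw [hp, hq]
      simp only [ev]; ring
    rw [e] at h
    exact (mul_eq_zero.1 h).resolve_left (pow_ne_zero 3 hg')

/-- Pairs of nonzero integers with product at most `N`. -/
noncomputable def factorPairs (N : ℕ) : Finset (ℤ × ℤ) :=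
  (seg N ×ˢ seg N).filter fun x => x.1 ≠ 0 ∧ x.2 ≠ 0 ∧ |x.1 * x.2| ≤ N

theorem mem_factorPairs {N : ℕ} {x y : ℤ} (h : x * y ≠ 0) (hN : |x * y| ≤ N) :
    (x, y) ∈ factorPairs N := by
  obtain ⟨hx, hy⟩ := mul_ne_zero_iff.1 h
  have h1 := Int.one_le_abs hx
  have h2 := Int.one_le_abs hy
  simp only [factorPairs, Finset.mem_filter, Finset.mem_product, mem_seg]
  refine ⟨⟨?_, ?_⟩, hx, hy, hN⟩ <;> rw [abs_mul] at hN <;> nlinarith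

theorem card_factorPairs_le (N : ℕ) :
    ((factorPairs N).card : ℝ) ≤ 6 * N * (1 + Real.log N) := by
  classical
  have h1 : (factorPairs N).card ≤ ∑ n ∈ Finset.Icc 1 N, 2 * (2 * (N / n) + 1) := by
    have hm : ∀ x ∈ factorPairs N, x.1.natAbs ∈ Finset.Icc 1 N := by
      intro x hx
      simp only [factorPairs, Finset.mem_filter, Finset.mem_product, mem_seg] at hx
      rw [Finset.mem_Icc]
      have := hx.1.1
      have := hx.2.1
      rw [Int.abs_eq_natAbs] at *
      omega
    rw [Finset.card_eq_sum_card_fiberwise hm]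
    refine Finset.sum_le_sum fun n hn => ?_
    rw [Finset.mem_Icc] at hn
    have hsub : (factorPairs N).filter (fun x => x.1.natAbs = n) ⊆
        ({(n : ℤ), -(n : ℤ)} : Finset ℤ) ×ˢ seg (N / n) := by
      rintro ⟨x, y⟩ hx
      simp only [factorPairs, Finset.mem_filter, Finset.mem_product, mem_seg] at hx
      obtain ⟨⟨-, -, -, hxy⟩, hxn⟩ := hx
      simp only [Finset.mem_product, Finset.mem_insert, Finset.mem_singleton, mem_seg]
      rw [Int.abs_eq_natAbs] at *
      refine ⟨by omega, ?_⟩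
      have : y.natAbs ≤ N / n := by
        rw [Nat.le_div_iff_mul_le hn.1, ← hxn, mul_comm, ← Int.natAbs_mul]
        omega
      omega
    refine (Finset.card_le_card hsub).trans ?_
    rw [Finset.card_product, card_seg]
    exact Nat.mul_le_mul_right _ Finset.card_le_two
  have h2 : (∑ n ∈ Finset.Icc 1 N, 2 * (2 * (N / n) + 1) : ℕ) ≤
      6 * N * ((harmonic N : ℚ) : ℝ) := by
    rw [harmonic_eq_sum_Icc]
    push_cast
    rw [Finset.mul_sum]
    refine Finset.sum_le_sum fun n hn => ?_
    rw [Finset.mem_Icc] at hn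
    have hn0 : (0 : ℝ) < n := by exact_mod_cast hn.1
    have h3 : ((N / n : ℕ) : ℝ) ≤ N / n := Nat.cast_div_le
    have h4 : (1 : ℝ) ≤ N / n := by
      rw [le_div_iff₀ hn0, one_mul]; exact_mod_cast hn.2
    calc (2 * (2 * ((N / n : ℕ) : ℝ) + 1)) ≤ 6 * (N / n) := by linarith
      _ = 6 * N * (n : ℝ)⁻¹ := by rw [div_eq_mul_inv]; ring
  calc ((factorPairs N).card : ℝ) ≤ _ := by exact_mod_cast h1
    _ ≤ _ := h2
    _ ≤ _ := mul_le_mul_of_nonneg_left (harmonic_le_one_add_log N) (by positivity)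

theorem card_not_irr_le {N : ℕ} (T : Finset (BCF ℤ)) (hT : T ⊆ box N)
    (h : ∀ f ∈ T, f.1.1 ≠ 0 ∧ ¬f.Irr) :
    T.card ≤ (2 * N + 1) ^ 3 + (2 * N + 1) * (factorPairs N).card ^ 2 := by
  classical
  rw [← Finset.card_filter_add_card_filter_not (s := T) (fun f => f.2.2 = 0)]
  refine add_le_add ?_ ?_
  · have hsub : T.filter (fun f => f.2.2 = 0) ⊆ (seg N ×ˢ seg N) ×ˢ (seg N ×ˢ {0}) := by
      intro f hf
      rw [Finset.mem_filter] at hf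
      have := mem_box.1 (hT hf.1)
      simp only [Finset.mem_product, mem_seg, Finset.mem_singleton]
      exact ⟨this.1, this.2.1, hf.2⟩
    refine (Finset.card_le_card hsub).trans (le_of_eq ?_)
    simp only [Finset.card_product, card_seg, Finset.card_singleton]
    ring
  · have hr : ∀ f : BCF ℤ, ∃ p q : ℤ, ¬f.Irr → IsCoprime p q ∧ f.ev p q = 0 := by
      intro f
      by_cases hf : f.Irr
      · exact ⟨0, 0, fun h => absurd hf h⟩
      · obtain ⟨p, q, h⟩ := exists_coprime_root hf
        exact ⟨p, q, fun _ => h⟩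
    choose p q hpq using hr
    have key : ∀ f ∈ T.filter (fun f => ¬f.2.2 = 0), p f ≠ 0 ∧ q f ≠ 0 ∧
        f.1.1 = q f * (f.1.1 / q f) ∧ f.2.2 = p f * (f.2.2 / p f) ∧ f.ev (p f) (q f) = 0 := by
      intro f hf
      rw [Finset.mem_filter] at hf
      obtain ⟨ha, hirr⟩ := h f hf.1
      obtain ⟨hc, h0⟩ := hpq f hirr
      have hqa : q f ∣ f.1.1 := by
        refine (hc.symm.pow_right (n := 3)).dvd_of_dvd_mul_right ?_
        refine (dvd_add_right (a := q f) (b := q f * (3 * f.1.2 * p f ^ 2 + 3 * f.2.1 * p f * q f +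
          f.2.2 * q f ^ 2)) (dvd_mul_right _ _)).1 ?_
        have : q f * (3 * f.1.2 * p f ^ 2 + 3 * f.2.1 * p f * q f + f.2.2 * q f ^ 2) +
          f.1.1 * p f ^ 3 = f.ev (p f) (q f) := by simp only [ev]; ring
        rw [this, h0]; exact dvd_zero _
      have hpd : p f ∣ f.2.2 := by
        refine (hc.pow_right (n := 3)).dvd_of_dvd_mul_right ?_
        refine (dvd_add_right (a := p f) (b := p f * (f.1.1 * p f ^ 2 + 3 * f.1.2 * p f * q f +
          3 * f.2.1 * q f ^ 2)) (dvd_mul_right _ _)).1 ?_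
        have : p f * (f.1.1 * p f ^ 2 + 3 * f.1.2 * p f * q f + 3 * f.2.1 * q f ^ 2) +
          f.2.2 * q f ^ 3 = f.ev (p f) (q f) := by simp only [ev]; ring
        rw [this, h0]; exact dvd_zero _
      refine ⟨?_, ?_, (Int.mul_ediv_cancel' hqa).symm, (Int.mul_ediv_cancel' hpd).symm, h0⟩
      · rintro h1; rw [h1, zero_dvd_iff] at hpd; exact hf.2 hpd
      · rintro h1; rw [h1, zero_dvd_iff] at hqa; exact ha hqa
    have hc : (T.filter (fun f => ¬f.2.2 = 0)).card ≤
        (seg N ×ˢ (factorPairs N ×ˢ factorPairs N)).card := by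
      refine Finset.card_le_card_of_injOn
        (fun f => (f.1.2, (q f, f.1.1 / q f), (p f, f.2.2 / p f))) ?_ ?_
      · intro f hf
        obtain ⟨h1, h2, h3, h4, -⟩ := key f hf
        rw [Finset.mem_coe, Finset.mem_filter] at hf
        have hb := mem_box.1 (hT hf.1)
        simp only [Finset.coe_product, Set.mem_prod, Finset.mem_coe, mem_seg]
        exact ⟨hb.1.2, mem_factorPairs (by rw [← h3]; exact (h f hf.1).1) (by rw [← h3]; exact hb.1.1),
          mem_factorPairs (by rw [← h4]; exact hf.2) (by rw [← h4]; exact hb.2.2)⟩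
      · intro f hf f' hf' e
        obtain ⟨h1, h2, h3, h4, h5⟩ := key f hf
        obtain ⟨-, -, h3', h4', h5'⟩ := key f' hf'
        simp only [Prod.mk.injEq] at e
        obtain ⟨eb, ⟨eq, ea⟩, ep, ed⟩ := e
        rw [← ea, ← eq, ← h3] at h3'
        rw [← ed, ← ep, ← h4] at h4'
        rw [← ep, ← eq] at h5'
        have hc : f.2.1 = f'.2.1 := by
          have h6 : 3 * p f * q f ^ 2 * (f.2.1 - f'.2.1) = 0 := by
            simp only [ev, h3', h4', ← eb] at h5 h5'
            linear_combination h5 - h5'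
          have h7 : 3 * p f * q f ^ 2 ≠ 0 := by positivity
          exact sub_eq_zero.1 ((mul_eq_zero.1 h6).resolve_left h7)
        exact Prod.ext (Prod.ext h3'.symm eb) (Prod.ext hc h4'.symm)
    refine hc.trans (le_of_eq ?_)
    rw [Finset.card_product, Finset.card_product, card_seg, sq]

theorem eventually_card_not_irr_le {ε : ℝ} (hε : 0 < ε) :
    ∀ᶠ N : ℕ in atTop, ∀ T : Finset (BCF ℤ), T ⊆ box N → (∀ f ∈ T, f.1.1 ≠ 0 ∧ ¬f.Irr) →
      (T.card : ℝ) ≤ ε * N ^ 4 := by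
  have hlog : Tendsto (fun N : ℕ => (1 + Real.log N) ^ 2 / N) atTop (nhds 0) := by
    have h1 : Tendsto (fun x : ℝ => (1 : ℝ) / x + 2 * (Real.log x / x) + Real.log x ^ 2 / x) atTop
        (nhds (0 + 2 * 0 + 0)) := by
      refine ((tendsto_const_nhds.div_atTop tendsto_id).add (Tendsto.const_mul _ ?_)).add ?_
      · exact Real.isLittleO_log_id_atTop.tendsto_div_nhds_zero
      · exact Real.isLittleO_pow_log_id_atTop.tendsto_div_nhds_zero
    have h2 := h1.comp tendsto_natCast_atTop_atTop
    simp only [mul_zero, add_zero] at h2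
    refine h2.congr fun N => ?_
    simp only [Function.comp]
    ring
  have hinv : Tendsto (fun N : ℕ => (1 : ℝ) / N) atTop (nhds 0) := tendsto_one_div_atTop_nhds_zero_nat
  have h3 := (hinv.const_mul 27).add (hlog.const_mul 108)
  simp only [mul_zero, add_zero] at h3
  filter_upwards [h3.eventually_le_const hε, eventually_ge_atTop 1] with N hN hN1 T hT h
  have hN0 : (1 : ℝ) ≤ N := by exact_mod_cast hN1
  have hN0' : (0 : ℝ) < N := by linarith
  have hQ := card_factorPairs_le N
  have hl : 0 ≤ Real.log N := Real.log_nonneg hN0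
  calc (T.card : ℝ) ≤ (2 * N + 1) ^ 3 + (2 * N + 1) * ((factorPairs N).card : ℝ) ^ 2 := by
        exact_mod_cast card_not_irr_le T hT h
    _ ≤ (3 * N) ^ 3 + (3 * N) * (6 * N * (1 + Real.log N)) ^ 2 := by gcongr <;> linarith
    _ = (27 * (1 / N) + 108 * ((1 + Real.log N) ^ 2 / N)) * N ^ 4 := by field_simp; ring
    _ ≤ ε * N ^ 4 := by gcongr

end BCF

/-! ### Classes whose discriminant has a square factor for a simple reason -/

namespace BCF

/-- The square of `p` divides the discriminant, but `p` does not divide the Hessian. -/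
def Weak (p : ℕ) (f : BCF ℤ) : Prop :=
  (p : ℤ) ^ 2 ∣ f.disc ∧ ¬((p : ℤ) ∣ f.hA ∧ (p : ℤ) ∣ f.hB ∧ (p : ℤ) ∣ f.hC)

/-- The form `(p² a, p b, c, d)`. -/
def up (p : ℤ) (h : BCF ℤ) : BCF ℤ := ((p ^ 2 * h.1.1, p * h.1.2), (h.2.1, h.2.2))

/-- The form `(a, b, c, p d)`. -/
def down (p : ℤ) (h : BCF ℤ) : BCF ℤ := ((h.1.1, h.1.2), (h.2.1, p * h.2.2))

theorem disc_up (p : ℤ) (h : BCF ℤ) : (up p h).disc = p ^ 2 * (down p h).disc := by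
  simp only [up, down, disc]; ring

theorem Irr.down {p : ℤ} (hp : p ≠ 0) {h : BCF ℤ} (hh : (up p h).Irr) : (down p h).Irr := by
  intro x y hxy
  have e : (up p h).ev x (p * y) = p ^ 2 * (BCF.down p h).ev x y := by
    simp only [up, BCF.down, ev]; ring
  obtain ⟨h1, h2⟩ := hh x (p * y) (by rw [e, hxy, mul_zero])
  exact ⟨h1, (mul_eq_zero.1 h2).resolve_left hp⟩

theorem up_eq_sub {p : ℤ} (hp : p ≠ 0) {h h' : BCF ℤ} {x k z w : ℤ}
    (e : down p h' = (down p h).sub x (p * k) z w) : up p h' = (up p h).sub x k (p * z) w := by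
  simp only [down, sub, ev, Prod.ext_iff] at e
  obtain ⟨⟨e1, e2⟩, e3, e4⟩ := e
  simp only [up, sub, ev, Prod.ext_iff]
  refine ⟨⟨?_, ?_⟩, ?_, ?_⟩
  · rw [e1]; ring
  · rw [e2]; ring
  · rw [e3]; ring
  · refine mul_left_cancel₀ hp ?_
    rw [e4]; ring

theorem dvd_hess_sub {p : ℤ} {f : BCF ℤ} (h : p ∣ f.hA ∧ p ∣ f.hB ∧ p ∣ f.hC) (x y z w : ℤ) :
    p ∣ (f.sub x y z w).hA ∧ p ∣ (f.sub x y z w).hB ∧ p ∣ (f.sub x y z w).hC := by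
  obtain ⟨⟨a, ha⟩, ⟨b, hb⟩, c, hc⟩ := h
  rw [hA_sub, hB_sub, hC_sub]
  simp only [hess]
  rw [ha, hb, hc]
  exact ⟨⟨(x * w - y * z) ^ 2 * (a * x ^ 2 + b * x * z + c * z ^ 2), by ring⟩,
    ⟨(x * w - y * z) ^ 2 * (2 * a * x * y + b * (x * w + y * z) + 2 * c * z * w), by ring⟩,
    ⟨(x * w - y * z) ^ 2 * (a * y ^ 2 + b * y * w + c * w ^ 2), by ring⟩⟩

theorem Weak.equivalent {p : ℕ} {f g : BCF ℤ} (hf : Weak p f) (h : Equivalent f g) : Weak p g := by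
  refine ⟨h.disc_eq ▸ hf.1, fun hg => hf.2 ?_⟩
  obtain ⟨x, y, z, w, -, rfl⟩ := h.symm
  exact dvd_hess_sub hg ..

theorem Weak.exists_dvd_hA {p : ℕ} (hp : p.Prime) (hp2 : p ≠ 2) {f : BCF ℤ} (hf : Weak p f) :
    ∃ g, Equivalent f g ∧ (p : ℤ) ∣ g.hA := by
  have hp' : Prime (p : ℤ) := Nat.prime_iff_prime_int.1 hp
  by_cases hA : (p : ℤ) ∣ f.hA
  · exact ⟨f, .refl f, hA⟩
  have h2 : ¬(p : ℤ) ∣ 2 := fun h => hp2 ((Nat.prime_dvd_prime_iff_eq hp Nat.prime_two).1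
    (by exact_mod_cast h))
  have hco : IsCoprime (p : ℤ) (2 * f.hA) := (hp'.coprime_iff_not_dvd).2 fun h =>
    (hp'.dvd_mul.1 h).elim h2 hA
  obtain ⟨u, v, huv⟩ := hco
  refine ⟨f.sub (-v * f.hB) (-1) 1 0, ⟨_, _, _, _, by ring, rfl⟩, ?_⟩
  rw [hA_sub]
  have h4 : ¬(p : ℤ) ∣ 4 * f.hA := fun h => by
    rw [show (4 : ℤ) = 2 * 2 by norm_num, mul_assoc] at h
    exact (hp'.dvd_mul.1 h).elim h2 fun h => (hp'.dvd_mul.1 h).elim h2 hA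
  refine (hp'.dvd_or_dvd (a := 4 * f.hA) ?_).resolve_left h4
  have hd : (p : ℤ) ∣ f.disc := (dvd_pow_self _ two_ne_zero).trans hf.1
  obtain ⟨k, hk⟩ := hd
  rw [disc_eq] at hk
  refine ⟨p * (u * f.hB) ^ 2 - k, ?_⟩
  simp only [hess]
  linear_combination (-hk) + (-f.hB ^ 2 * (1 - 2 * f.hA * v + p * u)) * huv

theorem Weak.exists_up {p : ℕ} (hp : p.Prime) (hp2 : p ≠ 2) {f : BCF ℤ} (hf : Weak p f) :
    ∃ h, Equivalent f (up p h) ∧ ¬(p : ℤ) ∣ h.2.1 := by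
  have hp' : Prime (p : ℤ) := Nat.prime_iff_prime_int.1 hp
  have h2 : ¬(p : ℤ) ∣ 2 := fun h => hp2 ((Nat.prime_dvd_prime_iff_eq hp Nat.prime_two).1
    (by exact_mod_cast h))
  obtain ⟨g, hfg, hA⟩ := hf.exists_dvd_hA hp hp2
  obtain ⟨hD, hH⟩ := hf.equivalent hfg
  have hB : (p : ℤ) ∣ g.hB := by
    refine hp'.dvd_of_dvd_pow (n := 2) ?_
    have e : g.hB ^ 2 = g.disc + g.hA * (4 * g.hC) := by rw [disc_eq]; ring
    rw [e]
    exact dvd_add ((dvd_pow_self _ two_ne_zero).trans hD) (hA.mul_right _)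
  have hC : ¬(p : ℤ) ∣ g.hC := fun h => hH ⟨hA, hB, h⟩
  have ha : (p : ℤ) ∣ g.1.1 := by
    refine (hp'.dvd_or_dvd (b := g.hC) ?_).resolve_right hC
    have e : g.1.1 * g.hC = g.hA * (-g.2.1) + g.hB * g.1.2 := by
      simp only [BCF.hA, BCF.hB, BCF.hC]; ring
    rw [e]
    exact dvd_add (hA.mul_right _) (hB.mul_right _)
  have hb : (p : ℤ) ∣ g.1.2 := by
    refine hp'.dvd_of_dvd_pow (n := 2) ?_
    have e : g.1.2 ^ 2 = g.hA + g.1.1 * g.2.1 := by simp only [BCF.hA]; ring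
    rw [e]
    exact dvd_add hA (ha.mul_right _)
  have hc : ¬(p : ℤ) ∣ g.2.1 := fun h => hC <| by
    have e : g.hC = g.2.1 * g.2.1 - g.1.2 * g.2.2 := by simp only [BCF.hC]; ring
    rw [e]
    exact dvd_sub (h.mul_right _) (hb.mul_right _)
  have hA2 : (p : ℤ) ^ 2 ∣ g.hA := by
    have h4 : (p : ℤ) ^ 2 ∣ g.hA * (4 * g.hC) := by
      have e : g.hA * (4 * g.hC) = g.hB ^ 2 - g.disc := by rw [disc_eq]; ring
      rw [e]
      exact dvd_sub (pow_dvd_pow_of_dvd hB 2) hD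
    refine IsCoprime.dvd_of_dvd_mul_right (IsCoprime.pow_left ?_) h4
    refine (hp'.coprime_iff_not_dvd).2 fun h => ?_
    rw [show (4 : ℤ) = 2 * 2 by norm_num, mul_assoc] at h
    exact (hp'.dvd_mul.1 h).elim h2 fun h => (hp'.dvd_mul.1 h).elim h2 hC
  have ha2 : (p : ℤ) ^ 2 ∣ g.1.1 := by
    have h4 : (p : ℤ) ^ 2 ∣ g.1.1 * g.2.1 := by
      have e : g.1.1 * g.2.1 = g.1.2 ^ 2 - g.hA := by simp only [BCF.hA]; ring
      rw [e]
      exact dvd_sub (pow_dvd_pow_of_dvd hb 2) hA2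
    exact IsCoprime.dvd_of_dvd_mul_right
      (IsCoprime.pow_left ((hp'.coprime_iff_not_dvd).2 hc)) h4
  obtain ⟨a', ha'⟩ := ha2
  obtain ⟨b', hb'⟩ := hb
  refine ⟨((a', b'), (g.2.1, g.2.2)), ?_, hc⟩
  have : g = up p ((a', b'), (g.2.1, g.2.2)) := by
    simp only [up, ← ha', ← hb']
  rwa [← this]

/-- The zeros of a binary cubic form on the projective line. -/
noncomputable def projRoots (p : ℕ) [Fact p.Prime] (φ : BCF ℤ) : Finset (Option (ZMod p)) :=
  Finset.insertNone
    (Cubic.toPoly ⟨(φ.1.1 : ZMod p), 3 * φ.1.2, 3 * φ.2.1, φ.2.2⟩).roots.toFinset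

theorem card_projRoots_le (p : ℕ) [Fact p.Prime] (φ : BCF ℤ) : (projRoots p φ).card ≤ 4 := by
  rw [projRoots, Finset.card_insertNone]
  have h1 := Multiset.toFinset_card_le
    (Cubic.toPoly ⟨(φ.1.1 : ZMod p), 3 * φ.1.2, 3 * φ.2.1, φ.2.2⟩).roots
  have h2 := Polynomial.card_roots'
    (Cubic.toPoly ⟨(φ.1.1 : ZMod p), 3 * φ.1.2, 3 * φ.2.1, φ.2.2⟩)
  have h3 : (Cubic.toPoly ⟨(φ.1.1 : ZMod p), 3 * φ.1.2, 3 * φ.2.1, φ.2.2⟩).natDegree ≤ 3 :=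
    Polynomial.natDegree_cubic_le
  omega

/-- The point `(q : t)` on the projective line. -/
noncomputable def projPt (p : ℕ) [Fact p.Prime] (q t : ℤ) : Option (ZMod p) :=
  if (t : ZMod p) = 0 then none else some ((q : ZMod p) / t)

theorem projPt_mem {p : ℕ} [Fact p.Prime] {φ : BCF ℤ} {q t : ℤ} (h : (p : ℤ) ∣ φ.ev q t)
    (hφ : ¬((p : ℤ) ∣ φ.1.1 ∧ (p : ℤ) ∣ 3 * φ.1.2 ∧ (p : ℤ) ∣ 3 * φ.2.1 ∧ (p : ℤ) ∣ φ.2.2)) :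
    projPt p q t ∈ projRoots p φ := by
  rw [projPt, projRoots]
  split_ifs with ht
  · exact Finset.none_mem_insertNone
  rw [Finset.some_mem_insertNone, Multiset.mem_toFinset, Polynomial.mem_roots']
  constructor
  · intro h0
    refine hφ ?_
    have := (Cubic.toPoly_eq_zero_iff _).1 h0
    simp only [Cubic.ext_iff] at this
    simp only [← ZMod.intCast_zmod_eq_zero_iff_dvd]
    push_cast
    exact this
  · rw [← ZMod.intCast_zmod_eq_zero_iff_dvd] at h
    simp only [ev] at h
    push_cast at h
    simp only [Polynomial.IsRoot, Cubic.toPoly, Polynomial.eval_add, Polynomial.eval_mul,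
      Polynomial.eval_C, Polynomial.eval_pow, Polynomial.eval_X]
    field_simp
    linear_combination h

theorem dvd_of_projPt_eq {p : ℕ} [Fact p.Prime] {q t q' t' : ℤ}
    (h : projPt p q t = projPt p q' t') : (p : ℤ) ∣ t * q' - q * t' := by
  rw [← ZMod.intCast_zmod_eq_zero_iff_dvd]
  push_cast
  simp only [projPt] at h
  split_ifs at h with h1 h2 h2
  · rw [h1, h2]; ring
  · rw [Option.some_inj, div_eq_div_iff h1 h2] at h
    linear_combination -h

theorem card_fiber_le {p : ℕ} (hp : p.Prime) (hp3 : p ≠ 3) (S : Finset (BCF ℤ)) (φ : BCF ℤ)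
    (hS : ∀ h ∈ S, Equivalent φ (down p h) ∧ ¬(p : ℤ) ∣ h.2.1)
    (hinj : ∀ h ∈ S, ∀ h' ∈ S, Equivalent (up p h) (up p h') → h = h') : S.card ≤ 4 := by
  classical
  have : Fact p.Prime := ⟨hp⟩
  have hp' : Prime (p : ℤ) := Nat.prime_iff_prime_int.1 hp
  have hp0 : (p : ℤ) ≠ 0 := hp'.ne_zero
  have h3 : ¬(p : ℤ) ∣ 3 := fun h => hp3 ((Nat.prime_dvd_prime_iff_eq hp Nat.prime_three).1
    (by exact_mod_cast h))
  have hc : ∀ h : BCF ℤ, ∃ x q z t : ℤ, h ∈ S → x * t - q * z = 1 ∧ down p h = φ.sub x q z t := by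
    intro h
    by_cases hh : h ∈ S
    · obtain ⟨x, q, z, t, h1, h2⟩ := (hS h hh).1
      exact ⟨x, q, z, t, fun _ => ⟨h1, h2⟩⟩
    · exact ⟨0, 0, 0, 0, fun h' => absurd h' hh⟩
  choose x q z t hxt using hc
  refine (Finset.card_le_card_of_injOn (fun h => projPt p (q h) (t h)) ?_ ?_).trans
    (card_projRoots_le p φ)
  · intro h hh
    obtain ⟨h1, h2⟩ := hxt h hh
    have h2' := h2
    simp only [down, sub, Prod.ext_iff] at h2
    refine projPt_mem ⟨_, h2.2.2.symm⟩ fun hφ => ?_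
    obtain ⟨⟨a, ha⟩, ⟨b, hb⟩, ⟨c, hc⟩, ⟨d, hd⟩⟩ := hφ
    refine (hS h hh).2 ((hp'.dvd_or_dvd (a := 3) ?_).resolve_left h3)
    refine ⟨3 * a * x h * q h ^ 2 + b * (2 * x h * q h * t h + q h ^ 2 * z h) +
      c * (x h * t h ^ 2 + 2 * q h * z h * t h) + 3 * d * z h * t h ^ 2, ?_⟩
    rw [h2.2.1]
    linear_combination 3 * x h * q h ^ 2 * ha + (2 * x h * q h * t h + q h ^ 2 * z h) * hb +
      (x h * t h ^ 2 + 2 * q h * z h * t h) * hc + 3 * z h * t h ^ 2 * hd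
  · intro h hh h' hh' e
    obtain ⟨k, hk⟩ := dvd_of_projPt_eq e
    obtain ⟨h1, h2⟩ := hxt h hh
    obtain ⟨h1', h2'⟩ := hxt h' hh'
    refine hinj h hh h' hh' ?_
    have e2 : down p h' = (down p h).sub (t h * x h' - q h * z h') (p * k)
        (x h * z h' - z h * x h') (x h * t h' - z h * q h') := by
      rw [h2, sub_sub, h2', ← hk]
      congr 1
      · linear_combination -x h' * h1
      · linear_combination -q h' * h1
      · linear_combination -z h' * h1
      · linear_combination -t h' * h1
    refine ⟨_, _, _, _, ?_, up_eq_sub hp0 e2⟩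
    linear_combination (x h' * t h' - q h' * z h') * h1 + h1' + (x h * z h' - z h * x h') * hk

theorem card_weak_le {σ : ℝ} (hσ : Adm σ) {p : ℕ} (hp : p.Prime) (hp3 : 3 < p) {r : ℝ}
    (hr : 0 < r) (C : Finset (Quotient equivSetoid))
    (hC : ∀ x ∈ C, ∃ f ∈ irrForms σ (r ^ 4), Weak p f ∧ cls f = x) :
    (C.card : ℝ) ≤ 8 * 6720 ^ 4 * (r ^ 4 / p ^ 2) := by
  classical
  have hp0 : (p : ℤ) ≠ 0 := by exact_mod_cast hp.ne_zero
  have hpr : (0 : ℝ) < p := by exact_mod_cast hp.pos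
  have hh : ∀ x : Quotient equivSetoid, ∃ h : BCF ℤ, x ∈ C →
      cls (up p h) = x ∧ ¬(p : ℤ) ∣ h.2.1 ∧ down p h ∈ irrForms σ ((r / √p) ^ 4) := by
    intro x
    by_cases hx : x ∈ C
    · obtain ⟨f, hf, hw, hfx⟩ := hC x hx
      obtain ⟨h, h1, h2⟩ := hw.exists_up hp (by omega)
      refine ⟨h, fun _ => ⟨by rw [← hfx, cls_eq_iff]; exact h1.symm, h2, ?_⟩⟩
      obtain ⟨f1, f2, f3⟩ := hf
      have e : (f.disc : ℝ) = p ^ 2 * ((down p h).disc : ℝ) := by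
        rw [← h1.disc_eq, disc_up]; push_cast; ring
      have hp2 : (0 : ℝ) < p ^ 2 := by positivity
      refine ⟨(f1.equivalent h1).down hp0, ?_, ?_⟩
      · rw [e] at f2
        have : (p : ℝ) ^ 2 * (σ * ((down p h).disc : ℝ)) > 0 := by linarith
        exact (pos_iff_pos_of_mul_pos this).1 hp2
      · rw [e, abs_mul, abs_of_pos hp2] at f3
        rw [div_pow, show √(p : ℝ) ^ 4 = (√p ^ 2) ^ 2 by ring, Real.sq_sqrt hpr.le,
          lt_div_iff₀ hp2]
        linarith
    · exact ⟨0, fun h => absurd h hx⟩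
  choose h hh using hh
  have h1 : C.card ≤ 4 * (C.image fun x => cls (down p (h x))).card := by
    refine Finset.card_le_mul_card_image C 4 fun y hy => ?_
    obtain ⟨φ, rfl⟩ := Quotient.exists_rep y
    have hinj : Set.InjOn h (C.filter fun x => cls (down p (h x)) = Quotient.mk _ φ) := by
      intro x hx x' hx' e
      simp only [Finset.coe_filter, Set.mem_ofPred_eq] at hx hx'
      rw [← (hh x hx.1).1, ← (hh x' hx'.1).1, e]
    rw [← Finset.card_image_of_injOn hinj]
    refine card_fiber_le hp (by omega) _ φ ?_ ?_
    · intro g hg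
      obtain ⟨x, hx, rfl⟩ := Finset.mem_image.1 hg
      rw [Finset.mem_filter] at hx
      exact ⟨(cls_eq_iff.1 hx.2).symm, (hh x hx.1).2.1⟩
    · intro g hg g' hg' e
      obtain ⟨x, hx, rfl⟩ := Finset.mem_image.1 hg
      obtain ⟨x', hx', rfl⟩ := Finset.mem_image.1 hg'
      rw [Finset.mem_filter] at hx hx'
      rw [← cls_eq_iff, (hh x hx.1).1, (hh x' hx'.1).1] at e
      rw [e]
  have h2 := card_classes_le hσ (r := r / √p) (by positivity)
    (C.image fun x => cls (down p (h x))) (by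
      intro y hy
      obtain ⟨x, hx, rfl⟩ := Finset.mem_image.1 hy
      exact ⟨_, (hh x hx).2.2, rfl⟩)
  have e : (r / √p) ^ 4 = r ^ 4 / p ^ 2 := by
    rw [div_pow, show √(p : ℝ) ^ 4 = (√p ^ 2) ^ 2 by ring, Real.sq_sqrt hpr.le]
  rw [e] at h2
  have h3 : (C.card : ℝ) ≤ 4 * ((C.image fun x => cls (down p (h x))).card : ℝ) := by
    exact_mod_cast h1
  linarith

end BCF

/-! ### The sieve to fundamental discriminants -/

/-- The local conditions at the primes up to `M` for being a fundamental discriminant. -/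
def LocFund (M : ℕ) (D : ℤ) : Prop :=
  (D % 16 = 1 ∨ D % 16 = 5 ∨ D % 16 = 9 ∨ D % 16 = 13 ∨ D % 16 = 8 ∨ D % 16 = 12) ∧
    ∀ p : ℕ, p.Prime → p ≠ 2 → p ≤ M → ¬(p : ℤ) ^ 2 ∣ D

theorem squarefree_of_prime_sq {d : ℤ} (h : ∀ p : ℕ, p.Prime → ¬(p : ℤ) ^ 2 ∣ d) :
    Squarefree d := by
  rw [← Int.squarefree_natAbs, Nat.squarefree_iff_prime_squarefree]
  intro p hp hd
  refine h p hp ?_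
  rw [← Int.natAbs_dvd_natAbs, Int.natAbs_pow, Int.natAbs_natCast, sq]
  exact hd

theorem Squarefree.not_prime_sq_dvd {d : ℤ} (h : Squarefree d) {p : ℕ} (hp : p.Prime) :
    ¬(p : ℤ) ^ 2 ∣ d := fun hd => by
  have := h (p : ℤ) (by rwa [← sq])
  exact (Nat.prime_iff_prime_int.1 hp).not_isUnit this

theorem sq_dvd_of_sq_dvd_four_mul {p : ℕ} (hp : p.Prime) (hp2 : p ≠ 2) {m : ℤ}
    (h : (p : ℤ) ^ 2 ∣ 4 * m) : (p : ℤ) ^ 2 ∣ m := by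
  have hp' : Prime (p : ℤ) := Nat.prime_iff_prime_int.1 hp
  refine IsCoprime.dvd_of_dvd_mul_left ?_ h
  have h2 : IsCoprime (p : ℤ) 2 := hp'.coprime_iff_not_dvd.2 fun h =>
    hp2 ((Nat.prime_dvd_prime_iff_eq hp Nat.prime_two).1 (by exact_mod_cast h))
  rw [show (4 : ℤ) = 2 ^ 2 by norm_num]
  exact h2.pow

theorem isFundamentalDiscriminant_iff {D : ℤ} :
    IsFundamentalDiscriminant D ↔ D ≠ 1 ∧ ∀ M, LocFund M D := by
  refine and_congr_right fun _ => ⟨?_, fun h => ?_⟩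
  · rintro (⟨h1, h2⟩ | ⟨m, rfl, h1, h2⟩) M
    · exact ⟨by omega, fun p hp _ _ => h2.not_prime_sq_dvd hp⟩
    · exact ⟨by omega, fun p hp hp2 _ h => h2.not_prime_sq_dvd hp (sq_dvd_of_sq_dvd_four_mul hp hp2 h)⟩
  · have hodd : ∀ p : ℕ, p.Prime → p ≠ 2 → ¬(p : ℤ) ^ 2 ∣ D :=
      fun p hp hp2 => (h p).2 p hp hp2 le_rfl
    have h16 := (h 0).1
    by_cases h4 : D % 4 = 1
    · refine Or.inl ⟨h4, squarefree_of_prime_sq fun p hp => ?_⟩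
      by_cases hp2 : p = 2
      · subst hp2; norm_num; omega
      · exact hodd p hp hp2
    · refine Or.inr ⟨D / 4, by omega, by omega, squarefree_of_prime_sq fun p hp => ?_⟩
      by_cases hp2 : p = 2
      · subst hp2; norm_num; omega
      · refine fun h => hodd p hp hp2 (h.trans ⟨4, by omega⟩)

theorem exists_prime_of_locFund {M : ℕ} {D : ℤ} (h : LocFund M D) (hD : D ≠ 1)
    (hf : ¬IsFundamentalDiscriminant D) : ∃ p : ℕ, p.Prime ∧ M < p ∧ (p : ℤ) ^ 2 ∣ D := by
  rw [isFundamentalDiscriminant_iff] at hf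
  push Not at hf
  obtain ⟨M', hM'⟩ := hf hD
  unfold LocFund at hM'
  push Not at hM'
  obtain ⟨p, hp, hp2, -, hd⟩ := hM' h.1
  exact ⟨p, hp, not_le.1 fun hle => h.2 p hp hp2 hle hd, hd⟩

namespace BCF

/-- Classes of irreducible forms of bounded fundamental discriminant of a given sign. -/
def fundCls (σ X : ℝ) : Set (Quotient equivSetoid) :=
  cls '' {f | f ∈ irrForms σ X ∧ IsFundamentalDiscriminant f.disc}

theorem fundCls_subset (σ X : ℝ) : fundCls σ X ⊆ cls '' irrForms σ X :=
  Set.image_mono fun _ h => h.1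

theorem eventually_ncard_fundCls_le {σ : ℝ} (hσ : Adm σ) {M m : ℕ} (hm : 0 < m)
    (S : Finset (BCF (ZMod m))) (hS : ∀ f : BCF ℤ, LocFund M f.disc → f.red m ∈ S) {c : ℝ}
    (hc : vol σ * (S.card / (m : ℝ) ^ 4) < c) :
    ∀ᶠ r : ℝ in atTop, 2 * ((fundCls σ (r ^ 4)).ncard : ℝ) ≤ c * r ^ 4 := by
  obtain ⟨r₀, hr₀, h⟩ := card_classes_congr_le hσ hm S hc
  filter_upwards [eventually_ge_atTop r₀] with r hr
  have hfin := (finite_classes hσ (r ^ 4)).subset (fundCls_subset σ (r ^ 4))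
  rw [Set.ncard_eq_toFinset_card _ hfin]
  refine h r hr _ fun x hx => ?_
  rw [Set.Finite.mem_toFinset] at hx
  refine ⟨fundCls_subset _ _ hx, fun f hf => hS f ?_⟩
  obtain ⟨g, hg, rfl⟩ := hx
  rw [← (cls_eq_iff.1 hf).disc_eq]
  exact (isFundamentalDiscriminant_iff.1 hg.2).2 M

theorem mem_box_of_norm_le {f : BCF ℤ} {x : ℝ} (h : ‖f.toReal‖ ≤ x) : f ∈ box ⌈x⌉₊ := by
  have h1 := (norm_fst_le f.toReal).trans h
  have h2 := (norm_snd_le f.toReal).trans h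
  have key : ∀ a : ℤ, ‖(a : ℝ)‖ ≤ x → |a| ≤ (⌈x⌉₊ : ℤ) := fun a ha => by
    have : ((|a| : ℤ) : ℝ) ≤ (⌈x⌉₊ : ℝ) := by
      rw [Int.cast_abs]; exact ha.trans (Nat.le_ceil x)
    exact_mod_cast this
  rw [mem_box]
  exact ⟨⟨key _ ((norm_fst_le f.toReal.1).trans h1), key _ ((norm_snd_le f.toReal.1).trans h1)⟩,
    key _ ((norm_fst_le f.toReal.2).trans h2), key _ ((norm_snd_le f.toReal.2).trans h2)⟩

theorem sum_inv_sq_le {M : ℕ} (hM : 0 < M) (P : ℕ) :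
    ∑ i ∈ Finset.Ioc M P, ((i : ℝ) ^ 2)⁻¹ ≤ (M : ℝ)⁻¹ := by
  rcases le_total M P with h | h
  · have := sum_Ioc_inv_sq_le_sub (α := ℝ) hM.ne' h
    have : (0 : ℝ) ≤ (P : ℝ)⁻¹ := by positivity
    linarith
  · rw [Finset.Ioc_eq_empty (by omega), Finset.sum_empty]; positivity


theorem card_irr_weak_le {σ : ℝ} (hσ : Adm σ) {M : ℕ} (hM : 3 ≤ M) {r : ℝ} (hr : 0 < r)
    (T : Finset (BCF ℤ)) (hT : ∀ f ∈ T, InFd σ f ∧ f ∈ irrForms σ (r ^ 4) ∧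
      ∃ p : ℕ, p.Prime ∧ M < p ∧ Weak p f) :
    (T.card : ℝ) ≤ 16 * 6720 ^ 4 * r ^ 4 / M := by
  classical
  set P := ⌈r ^ 4⌉₊
  have hp : ∀ p ∈ Finset.Ioc M P,
      (((T.filter fun f => p.Prime ∧ Weak p f).card : ℕ) : ℝ) ≤
        16 * 6720 ^ 4 * r ^ 4 * ((p : ℝ) ^ 2)⁻¹ := by
    intro p hp
    rw [Finset.mem_Ioc] at hp
    by_cases hpp : p.Prime
    · have h1 := card_le_two_mul_card_image hσ (T.filter fun f => p.Prime ∧ Weak p f)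
        fun f hf => (hT f (Finset.mem_filter.1 hf).1).1
      have h2 := card_weak_le hσ hpp (by omega) hr
        ((T.filter fun f => p.Prime ∧ Weak p f).image cls) fun x hx => by
          obtain ⟨f, hf, rfl⟩ := Finset.mem_image.1 hx
          rw [Finset.mem_filter] at hf
          exact ⟨f, (hT f hf.1).2.1, hf.2.2, rfl⟩
      have h1' : ((T.filter fun f => p.Prime ∧ Weak p f).card : ℝ) ≤
          2 * (((T.filter fun f => p.Prime ∧ Weak p f).image cls).card : ℝ) := by exact_mod_cast h1
      rw [div_eq_mul_inv] at h2
      linarith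
    · rw [Finset.filter_false_of_mem fun f _ h => hpp h.1]
      rw [Finset.card_empty, Nat.cast_zero]
      positivity
  have hsub : T ⊆ (Finset.Ioc M P).biUnion fun p => T.filter fun f => p.Prime ∧ Weak p f := by
    intro f hf
    obtain ⟨-, ⟨-, h1, h2⟩, p, hpp, hMp, hw⟩ := hT f hf
    refine Finset.mem_biUnion.2 ⟨p, Finset.mem_Ioc.2 ⟨hMp, ?_⟩, Finset.mem_filter.2 ⟨hf, hpp, hw⟩⟩
    have hD : f.disc ≠ 0 := by rintro h; simp [h] at h1
    have h3 : ((p : ℤ) ^ 2) ≤ |f.disc| :=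
      Int.le_of_dvd (abs_pos.2 hD) ((dvd_abs _ _).2 hw.1)
    have h4 : ((p : ℝ) ^ 2) ≤ |(f.disc : ℝ)| := by exact_mod_cast h3
    have h5 : (1 : ℝ) ≤ p := by exact_mod_cast hpp.one_lt.le
    have h6 : (p : ℝ) ≤ P := by
      have := Nat.le_ceil (r ^ 4)
      nlinarith
    exact_mod_cast h6
  calc (T.card : ℝ) ≤ ∑ p ∈ Finset.Ioc M P, ((T.filter fun f => p.Prime ∧ Weak p f).card : ℝ) := by
        exact_mod_cast (Finset.card_le_card hsub).trans Finset.card_biUnion_le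
    _ ≤ ∑ p ∈ Finset.Ioc M P, 16 * 6720 ^ 4 * r ^ 4 * ((p : ℝ) ^ 2)⁻¹ := Finset.sum_le_sum hp
    _ = 16 * 6720 ^ 4 * r ^ 4 * ∑ p ∈ Finset.Ioc M P, ((p : ℝ) ^ 2)⁻¹ := by rw [Finset.mul_sum]
    _ ≤ 16 * 6720 ^ 4 * r ^ 4 * (M : ℝ)⁻¹ := by
        gcongr
        exact sum_inv_sq_le (by omega) P
    _ = _ := by rw [div_eq_mul_inv]

theorem card_disc_one_le {σ : ℝ} (hσ : Adm σ) (T : Finset (BCF ℤ))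
    (hT : ∀ f ∈ T, InFd σ f ∧ f.Irr ∧ 0 < σ * (f.disc : ℝ) ∧ f.disc = 1) :
    (T.card : ℝ) ≤ 4 * 6720 ^ 4 * 2 ^ 4 := by
  classical
  have h1 := card_le_two_mul_card_image hσ T fun f hf => (hT f hf).1
  have h2 := card_classes_le hσ two_pos (T.image cls) fun x hx => by
    obtain ⟨f, hf, rfl⟩ := Finset.mem_image.1 hx
    obtain ⟨-, h1, h2, h3⟩ := hT f hf
    exact ⟨f, ⟨h1, h2, by rw [h3]; norm_num⟩, rfl⟩
  have h1' : (T.card : ℝ) ≤ 2 * ((T.image cls).card : ℝ) := by exact_mod_cast h1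
  linarith

theorem eventually_le_ncard_fundCls {σ : ℝ} (hσ : Adm σ) {c : ℝ} (hc : c < vol σ) :
    ∃ K : ℝ, ∀ M m : ℕ, 3 ≤ M → 0 < m → ∀ S : Finset (BCF (ZMod m)),
      (∀ f : BCF ℤ, f.red m ∈ S → LocFund M f.disc) → ∀ ε : ℝ, 0 < ε →
      ∀ᶠ r : ℝ in atTop, (c * (S.card / (m : ℝ) ^ 4) - K / M - ε) * r ^ 4 ≤
        2 * ((fundCls σ (r ^ 4)).ncard : ℝ) := by
  classical
  obtain ⟨R, hR, hT⟩ := exists_many_forms hσ hc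
  refine ⟨336 * (2 * R) ^ 4 + 16 * 6720 ^ 4, fun M m hM hm S hS ε hε => ?_⟩
  obtain ⟨r₀, hr₀, hT⟩ := hT hm S
  have hM0 : (0 : ℝ) < M := by exact_mod_cast (by omega : 0 < M)
  have hN : Tendsto (fun r : ℝ => ⌈R * r⌉₊) atTop atTop :=
    tendsto_nat_ceil_atTop.comp (tendsto_id.const_mul_atTop hR)
  have hsmall : Tendsto (fun r : ℝ => 54 * (2 * R) ^ 3 / r + 4 * 6720 ^ 4 * 2 ^ 4 / r ^ 4) atTop
      (nhds (0 + 0)) :=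
    (tendsto_const_nhds.div_atTop tendsto_id).add
      (tendsto_const_nhds.div_atTop (tendsto_pow_atTop (by norm_num)))
  rw [add_zero] at hsmall
  filter_upwards [eventually_ge_atTop r₀, eventually_ge_atTop (1 / R),
    hN.eventually (eventually_card_not_irr_le (ε := ε / 2 / (2 * R) ^ 4) (by positivity)),
    hsmall.eventually_le_const (half_pos hε)] with r hr hr1 hred hsm
  have hr0 : 0 < r := hr₀.trans_le hr
  set N := ⌈R * r⌉₊ with hNdef
  have hRr : 1 ≤ R * r := by rwa [div_le_iff₀ hR, mul_comm] at hr1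
  have hN0 : 0 < N := Nat.ceil_pos.2 (by linarith)
  have hN2 : (N : ℝ) ≤ 2 * R * r := by
    have := Nat.ceil_lt_add_one (by linarith : 0 ≤ R * r)
    linarith
  obtain ⟨T, hT1, hT2⟩ := hT r hr
  have hbox : T ⊆ box N := fun f hf => mem_box_of_norm_le (hT1 f hf).2.2.2.2
  set T₀ := T.filter fun f => f.Irr ∧ IsFundamentalDiscriminant f.disc with hT₀
  set T₁ := T.filter fun f => ¬f.Irr with hT₁
  set T₂ := T.filter fun f => ∃ p : ℕ, p.Prime ∧ M < p ∧ (p : ℤ) ∣ f.hA ∧ (p : ℤ) ∣ f.hB ∧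
    (p : ℤ) ∣ f.hC with hT₂
  set T₃ := T.filter fun f => f.Irr ∧ ∃ p : ℕ, p.Prime ∧ M < p ∧ Weak p f with hT₃
  set T₄ := T.filter fun f => f.Irr ∧ f.disc = 1 with hT₄
  have hcover : T ⊆ T₀ ∪ T₁ ∪ T₂ ∪ T₃ ∪ T₄ := by
    intro f hf
    simp only [hT₀, hT₁, hT₂, hT₃, hT₄, Finset.mem_union, Finset.mem_filter, hf, true_and]
    by_cases h1 : f.Irr
    · by_cases h2 : f.disc = 1
      · exact Or.inr ⟨h1, h2⟩
      by_cases h3 : IsFundamentalDiscriminant f.disc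
      · exact Or.inl (Or.inl (Or.inl (Or.inl ⟨h1, h3⟩)))
      obtain ⟨p, hp, hMp, hpd⟩ :=
        exists_prime_of_locFund (hS f (hT1 f hf).2.2.2.1) h2 h3
      by_cases h4 : (p : ℤ) ∣ f.hA ∧ (p : ℤ) ∣ f.hB ∧ (p : ℤ) ∣ f.hC
      · exact Or.inl (Or.inl (Or.inr ⟨p, hp, hMp, h4⟩))
      · exact Or.inl (Or.inr ⟨h1, p, hp, hMp, hpd, h4⟩)
    · exact Or.inl (Or.inl (Or.inl (Or.inr h1)))
  have hcard : (T.card : ℝ) ≤ T₀.card + T₁.card + T₂.card + T₃.card + T₄.card := by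
    have h1 := Finset.card_le_card hcover
    have h2 := Finset.card_union_le (T₀ ∪ T₁ ∪ T₂ ∪ T₃) T₄
    have h3 := Finset.card_union_le (T₀ ∪ T₁ ∪ T₂) T₃
    have h4 := Finset.card_union_le (T₀ ∪ T₁) T₂
    have h5 := Finset.card_union_le T₀ T₁
    have : T.card ≤ T₀.card + T₁.card + T₂.card + T₃.card + T₄.card := by omega
    exact_mod_cast this
  have c0 : (T₀.card : ℝ) ≤ 2 * ((fundCls σ (r ^ 4)).ncard : ℝ) := by
    have h1 := card_le_two_mul_card_image hσ T₀ fun f hf => (hT1 f (Finset.mem_filter.1 hf).1).1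
    have hfin := (finite_classes hσ (r ^ 4)).subset (fundCls_subset σ (r ^ 4))
    have h2 : (T₀.image cls).card ≤ (fundCls σ (r ^ 4)).ncard := by
      rw [← Set.ncard_coe_finset]
      refine Set.ncard_le_ncard (fun x hx => ?_) hfin
      obtain ⟨f, hf, rfl⟩ := Finset.mem_image.1 (Finset.mem_coe.1 hx)
      rw [Finset.mem_filter] at hf
      exact ⟨f, ⟨⟨hf.2.1, (hT1 f hf.1).2.1, (hT1 f hf.1).2.2.1⟩, hf.2.2⟩, rfl⟩
    exact_mod_cast h1.trans (by omega)
  have c1 : (T₁.card : ℝ) ≤ ε / 2 * r ^ 4 := by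
    have := hred T₁ ((Finset.filter_subset _ _).trans hbox) fun f hf => by
      rw [Finset.mem_filter] at hf
      exact ⟨(hT1 f hf.1).1.1, hf.2⟩
    refine this.trans ?_
    calc ε / 2 / (2 * R) ^ 4 * (N : ℝ) ^ 4 ≤ ε / 2 / (2 * R) ^ 4 * (2 * R * r) ^ 4 := by gcongr
      _ = ε / 2 * r ^ 4 := by field_simp
  have c2 : (T₂.card : ℝ) ≤ 336 * (2 * R) ^ 4 / M * r ^ 4 + 54 * (2 * R) ^ 3 / r * r ^ 4 := by
    have := card_hess_le hN0 (by omega : 0 < M) T₂ ((Finset.filter_subset _ _).trans hbox)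
      fun f hf => by
        rw [Finset.mem_filter] at hf
        exact ⟨(hT1 f hf.1).1.1, hf.2⟩
    refine this.trans ?_
    calc 336 * (N : ℝ) ^ 4 / M + 54 * (N : ℝ) ^ 3
        ≤ 336 * (2 * R * r) ^ 4 / M + 54 * (2 * R * r) ^ 3 := by gcongr
      _ = _ := by field_simp
  have c3 : (T₃.card : ℝ) ≤ 16 * 6720 ^ 4 * r ^ 4 / M :=
    card_irr_weak_le hσ hM hr0 T₃ fun f hf => by
      rw [Finset.mem_filter] at hf
      obtain ⟨h1, h2, h3, -⟩ := hT1 f hf.1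
      exact ⟨h1, ⟨hf.2.1, h2, h3⟩, hf.2.2⟩
  have c4 : (T₄.card : ℝ) ≤ 4 * 6720 ^ 4 * 2 ^ 4 / r ^ 4 * r ^ 4 := by
    rw [div_mul_cancel₀ _ (by positivity)]
    exact card_disc_one_le hσ T₄ fun f hf => by
      rw [Finset.mem_filter] at hf
      obtain ⟨h1, h2, h3, -⟩ := hT1 f hf.1
      exact ⟨h1, hf.2.1, h2, hf.2.2⟩
  have hr4 : 0 < r ^ 4 := by positivity
  have hsm' := mul_le_mul_of_nonneg_right hsm hr4.le
  have e3 : 16 * 6720 ^ 4 * r ^ 4 / (M : ℝ) = 16 * 6720 ^ 4 / M * r ^ 4 := by ring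
  rw [e3] at c3
  rw [sub_mul, sub_mul, add_div]
  linarith

theorem tendsto_ncard_fundCls {σ : ℝ} (hσ : Adm σ) {m : ℕ → ℕ} (hm : ∀ M, 0 < m M)
    (S : ∀ M, Finset (BCF (ZMod (m M)))) (hS : ∀ M, ∀ f : BCF ℤ, f.red (m M) ∈ S M ↔ LocFund M f.disc)
    {δ : ℝ} (hδ : Tendsto (fun M => ((S M).card : ℝ) / (m M : ℝ) ^ 4) atTop (nhds δ)) :
    Tendsto (fun X : ℝ => ((fundCls σ X).ncard : ℝ) / X) atTop (nhds (vol σ * δ / 2)) := by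
  have hv : 0 < vol σ := by unfold vol; have := abs_pos.2 hσ.ne_zero; positivity
  have key : Tendsto (fun r : ℝ => ((fundCls σ (r ^ 4)).ncard : ℝ) / r ^ 4) atTop
      (nhds (vol σ * δ / 2)) := by
    rw [tendsto_order]
    constructor
    · intro a ha
      have h1 : ∃ c < vol σ, 2 * a < c * δ := by
        have hcont : Tendsto (fun c : ℝ => c * δ) (nhdsWithin (vol σ) (Set.Iio (vol σ)))
            (nhds (vol σ * δ)) :=
          ((continuous_id.mul continuous_const).tendsto _).mono_left nhdsWithin_le_nhds
        have h2 := hcont.eventually_const_lt (show 2 * a < vol σ * δ by linarith)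
        obtain ⟨c, hc1, hc2⟩ := (h2.and self_mem_nhdsWithin).exists
        exact ⟨c, hc2, hc1⟩
      obtain ⟨c, hc, hca⟩ := h1
      obtain ⟨K, hK⟩ := eventually_le_ncard_fundCls hσ hc
      have h3 : Tendsto (fun M : ℕ => c * (((S M).card : ℝ) / (m M : ℝ) ^ 4) - K / M) atTop
          (nhds (c * δ - 0)) :=
        (hδ.const_mul c).sub (tendsto_const_nhds.div_atTop tendsto_natCast_atTop_atTop)
      rw [sub_zero] at h3
      obtain ⟨M, hM1, hM2⟩ := ((h3.eventually_const_lt hca).and (eventually_ge_atTop 3)).exists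
      filter_upwards [hK M (m M) hM2 (hm M) (S M) (fun f => (hS M f).1) _
        (half_pos (sub_pos.2 hM1)), eventually_gt_atTop 0] with r hr hr0
      have hr4 : 0 < r ^ 4 := by positivity
      rw [lt_div_iff₀ hr4]
      nlinarith
    · intro a ha
      have h1 := (hδ.const_mul (vol σ)).eventually_lt_const (show vol σ * δ < 2 * a by linarith)
      obtain ⟨M, hM⟩ := h1.exists
      obtain ⟨c, hc1, hc2⟩ := exists_between hM
      filter_upwards [eventually_ncard_fundCls_le hσ (hm M) (S M) (fun f => (hS M f).2) hc1,
        eventually_gt_atTop 0] with r hr hr0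
      have hr4 : 0 < r ^ 4 := by positivity
      rw [div_lt_iff₀ hr4]
      nlinarith
  have hsqrt : Tendsto (fun X : ℝ => √(√X)) atTop atTop :=
    Real.tendsto_sqrt_atTop.comp Real.tendsto_sqrt_atTop
  refine (key.comp hsqrt).congr' ?_
  filter_upwards [eventually_ge_atTop 0] with X hX
  have : √(√X) ^ 4 = X := by
    rw [show √(√X) ^ 4 = (√(√X) ^ 2) ^ 2 by ring, Real.sq_sqrt (Real.sqrt_nonneg _),
      Real.sq_sqrt hX]
  simp only [Function.comp, this]

end BCF

/-! ### Counting forms of discriminant zero modulo the square of an odd prime -/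

namespace BCF

section LocalCount

variable {R : Type*} [CommRing R] [Fintype R] [DecidableEq R] {p : ℕ}

theorem card_sq_eq_four_cube (h2 : IsUnit (2 : R)) (h0 : ∀ x y : R, ¬IsUnit x → ¬IsUnit y → x * y = 0)
    (hR : Fintype.card R = p ^ 2) (hn : Fintype.card {x : R // ¬IsUnit x} = p) :
    Fintype.card {x : R × R // x.2 ^ 2 = 4 * x.1 ^ 3} + p = 2 * p ^ 2 := by
  classical
  have hu : Fintype.card {x : R // IsUnit x} + p = p ^ 2 := by
    rw [← hR, ← hn, Fintype.card_subtype_compl]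
    exact Nat.add_sub_cancel' (Fintype.card_subtype_le _)
  have e1 : Fintype.card {x : {x : R × R // x.2 ^ 2 = 4 * x.1 ^ 3} // IsUnit x.1.1} =
      Fintype.card {x : R // IsUnit x} := by
    symm
    refine Fintype.card_of_bijective (f := fun t => ⟨⟨(t.1 ^ 2, 2 * t.1 ^ 3), by ring⟩, t.2.pow 2⟩)
      ⟨?_, ?_⟩
    · rintro ⟨t, ht⟩ ⟨s, hs⟩ e
      simp only [Subtype.mk.injEq, Prod.mk.injEq] at e
      have h3 := h2.mul_left_cancel e.2
      rw [Subtype.mk.injEq]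
      refine (ht.pow 2).mul_left_cancel ?_
      calc t ^ 2 * t = t ^ 3 := by ring
        _ = s ^ 3 := h3
        _ = s ^ 2 * s := by ring
        _ = t ^ 2 * s := by rw [e.1]
    · rintro ⟨⟨⟨A, g⟩, h⟩, hA⟩
      simp only at h hA
      have h2A := h2.mul hA
      obtain ⟨u, hu⟩ := h2A
      have hu' : (↑u⁻¹ : R) * (2 * A) = 1 := by rw [← hu, Units.inv_mul]
      have e1 : (↑u⁻¹ * g : R) ^ 2 = A := by
        linear_combination (↑u⁻¹ : R) ^ 2 * h + A * (↑u⁻¹ * (2 * A) + 1) * hu'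
      have e2 : 2 * (↑u⁻¹ * g : R) ^ 3 = g := by
        linear_combination 2 * (↑u⁻¹ * g : R) * e1 + g * hu'
      refine ⟨⟨↑u⁻¹ * g, ?_⟩, ?_⟩
      · exact isUnit_of_mul_isUnit_left (y := (↑u⁻¹ * g : R)) (by rw [← sq, e1]; exact hA)
      · simp only [Subtype.mk.injEq, Prod.mk.injEq]
        exact ⟨e1, e2⟩
  have e2 : Fintype.card {x : {x : R × R // x.2 ^ 2 = 4 * x.1 ^ 3} // ¬IsUnit x.1.1} =
      Fintype.card ({x : R // ¬IsUnit x} × {x : R // ¬IsUnit x}) := by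
    refine Fintype.card_congr ⟨fun x => (⟨x.1.1.1, x.2⟩, ⟨x.1.1.2, ?_⟩),
      fun x => ⟨⟨(x.1.1, x.2.1), ?_⟩, x.1.2⟩, fun x => rfl, fun x => rfl⟩
    · intro h
      refine x.2 ?_
      have h3 := x.1.2
      have h4 := h.pow 2
      rw [h3] at h4
      exact isUnit_of_dvd_unit ⟨4 * x.1.1.1 ^ 2, by ring⟩ h4
    · simp only
      rw [sq, h0 _ _ x.2.2 x.2.2, show 4 * x.1.1 ^ 3 = 4 * x.1.1 * (x.1.1 * x.1.1) by ring,
        h0 _ _ x.1.2 x.1.2, mul_zero]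
  have e3 := Fintype.card_subtype_compl (fun x : {x : R × R // x.2 ^ 2 = 4 * x.1 ^ 3} => IsUnit x.1.1)
  have e4 := Fintype.card_subtype_le (fun x : {x : R × R // x.2 ^ 2 = 4 * x.1 ^ 3} => IsUnit x.1.1)
  rw [e2, e1, Fintype.card_prod, hn] at e3
  rw [e1] at e4
  have : p * p = p ^ 2 := by ring
  omega

theorem card_fiber_of_isUnit {a : R} (ha : IsUnit a) (b : R) :
    Fintype.card {x : R × R // BCF.disc ((a, b), x) = 0} =
      Fintype.card {x : R × R // x.2 ^ 2 = 4 * x.1 ^ 3} := by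
  obtain ⟨u, rfl⟩ := ha
  have hu : (↑u⁻¹ : R) * u = 1 := u.inv_mul
  have hs : ∀ x : R × R, BCF.disc (((u : R), b), x) = 0 ↔
      (BCF.g₀ (((u : R), b), x)) ^ 2 = 4 * BCF.hA (((u : R), b), x) ^ 3 := fun x => by
    rw [← syzygy]
    simp only
    constructor
    · intro h; rw [h, zero_mul, sub_zero]
    · intro h
      have h1 : BCF.disc (((u : R), b), x) * (u : R) ^ 2 = 0 := by linear_combination h
      exact (u.isUnit.pow 2).mul_left_eq_zero.1 h1
  refine Fintype.card_congr ⟨fun x => ⟨(BCF.hA ((u, b), x.1), BCF.g₀ ((u, b), x.1)), (hs x.1).1 x.2⟩,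
    fun y => ⟨(↑u⁻¹ * (b ^ 2 - y.1.1),
      ↑u⁻¹ ^ 2 * (y.1.2 + 3 * u * b * (↑u⁻¹ * (b ^ 2 - y.1.1)) - 2 * b ^ 3)), (hs _).2 ?_⟩, ?_, ?_⟩
  · have e1 : BCF.hA ((↑u, b), (↑u⁻¹ * (b ^ 2 - y.1.1),
      ↑u⁻¹ ^ 2 * (y.1.2 + 3 * u * b * (↑u⁻¹ * (b ^ 2 - y.1.1)) - 2 * b ^ 3))) = y.1.1 := by
      simp only [BCF.hA]
      linear_combination -(b ^ 2 - y.1.1) * hu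
    have e2 : BCF.g₀ ((↑u, b), (↑u⁻¹ * (b ^ 2 - y.1.1),
      ↑u⁻¹ ^ 2 * (y.1.2 + 3 * u * b * (↑u⁻¹ * (b ^ 2 - y.1.1)) - 2 * b ^ 3))) = y.1.2 := by
      simp only [BCF.g₀]
      linear_combination (y.1.2 + 3 * u * b * (↑u⁻¹ * (b ^ 2 - y.1.1)) - 2 * b ^ 3) *
        (↑u⁻¹ * u + 1) * hu
    rw [e1, e2]; exact y.2
  · rintro ⟨⟨c, d⟩, h⟩
    simp only [BCF.hA, BCF.g₀, Subtype.mk.injEq, Prod.mk.injEq]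
    have e1 : (↑u⁻¹ : R) * (b ^ 2 - (b ^ 2 - u * c)) = c := by linear_combination c * hu
    refine ⟨e1, ?_⟩
    rw [e1]
    linear_combination d * (↑u⁻¹ * u + 1) * hu
  · rintro ⟨⟨c, d⟩, h⟩
    simp only [BCF.hA, BCF.g₀, Subtype.mk.injEq, Prod.mk.injEq]
    constructor
    · linear_combination -(b ^ 2 - c) * hu
    · linear_combination (d + 3 * u * b * (↑u⁻¹ * (b ^ 2 - c)) - 2 * b ^ 3) * (↑u⁻¹ * u + 1) * hu

theorem card_fiber_of_isUnit_snd (h2 : IsUnit (2 : R))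
    (h0 : ∀ x y : R, ¬IsUnit x → ¬IsUnit y → x * y = 0) {a b : R} (ha : ¬IsUnit a) (hb : IsUnit b) :
    Fintype.card {x : R × R // BCF.disc ((a, b), x) = 0} = Fintype.card R := by
  have haa : a * a = 0 := h0 a a ha ha
  have hk : ∀ c : R, IsUnit (4 * b ^ 3 - 6 * a * b * c) := fun c => by
    refine isUnit_of_mul_isUnit_left (y := 4 * b ^ 3 + 6 * a * b * c) ?_
    have e : (4 * b ^ 3 - 6 * a * b * c) * (4 * b ^ 3 + 6 * a * b * c) = (2 * 2 * b ^ 3) ^ 2 := by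
      linear_combination -36 * b ^ 2 * c ^ 2 * haa
    rw [e]
    exact ((h2.mul h2).mul (hb.pow 3)).pow 2
  choose k hk using hk
  have hki : ∀ c, (↑(k c)⁻¹ : R) * (4 * b ^ 3 - 6 * a * b * c) = 1 := fun c => by
    rw [← hk, Units.inv_mul]
  refine Fintype.card_congr ⟨fun x => x.1.1,
    fun c => ⟨(c, ↑(k c)⁻¹ * (3 * b ^ 2 * c ^ 2 - 4 * a * c ^ 3)), ?_⟩, ?_, fun c => rfl⟩
  · simp only [BCF.disc]
    linear_combination ((↑(k c)⁻¹ : R) * (3 * b ^ 2 * c ^ 2 - 4 * a * c ^ 3)) ^ 2 * haa +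
      (3 * b ^ 2 * c ^ 2 - 4 * a * c ^ 3) * hki c
  · rintro ⟨⟨c, d⟩, h⟩
    simp only [BCF.disc] at h
    refine Subtype.ext (Prod.ext rfl ?_)
    simp only
    linear_combination d * hki c + (↑(k c)⁻¹ : R) * d ^ 2 * haa - (↑(k c)⁻¹ : R) * h

theorem card_fiber_of_not_isUnit (h2 : IsUnit (2 : R))
    (h0 : ∀ x y : R, ¬IsUnit x → ¬IsUnit y → x * y = 0) {a b : R} (ha : ¬IsUnit a)
    (hb : ¬IsUnit b) (ha0 : a ≠ 0) :
    Fintype.card {x : R × R // BCF.disc ((a, b), x) = 0} =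
      Fintype.card {x : R // ¬IsUnit x} * Fintype.card R := by
  have haa : a * a = 0 := h0 a a ha ha
  have hbb : b * b = 0 := h0 b b hb hb
  have hab : a * b = 0 := h0 a b ha hb
  have hd : ∀ x : R × R, BCF.disc ((a, b), x) = 0 ↔ ¬IsUnit x.1 := fun x => by
    have e : BCF.disc ((a, b), x) = 2 * 2 * a * x.1 ^ 3 := by
      simp only [BCF.disc]
      linear_combination x.2 ^ 2 * haa - 6 * x.1 * x.2 * hab + (4 * b * x.2 - 3 * x.1 ^ 2) * hbb
    rw [e]
    constructor
    · intro h hx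
      refine ha0 ?_
      have h1 := (hx.pow 3).mul_left_eq_zero.1 h
      exact (h2.mul h2).mul_right_eq_zero.1 h1
    · intro hx
      rw [show 2 * 2 * a * x.1 ^ 3 = 4 * x.1 ^ 2 * (a * x.1) by ring, h0 a _ ha hx, mul_zero]
  rw [← Fintype.card_prod]
  exact Fintype.card_congr ⟨fun x => (⟨x.1.1, (hd _).1 x.2⟩, x.1.2),
    fun y => ⟨(y.1.1, y.2), (hd _).2 y.1.2⟩, fun _ => rfl, fun _ => rfl⟩

theorem card_fiber_zero (h0 : ∀ x y : R, ¬IsUnit x → ¬IsUnit y → x * y = 0) {b : R}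
    (hb : ¬IsUnit b) :
    Fintype.card {x : R × R // BCF.disc (((0 : R), b), x) = 0} = Fintype.card R ^ 2 := by
  have hbb : b * b = 0 := h0 b b hb hb
  rw [sq, ← Fintype.card_prod]
  refine Fintype.card_congr (Equiv.subtypeUnivEquiv fun x => ?_)
  simp only [BCF.disc]
  linear_combination (4 * b * x.2 - 3 * x.1 ^ 2) * hbb

theorem card_disc_eq_zero (h2 : IsUnit (2 : R))
    (h0 : ∀ x y : R, ¬IsUnit x → ¬IsUnit y → x * y = 0) (hp : 2 ≤ p)
    (hR : Fintype.card R = p ^ 2) (hn : Fintype.card {x : R // ¬IsUnit x} = p) :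
    Fintype.card {f : BCF R // f.disc = 0} + p ^ 4 = 2 * p ^ 6 := by
  classical
  have hu : Fintype.card {x : R // IsUnit x} + p = p ^ 2 := by
    rw [← hR, ← hn, Fintype.card_subtype_compl]
    exact Nat.add_sub_cancel' (Fintype.card_subtype_le _)
  have hnt : Nontrivial R := Fintype.one_lt_card_iff_nontrivial.1 (by rw [hR]; nlinarith)
  set n : R → R → ℕ := fun a b => Fintype.card {x : R × R // BCF.disc ((a, b), x) = 0} with hndef
  have hsum : Fintype.card {f : BCF R // f.disc = 0} = ∑ a, ∑ b, n a b := by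
    rw [← Fintype.sum_prod_type', ← Fintype.card_sigma]
    exact Fintype.card_congr ⟨fun f => ⟨f.1.1, f.1.2, f.2⟩, fun x => ⟨(x.1, x.2.1), x.2.2⟩,
      fun _ => rfl, fun _ => rfl⟩
  obtain ⟨q, hq⟩ : ∃ q, Fintype.card {x : R × R // x.2 ^ 2 = 4 * x.1 ^ 3} = q := ⟨_, rfl⟩
  have hq' := card_sq_eq_four_cube h2 h0 hR hn
  rw [hq] at hq'
  obtain ⟨w, hw⟩ : ∃ w, Fintype.card {x : R // IsUnit x} = w := ⟨_, rfl⟩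
  rw [hw] at hu
  have hrow : ∀ (P Q : ℕ), ∑ b : R, (if IsUnit b then P else Q) = w * P + p * Q := fun P Q => by
    rw [Finset.sum_ite, Finset.sum_const, Finset.sum_const, ← Fintype.card_subtype,
      ← Fintype.card_subtype, hw, hn, smul_eq_mul, smul_eq_mul]
  have hA : ∀ a, ∑ b, n a b = if IsUnit a then p ^ 2 * q else
      if a = 0 then w * p ^ 2 + p * p ^ 4 else w * p ^ 2 + p * p ^ 3 := by
    intro a
    split_ifs with ha ha0
    · rw [Finset.sum_congr rfl fun b _ => (card_fiber_of_isUnit ha b).trans hq, Finset.sum_const,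
        Finset.card_univ, hR, smul_eq_mul]
    · subst ha0
      rw [← hrow]
      refine Finset.sum_congr rfl fun b _ => ?_
      split_ifs with hb
      · exact (card_fiber_of_isUnit_snd h2 h0 ha hb).trans hR
      · exact (card_fiber_zero h0 hb).trans (by rw [hR]; ring)
    · rw [← hrow]
      refine Finset.sum_congr rfl fun b _ => ?_
      split_ifs with hb
      · exact (card_fiber_of_isUnit_snd h2 h0 ha hb).trans hR
      · exact (card_fiber_of_not_isUnit h2 h0 ha hb ha0).trans (by rw [hR, hn]; ring)
  have hzero : ∀ P Q : ℕ, ∑ a : {x : R // ¬IsUnit x}, (if (a : R) = 0 then P else Q) + Q =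
      P + p * Q := fun P Q => by
    have h00 : ¬IsUnit (0 : R) := not_isUnit_zero
    rw [← Finset.add_sum_erase _ _ (Finset.mem_univ (⟨0, h00⟩ : {x : R // ¬IsUnit x}))]
    rw [Finset.sum_congr rfl (g := fun _ => Q) fun a ha => if_neg fun h =>
      (Finset.mem_erase.1 ha).1 (Subtype.ext h)]
    rw [Finset.sum_const, Finset.card_erase_of_mem (Finset.mem_univ _), Finset.card_univ, hn,
      if_pos rfl, smul_eq_mul]
    obtain ⟨k, rfl⟩ : ∃ k, p = k + 1 := ⟨p - 1, by omega⟩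
    rw [Nat.add_sub_cancel]; ring
  have htot : ∑ a, ∑ b, n a b = w * (p ^ 2 * q) + ∑ a : {x : R // ¬IsUnit x},
      (if (a : R) = 0 then w * p ^ 2 + p * p ^ 4 else w * p ^ 2 + p * p ^ 3) := by
    rw [Finset.sum_congr rfl fun a _ => hA a, Finset.sum_ite, Finset.sum_const, smul_eq_mul,
      ← Fintype.card_subtype, hw]
    congr 1
    exact Finset.sum_subtype _ (by simp) _
  have h5 := hzero (w * p ^ 2 + p * p ^ 4) (w * p ^ 2 + p * p ^ 3)
  rw [hsum, htot]
  generalize (∑ a : {x : R // ¬IsUnit x},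
      (if (a : R) = 0 then w * p ^ 2 + p * p ^ 4 else w * p ^ 2 + p * p ^ 3)) = s at h5
  zify at h5 hq' hu ⊢
  have ew : (w : ℤ) = p ^ 2 - p := by linear_combination hu
  have eq : (q : ℤ) = 2 * p ^ 2 - p := by linear_combination hq'
  rw [ew] at h5 ⊢
  rw [eq]
  linear_combination h5

end LocalCount

theorem isUnit_zmod_sq_iff {p : ℕ} (hp : p.Prime) (x : ZMod (p ^ 2)) :
    IsUnit x ↔ ¬p ∣ x.val := by
  have : NeZero (p ^ 2) := ⟨pow_ne_zero _ hp.ne_zero⟩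
  rw [← ZMod.natCast_zmod_val x, ZMod.isUnit_iff_coprime, ZMod.natCast_zmod_val,
    Nat.coprime_pow_right_iff two_pos, Nat.coprime_comm, hp.coprime_iff_not_dvd]

theorem card_disc_eq_zero_zmod {p : ℕ} (hp : p.Prime) (hp2 : p ≠ 2) :
    Nat.card {f : BCF (ZMod (p ^ 2)) // f.disc = 0} + p ^ 4 = 2 * p ^ 6 := by
  classical
  have : NeZero (p ^ 2) := ⟨pow_ne_zero _ hp.ne_zero⟩
  have hu : Fintype.card {x : ZMod (p ^ 2) // IsUnit x} = p ^ 2 - p := by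
    have e : Fintype.card {x : ZMod (p ^ 2) // IsUnit x} = Fintype.card (ZMod (p ^ 2))ˣ :=
      (Fintype.card_congr (Equiv.ofBijective
        (fun u : (ZMod (p ^ 2))ˣ => (⟨u, u.isUnit⟩ : {x : ZMod (p ^ 2) // IsUnit x}))
        ⟨fun u v h => Units.ext (Subtype.ext_iff.1 h), fun x => ⟨x.2.unit, rfl⟩⟩)).symm
    rw [e, ZMod.card_units_eq_totient, Nat.totient_prime_pow hp two_pos, Nat.mul_sub, mul_one]
    ring_nf
  rw [Nat.card_eq_fintype_card]
  refine card_disc_eq_zero ?_ ?_ hp.two_le (ZMod.card _) ?_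
  · have h : IsUnit ((2 : ℕ) : ZMod (p ^ 2)) := by
      rw [ZMod.isUnit_iff_coprime, Nat.coprime_pow_right_iff two_pos]
      exact (Nat.coprime_primes Nat.prime_two hp).2 (Ne.symm hp2)
    exact_mod_cast h
  · intro x y hx hy
    rw [isUnit_zmod_sq_iff hp, not_not] at hx hy
    rw [← ZMod.natCast_zmod_val x, ← ZMod.natCast_zmod_val y, ← Nat.cast_mul,
      ZMod.natCast_eq_zero_iff]
    have h := mul_dvd_mul hx hy
    rwa [← sq] at h
  · rw [Fintype.card_subtype_compl, ZMod.card, hu]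
    have : p ≤ p ^ 2 := Nat.le_self_pow two_ne_zero p
    omega

end BCF

/-! ### Densities of local conditions -/

section Density

theorem Set.ncard_image_eq_ncard_image {α β γ : Type*} {s : Set α} {f : α → β} {g : α → γ}
    (h : ∀ x ∈ s, ∀ y ∈ s, f x = f y ↔ g x = g y) : (f '' s).ncard = (g '' s).ncard := by
  have hx : ∀ b ∈ f '' s, ∃ x ∈ s, f x = b := fun b hb => hb
  choose i hi hfi using hx
  refine Set.ncard_congr (fun b hb => g (i b hb)) (fun b hb => ⟨_, hi b hb, rfl⟩) ?_ ?_
  · intro b c hb hc hbc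
    rw [← hfi b hb, ← hfi c hc]
    exact (h _ (hi b hb) _ (hi c hc)).2 hbc
  · rintro _ ⟨x, hx, rfl⟩
    have hb : f x ∈ f '' s := ⟨x, hx, rfl⟩
    exact ⟨f x, hb, (h _ (hi _ hb) _ hx).1 (hfi _ hb)⟩

variable {A : Type*} {B : ℕ → Type*} {ρ : ∀ m, A → B m}

theorem ncard_image_mul
    (hcrt : ∀ m n, Nat.Coprime m n → ∀ x y, ∃ z, ρ m z = ρ m x ∧ ρ n z = ρ n y)
    (hmul : ∀ m n, Nat.Coprime m n → ∀ x y,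
      ρ (m * n) x = ρ (m * n) y ↔ ρ m x = ρ m y ∧ ρ n x = ρ n y)
    {m n : ℕ} (hmn : m.Coprime n) {P Q : A → Prop}
    (hP : ∀ x y, ρ m x = ρ m y → P x → P y) (hQ : ∀ x y, ρ n x = ρ n y → Q x → Q y) :
    (ρ (m * n) '' {x | P x ∧ Q x}).ncard = (ρ m '' {x | P x}).ncard * (ρ n '' {x | Q x}).ncard := by
  rw [← Set.ncard_prod, Set.ncard_image_eq_ncard_image (g := fun x => (ρ m x, ρ n x))
    fun x _ y _ => by rw [hmul m n hmn, Prod.mk.injEq]]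
  congr 1
  ext ⟨u, v⟩
  constructor
  · rintro ⟨x, ⟨h1, h2⟩, h⟩
    rw [Prod.mk.injEq] at h
    exact ⟨⟨x, h1, h.1⟩, ⟨x, h2, h.2⟩⟩
  · rintro ⟨⟨x, h1, hx⟩, ⟨y, h2, hy⟩⟩
    obtain ⟨z, hz1, hz2⟩ := hcrt m n hmn x y
    exact ⟨z, ⟨hP x z hz1.symm h1, hQ y z hz2.symm h2⟩, by
      rw [Prod.mk.injEq]; exact ⟨hz1.trans hx, hz2.trans hy⟩⟩

theorem ncard_image_prod
    (hcrt : ∀ m n, Nat.Coprime m n → ∀ x y, ∃ z, ρ m z = ρ m x ∧ ρ n z = ρ n y)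
    (hmul : ∀ m n, Nat.Coprime m n → ∀ x y,
      ρ (m * n) x = ρ (m * n) y ↔ ρ m x = ρ m y ∧ ρ n x = ρ n y)
    {m : ℕ} {P : A → Prop} {Q : ℕ → A → Prop} (hP : ∀ x y, ρ m x = ρ m y → P x → P y)
    (hQ : ∀ p x y, ρ (p ^ 2) x = ρ (p ^ 2) y → Q p x → Q p y) (s : Finset ℕ)
    (hs : ∀ p ∈ s, p.Prime ∧ m.Coprime p) :
    (∀ x y, ρ (m * ∏ p ∈ s, p ^ 2) x = ρ (m * ∏ p ∈ s, p ^ 2) y →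
      (P x ∧ ∀ p ∈ s, Q p x) → (P y ∧ ∀ p ∈ s, Q p y)) ∧
    (ρ (m * ∏ p ∈ s, p ^ 2) '' {x | P x ∧ ∀ p ∈ s, Q p x}).ncard =
      (ρ m '' {x | P x}).ncard * ∏ p ∈ s, (ρ (p ^ 2) '' {x | Q p x}).ncard := by
  classical
  induction s using Finset.induction_on with
  | empty =>
    rw [Finset.prod_empty, Finset.prod_empty, mul_one, mul_one]
    simpa using hP
  | insert q s hq ih =>
    obtain ⟨ih1, ih2⟩ := ih fun p hp => hs p (Finset.mem_insert_of_mem hp)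
    obtain ⟨hq1, hq2⟩ := hs q (Finset.mem_insert_self q s)
    have e : m * ∏ p ∈ insert q s, p ^ 2 = (m * ∏ p ∈ s, p ^ 2) * q ^ 2 := by
      rw [Finset.prod_insert hq]; ring
    have hco : (m * ∏ p ∈ s, p ^ 2).Coprime (q ^ 2) := by
      refine Nat.Coprime.pow_right _ (Nat.Coprime.mul_left hq2 (Nat.Coprime.prod_left fun p hp => ?_))
      refine Nat.Coprime.pow_left _ ((Nat.coprime_primes (hs p (Finset.mem_insert_of_mem hp)).1
        hq1).2 ?_)
      rintro rfl; exact hq hp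
    have hset : ∀ x, (P x ∧ ∀ p ∈ insert q s, Q p x) ↔ (P x ∧ ∀ p ∈ s, Q p x) ∧ Q q x := fun x => by
      rw [Finset.forall_mem_insert]; tauto
    simp only [hset]
    rw [e]
    refine ⟨fun x y h hx => ?_, ?_⟩
    · obtain ⟨h1, h2⟩ := (hmul _ _ hco x y).1 h
      exact ⟨ih1 x y h1 hx.1, hQ q x y h2 hx.2⟩
    · rw [ncard_image_mul hcrt hmul hco ih1 (hQ q), ih2, Finset.prod_insert hq]
      ring

end Density

theorem Int.cast_zmod_mul_eq_iff {m n : ℕ} (h : m.Coprime n) (x y : ℤ) :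
    (x : ZMod (m * n)) = y ↔ (x : ZMod m) = y ∧ (x : ZMod n) = y := by
  simp only [ZMod.intCast_eq_intCast_iff_dvd_sub, Nat.cast_mul]
  exact ⟨fun h => ⟨(dvd_mul_right _ _).trans h, (dvd_mul_left _ _).trans h⟩,
    fun h' => (Nat.isCoprime_iff_coprime.2 h).mul_dvd h'.1 h'.2⟩

theorem Int.exists_cast_zmod_eq {m n : ℕ} (h : m.Coprime n) (x y : ℤ) :
    ∃ z : ℤ, (z : ZMod m) = x ∧ (z : ZMod n) = y := by
  obtain ⟨a, b, hab⟩ := Nat.isCoprime_iff_coprime.2 h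
  refine ⟨x * (b * n) + y * (a * m), ?_, ?_⟩
  · rw [ZMod.intCast_eq_intCast_iff_dvd_sub]
    exact ⟨(x - y) * a, by linear_combination (-x) * hab⟩
  · rw [ZMod.intCast_eq_intCast_iff_dvd_sub]
    exact ⟨(y - x) * b, by linear_combination (-y) * hab⟩

/-- The odd primes up to `M`. -/
def oddPrimes (M : ℕ) : Finset ℕ := (Finset.range (M + 1)).filter fun p => p.Prime ∧ p ≠ 2

theorem mem_oddPrimes {M p : ℕ} : p ∈ oddPrimes M ↔ p ≤ M ∧ p.Prime ∧ p ≠ 2 := by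
  rw [oddPrimes, Finset.mem_filter, Finset.mem_range, Nat.lt_succ_iff]

/-- The residue classes modulo `16` of fundamental discriminants. -/
def LocFundTwo (D : ℤ) : Prop :=
  D % 16 = 1 ∨ D % 16 = 5 ∨ D % 16 = 9 ∨ D % 16 = 13 ∨ D % 16 = 8 ∨ D % 16 = 12

instance : DecidablePred LocFundTwo := fun D => by unfold LocFundTwo; infer_instance

theorem locFund_iff {M : ℕ} {D : ℤ} :
    LocFund M D ↔ LocFundTwo D ∧ ∀ p ∈ oddPrimes M, ¬(p : ℤ) ^ 2 ∣ D := by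
  refine and_congr_right fun _ => ⟨fun h p hp => ?_, fun h p h1 h2 h3 => ?_⟩
  · obtain ⟨h3, h1, h2⟩ := mem_oddPrimes.1 hp
    exact h p h1 h2 h3
  · exact h p (mem_oddPrimes.2 ⟨h3, h1, h2⟩)

theorem coprime_two_pow_of_mem_oddPrimes {M p k : ℕ} (hp : p ∈ oddPrimes M) : (2 ^ k).Coprime p := by
  obtain ⟨-, h1, h2⟩ := mem_oddPrimes.1 hp
  exact Nat.Coprime.pow_left _ ((Nat.coprime_primes Nat.prime_two h1).2 h2.symm)

theorem sq_dvd_iff_cast_eq_zero {p : ℕ} {D : ℤ} : (p : ℤ) ^ 2 ∣ D ↔ (D : ZMod (p ^ 2)) = 0 := by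
  rw [ZMod.intCast_zmod_eq_zero_iff_dvd]; push_cast; rfl

/-- The modulus determining `LocFund M`. -/
def locMod (k M : ℕ) : ℕ := 2 ^ k * ∏ p ∈ oddPrimes M, p ^ 2

theorem locMod_pos (k M : ℕ) : 0 < locMod k M :=
  Nat.mul_pos (by positivity) (Finset.prod_pos fun p hp => pow_pos (mem_oddPrimes.1 hp).2.1.pos 2)

theorem locFund_int (M : ℕ) :
    (∀ x y : ℤ, (x : ZMod (locMod 4 M)) = y → LocFund M x → LocFund M y) ∧
    ((fun x : ℤ => (x : ZMod (locMod 4 M))) '' {x | LocFund M x}).ncard =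
      6 * ∏ p ∈ oddPrimes M, (p ^ 2 - 1) := by
  have h := ncard_image_prod (ρ := fun m (x : ℤ) => (x : ZMod m))
    (fun m n h x y => Int.exists_cast_zmod_eq h x y)
    (fun m n h x y => Int.cast_zmod_mul_eq_iff h x y) (m := 2 ^ 4) (P := LocFundTwo)
    (Q := fun p x => ¬(p : ℤ) ^ 2 ∣ x) ?_ ?_ (oddPrimes M)
    (fun p hp => ⟨(mem_oddPrimes.1 hp).2.1, coprime_two_pow_of_mem_oddPrimes hp⟩)
  · simp only [← locFund_iff] at h
    refine ⟨h.1, h.2.trans ?_⟩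
    congr 1
    · have e : (fun x : ℤ => (x : ZMod (2 ^ 4))) '' {x | LocFundTwo x} =
          ({1, 5, 9, 13, 8, 12} : Finset (ZMod (2 ^ 4))) := by
        ext u
        constructor
        · rintro ⟨x, hx, rfl⟩
          have hx16 : (x : ZMod (2 ^ 4)) = ((x % 16 : ℤ) : ZMod (2 ^ 4)) := by
            rw [ZMod.intCast_eq_intCast_iff_dvd_sub]; push_cast; omega
          simp only [hx16]
          rcases hx with hx | hx | hx | hx | hx | hx <;> rw [hx] <;> decide
        · intro hu
          simp only [Finset.coe_insert, Finset.coe_singleton, Set.mem_insert_iff,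
            Set.mem_singleton_iff] at hu
          rcases hu with rfl | rfl | rfl | rfl | rfl | rfl
          exacts [⟨1, by decide, by decide⟩, ⟨5, by decide, by decide⟩, ⟨9, by decide, by decide⟩,
            ⟨13, by decide, by decide⟩, ⟨8, by decide, by decide⟩, ⟨12, by decide, by decide⟩]
      rw [e, Set.ncard_coe_finset]
      decide
    · refine Finset.prod_congr rfl fun p hp => ?_
      have hp' := (mem_oddPrimes.1 hp).2.1
      have : NeZero (p ^ 2) := ⟨pow_ne_zero _ hp'.ne_zero⟩
      have e : (fun x : ℤ => (x : ZMod (p ^ 2))) '' {x | ¬(p : ℤ) ^ 2 ∣ x} = {0}ᶜ := by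
        ext u
        constructor
        · rintro ⟨x, hx, rfl⟩
          exact fun h => hx (sq_dvd_iff_cast_eq_zero.2 h)
        · intro hu
          obtain ⟨x, rfl⟩ := ZMod.intCast_surjective u
          exact ⟨x, fun h => hu (sq_dvd_iff_cast_eq_zero.1 h), rfl⟩
      have h1 := Set.ncard_add_ncard_compl ({0} : Set (ZMod (p ^ 2)))
      rw [Set.ncard_singleton, Nat.card_zmod, ← e] at h1
      omega
  · intro x y hxy
    simp only [ZMod.intCast_eq_intCast_iff_dvd_sub] at hxy
    push_cast at hxy
    unfold LocFundTwo
    omega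
  · intro p x y hxy hx
    rw [sq_dvd_iff_cast_eq_zero] at hx ⊢
    rwa [← hxy]

namespace BCF

theorem red_eq_red_iff {m : ℕ} {f g : BCF ℤ} : f.red m = g.red m ↔
    ((f.1.1 : ZMod m) = g.1.1 ∧ (f.1.2 : ZMod m) = g.1.2) ∧
      (f.2.1 : ZMod m) = g.2.1 ∧ (f.2.2 : ZMod m) = g.2.2 := by
  simp only [red, map, Prod.mk.injEq, eq_intCast]

theorem red_surjective (m : ℕ) : Function.Surjective (red m) := by
  rintro ⟨⟨a, b⟩, c, d⟩
  obtain ⟨a, rfl⟩ := ZMod.intCast_surjective a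
  obtain ⟨b, rfl⟩ := ZMod.intCast_surjective b
  obtain ⟨c, rfl⟩ := ZMod.intCast_surjective c
  obtain ⟨d, rfl⟩ := ZMod.intCast_surjective d
  exact ⟨((a, b), (c, d)), rfl⟩

theorem disc_red (m : ℕ) (f : BCF ℤ) : (f.red m).disc = (f.disc : ZMod m) := by
  rw [red, disc_map, eq_intCast]

theorem locFundTwo_of_red_eq {f g : BCF ℤ} (h : f.red 4 = g.red 4) (hf : LocFundTwo f.disc) :
    LocFundTwo g.disc := by
  simp only [red_eq_red_iff, ZMod.intCast_eq_intCast_iff_dvd_sub] at h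
  obtain ⟨⟨⟨a, ha⟩, ⟨b, hb⟩⟩, ⟨c, hc⟩, ⟨d, hd⟩⟩ := h
  obtain ⟨t, ht⟩ : ∃ t, g.hB = f.hB + 4 * t :=
    ⟨g.1.2 * c + b * f.2.1 - g.1.1 * d - a * f.2.2, by
      simp only [hB]; linear_combination g.1.2 * hc + f.2.1 * hb - g.1.1 * hd - f.2.2 * ha⟩
  obtain ⟨t₁, ht₁⟩ : ∃ t, g.hA = f.hA + 4 * t :=
    ⟨(g.1.2 + f.1.2) * b - g.1.1 * c - a * f.2.1, by
      simp only [hA]; linear_combination (g.1.2 + f.1.2) * hb - g.1.1 * hc - f.2.1 * ha⟩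
  obtain ⟨t₂, ht₂⟩ : ∃ t, g.hC = f.hC + 4 * t :=
    ⟨(g.2.1 + f.2.1) * c - g.1.2 * d - b * f.2.2, by
      simp only [hC]; linear_combination (g.2.1 + f.2.1) * hc - g.1.2 * hd - f.2.2 * hb⟩
  have e : g.disc = f.disc + 8 * (f.hB * t) +
      16 * (t ^ 2 - f.hA * t₂ - t₁ * f.hC - 4 * (t₁ * t₂)) := by
    rw [disc_eq, disc_eq, ht, ht₁, ht₂]; ring
  generalize t ^ 2 - f.hA * t₂ - t₁ * f.hC - 4 * (t₁ * t₂) = w at e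
  unfold LocFundTwo at *
  rcases Int.even_or_odd' f.hB with ⟨r, hr | hr⟩
  · have : f.hB * t = 2 * (r * t) := by rw [hr]; ring
    omega
  · have : f.disc = 4 * (r ^ 2 + r - f.hA * f.hC) + 1 := by rw [disc_eq, hr]; ring
    omega

/-- The integral form with given coefficients in `{0, …, 3}`. -/
def ofFin (u : (Fin 4 × Fin 4) × (Fin 4 × Fin 4)) : BCF ℤ :=
  ((((u.1.1 : ℕ) : ℤ), ((u.1.2 : ℕ) : ℤ)), (((u.2.1 : ℕ) : ℤ), ((u.2.2 : ℕ) : ℤ)))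

theorem card_locFundTwo :
    (Finset.univ.filter fun u => LocFundTwo (ofFin u).disc).card = 144 := by
  decide +kernel

theorem exists_fin_cast_eq (x : ℤ) : ∃ i : Fin 4, (((i : ℕ) : ℤ) : ZMod 4) = x := by
  refine ⟨⟨(x % 4).toNat, by omega⟩, ?_⟩
  rw [ZMod.intCast_eq_intCast_iff_dvd_sub]
  push_cast
  omega

theorem fin_eq_of_cast_eq {i j : Fin 4} (h : (((i : ℕ) : ℤ) : ZMod 4) = ((j : ℕ) : ℤ)) : i = j := by
  rw [ZMod.intCast_eq_intCast_iff_dvd_sub] at h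
  push_cast at h
  omega

theorem ncard_red_locFundTwo : (red 4 '' {f | LocFundTwo f.disc}).ncard = 144 := by
  have hinj : Function.Injective fun u => red 4 (ofFin u) := fun u v h => by
    obtain ⟨⟨h1, h2⟩, h3, h4⟩ := red_eq_red_iff.1 h
    exact Prod.ext (Prod.ext (fin_eq_of_cast_eq h1) (fin_eq_of_cast_eq h2))
      (Prod.ext (fin_eq_of_cast_eq h3) (fin_eq_of_cast_eq h4))
  rw [← card_locFundTwo, ← Set.ncard_coe_finset, ← Set.ncard_image_of_injective _ hinj]
  simp only [Finset.coe_filter, Finset.mem_univ, true_and]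
  congr 1
  ext v
  constructor
  · rintro ⟨f, hf, rfl⟩
    obtain ⟨a, ha⟩ := exists_fin_cast_eq f.1.1
    obtain ⟨b, hb⟩ := exists_fin_cast_eq f.1.2
    obtain ⟨c, hc⟩ := exists_fin_cast_eq f.2.1
    obtain ⟨d, hd⟩ := exists_fin_cast_eq f.2.2
    have e : red 4 (ofFin ((a, b), (c, d))) = red 4 f := red_eq_red_iff.2 ⟨⟨ha, hb⟩, hc, hd⟩
    exact ⟨((a, b), (c, d)), locFundTwo_of_red_eq e.symm hf, e⟩
  · rintro ⟨u, hu, rfl⟩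
    exact ⟨ofFin u, hu, rfl⟩

theorem locFund_bcf (M : ℕ) :
    (∀ f g : BCF ℤ, f.red (locMod 2 M) = g.red (locMod 2 M) → LocFund M f.disc →
      LocFund M g.disc) ∧
    (red (locMod 2 M) '' {f | LocFund M f.disc}).ncard =
      144 * ∏ p ∈ oddPrimes M, p ^ 4 * (p ^ 2 - 1) ^ 2 := by
  have h := ncard_image_prod (ρ := red)
    (fun m n h f g => ?_) (fun m n h f g => ?_) (m := 2 ^ 2) (P := fun f => LocFundTwo f.disc)
    (Q := fun p f => ¬(p : ℤ) ^ 2 ∣ f.disc) (fun f g => locFundTwo_of_red_eq) ?_ (oddPrimes M)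
    (fun p hp => ⟨(mem_oddPrimes.1 hp).2.1, coprime_two_pow_of_mem_oddPrimes hp⟩)
  · simp only [← locFund_iff] at h
    refine ⟨h.1, h.2.trans ?_⟩
    congr 1
    · exact ncard_red_locFundTwo
    · refine Finset.prod_congr rfl fun p hp => ?_
      obtain ⟨-, hp1, hp2⟩ := mem_oddPrimes.1 hp
      have : NeZero (p ^ 2) := ⟨pow_ne_zero _ hp1.ne_zero⟩
      have e : red (p ^ 2) '' {f | ¬(p : ℤ) ^ 2 ∣ f.disc} = {u | u.disc = 0}ᶜ := by
        ext u
        obtain ⟨f, rfl⟩ := red_surjective _ u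
        rw [Set.mem_compl_iff, Set.mem_ofPred_eq, disc_red, ← sq_dvd_iff_cast_eq_zero]
        constructor
        · rintro ⟨g, hg, hgf⟩
          rwa [sq_dvd_iff_cast_eq_zero, ← disc_red, ← hgf, disc_red, ← sq_dvd_iff_cast_eq_zero]
        · exact fun h => ⟨f, h, rfl⟩
      have h1 := Set.ncard_add_ncard_compl {u : BCF (ZMod (p ^ 2)) | u.disc = 0}
      have h2 := card_disc_eq_zero_zmod hp1 hp2
      have h3 : Nat.card (BCF (ZMod (p ^ 2))) = p ^ 8 := by
        simp only [BCF, Nat.card_prod, Nat.card_zmod]; ring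
      rw [← e, h3] at h1
      change Set.ncard {u : BCF (ZMod (p ^ 2)) | u.disc = 0} + _ = _ at h2
      generalize (red (p ^ 2) '' {f | ¬(p : ℤ) ^ 2 ∣ f.disc}).ncard = N at h1 ⊢
      obtain ⟨k, hk⟩ : ∃ k, p ^ 2 = k + 1 := ⟨p ^ 2 - 1, (Nat.succ_pred (NeZero.ne _)).symm⟩
      have e4 : p ^ 4 = (k + 1) ^ 2 := by rw [← hk]; ring
      have e6 : p ^ 6 = (k + 1) ^ 3 := by rw [← hk]; ring
      have e8 : p ^ 8 = (k + 1) ^ 4 := by rw [← hk]; ring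
      rw [e4, e6] at h2
      rw [e8] at h1
      rw [e4, hk, Nat.add_sub_cancel]
      zify at h1 h2 ⊢
      linear_combination h1 - h2
  · simp only [red_eq_red_iff]
    obtain ⟨a, ha1, ha2⟩ := Int.exists_cast_zmod_eq h f.1.1 g.1.1
    obtain ⟨b, hb1, hb2⟩ := Int.exists_cast_zmod_eq h f.1.2 g.1.2
    obtain ⟨c, hc1, hc2⟩ := Int.exists_cast_zmod_eq h f.2.1 g.2.1
    obtain ⟨d, hd1, hd2⟩ := Int.exists_cast_zmod_eq h f.2.2 g.2.2
    exact ⟨((a, b), (c, d)), ⟨⟨ha1, hb1⟩, hc1, hd1⟩, ⟨ha2, hb2⟩, hc2, hd2⟩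
  · simp only [red_eq_red_iff, Int.cast_zmod_mul_eq_iff h]
    tauto
  · intro p f g hfg hf
    rw [sq_dvd_iff_cast_eq_zero, ← disc_red] at hf ⊢
    rwa [← hfg]

end BCF

/-! ### Counting fundamental discriminants -/

theorem tendsto_prod_oddPrimes :
    Tendsto (fun M => ∏ p ∈ oddPrimes M, (1 - ((p : ℝ) ^ 2)⁻¹)) atTop (nhds (8 / Real.pi ^ 2)) := by
  have h := riemannZeta_eulerProduct (s := 2) (by norm_num)
  rw [riemannZeta_two] at h
  have h1 : Tendsto (fun n : ℕ => ∏ p ∈ Nat.primesBelow n, (1 - ((p : ℝ) ^ 2)⁻¹)⁻¹) atTop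
      (nhds (Real.pi ^ 2 / 6)) := by
    have h2 := (Complex.continuous_re.tendsto _).comp h
    have e : ((Real.pi : ℂ) ^ 2 / 6).re = Real.pi ^ 2 / 6 := by
      rw [show (Real.pi : ℂ) ^ 2 / 6 = ((Real.pi ^ 2 / 6 : ℝ) : ℂ) by push_cast; rfl,
        Complex.ofReal_re]
    rw [e] at h2
    refine h2.congr fun n => ?_
    rw [Function.comp_apply, ← Complex.ofReal_re (∏ p ∈ Nat.primesBelow n, _)]
    congr 1
    push_cast
    refine Finset.prod_congr rfl fun p _ => ?_
    rw [Complex.cpow_neg, Complex.cpow_ofNat]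
  have h2 := (h1.inv₀ (by positivity)).comp (tendsto_add_atTop_nat 1)
  have h3 := h2.const_mul (4 / 3)
  rw [show 8 / Real.pi ^ 2 = 4 / 3 * (Real.pi ^ 2 / 6)⁻¹ by field_simp; norm_num]
  refine h3.congr' ?_
  filter_upwards [eventually_ge_atTop 2] with M hM
  have e : Nat.primesBelow (M + 1) = insert 2 (oddPrimes M) := by
    ext p
    rw [Nat.mem_primesBelow, Finset.mem_insert, mem_oddPrimes]
    constructor
    · rintro ⟨h1, h2⟩
      by_cases h : p = 2
      · exact Or.inl h
      · exact Or.inr ⟨by omega, h2, h⟩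
    · rintro (rfl | ⟨h1, h2, -⟩)
      · exact ⟨by omega, Nat.prime_two⟩
      · exact ⟨by omega, h2⟩
  rw [Function.comp_apply, e, Finset.prod_insert fun h => (mem_oddPrimes.1 h).2.2 rfl,
    Finset.prod_inv_distrib, mul_inv, inv_inv, inv_inv]
  norm_num
  rw [← mul_assoc]
  norm_num

theorem cast_locMod (k M : ℕ) : (locMod k M : ℝ) = 2 ^ k * ∏ p ∈ oddPrimes M, (p : ℝ) ^ 2 := by
  rw [locMod]; push_cast; rfl

theorem prod_sq_sub_one (M : ℕ) : ((∏ p ∈ oddPrimes M, (p ^ 2 - 1) : ℕ) : ℝ) =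
    (∏ p ∈ oddPrimes M, (p : ℝ) ^ 2) * ∏ p ∈ oddPrimes M, (1 - ((p : ℝ) ^ 2)⁻¹) := by
  rw [← Finset.prod_mul_distrib]
  push_cast
  refine Finset.prod_congr rfl fun p hp => ?_
  have hp0 : 0 < p := (mem_oddPrimes.1 hp).2.1.pos
  rw [Nat.cast_sub (Nat.one_le_pow _ _ hp0)]
  have : (p : ℝ) ≠ 0 := by positivity
  push_cast
  field_simp

theorem prod_odd_sq_pos (M : ℕ) : (0 : ℝ) < ∏ p ∈ oddPrimes M, (p : ℝ) ^ 2 :=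
  Finset.prod_pos fun p hp => by
    have : 0 < p := (mem_oddPrimes.1 hp).2.1.pos
    positivity

namespace BCF

theorem tendsto_ncard_fundCls_div {σ : ℝ} (hσ : Adm σ) :
    Tendsto (fun X => ((fundCls σ X).ncard : ℝ) / X) atTop (nhds (3 / (|σ| * Real.pi ^ 2))) := by
  classical
  have hne : ∀ M, NeZero (locMod 2 M) := fun M => ⟨(locMod_pos 2 M).ne'⟩
  have hfin : ∀ M, (red (locMod 2 M) '' {f | LocFund M f.disc}).Finite := fun M => Set.toFinite _
  have hδ : Tendsto (fun M => ((hfin M).toFinset.card : ℝ) / (locMod 2 M : ℝ) ^ 4) atTop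
      (nhds (36 / Real.pi ^ 4)) := by
    have h := (tendsto_prod_oddPrimes.pow 2).const_mul (9 / 16)
    rw [show 9 / 16 * (8 / Real.pi ^ 2) ^ 2 = 36 / Real.pi ^ 4 by field_simp; norm_num] at h
    refine h.congr fun M => ?_
    rw [← Set.ncard_eq_toFinset_card _ (hfin M), (locFund_bcf M).2, cast_locMod]
    have e : ((144 * ∏ p ∈ oddPrimes M, p ^ 4 * (p ^ 2 - 1) ^ 2 : ℕ) : ℝ) =
        144 * (∏ p ∈ oddPrimes M, (p : ℝ) ^ 2) ^ 2 *
          ((∏ p ∈ oddPrimes M, (p ^ 2 - 1) : ℕ) : ℝ) ^ 2 := by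
      rw [Finset.prod_mul_distrib, Finset.prod_pow]
      push_cast
      rw [mul_assoc]
      congr 2
      · rw [Finset.prod_pow]
        ring
      · exact Finset.prod_pow _ _ _
    rw [e, prod_sq_sub_one]
    have := prod_odd_sq_pos M
    field_simp
    ring
  have h := tendsto_ncard_fundCls hσ (locMod_pos 2) (fun M => (hfin M).toFinset)
    (fun M f => by
      rw [Set.Finite.mem_toFinset]
      exact ⟨fun ⟨g, hg, h⟩ => (locFund_bcf M).1 g f h hg, fun h => ⟨f, h, rfl⟩⟩) hδ
  refine (congrArg (fun y => Tendsto _ _ (nhds y)) ?_).mp h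
  have := abs_pos.2 hσ.ne_zero
  rw [vol]
  field_simp
  norm_num

end BCF

section Count

theorem Nat.count_mul_of_periodic {P : ℕ → Prop} [DecidablePred P] {m : ℕ}
    (hP : Function.Periodic P m) (q : ℕ) : Nat.count P (m * q) = q * Nat.count P m := by
  induction q with
  | zero => simp
  | succ q ih =>
    rw [Nat.mul_succ, Nat.count_add, ih, Nat.succ_mul]
    congr 1
    have : (fun k => P (m * q + k)) = P := by
      ext k
      rw [add_comm, mul_comm]
      exact iff_of_eq (hP.nat_mul q k)
    simp only [this]

theorem tendsto_count_div_of_periodic {P : ℕ → Prop} [DecidablePred P] {m : ℕ} (hm : 0 < m)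
    (hP : Function.Periodic P m) :
    Tendsto (fun N => (Nat.count P N : ℝ) / N) atTop (nhds ((Nat.count P m : ℝ) / m)) := by
  have hm0 : (0 : ℝ) < m := by exact_mod_cast hm
  have hb : ∀ N : ℕ, 0 < N →
      |(Nat.count P N : ℝ) / N - (Nat.count P m : ℝ) / m| ≤ (m : ℝ) / N := fun N hN => by
    have h1 : Nat.count P N =
        N / m * Nat.count P m + Nat.count (fun k => P (m * (N / m) + k)) (N % m) := by
      rw [← Nat.count_mul_of_periodic hP, ← Nat.count_add, Nat.div_add_mod]
    have h2 : Nat.count (fun k => P (m * (N / m) + k)) (N % m) ≤ m :=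
      (Nat.count_le _).trans (Nat.mod_lt N hm).le
    have h3 : N = m * (N / m) + N % m := (Nat.div_add_mod N m).symm
    have h4 : Nat.count P m ≤ m := Nat.count_le _
    have h5 := (Nat.mod_lt N hm).le
    have hN0 : (0 : ℝ) < N := by exact_mod_cast hN
    rw [div_sub_div _ _ hN0.ne' hm0.ne', abs_div, abs_of_pos (mul_pos hN0 hm0),
      div_le_div_iff₀ (mul_pos hN0 hm0) hN0]
    generalize Nat.count (fun k => P (m * (N / m) + k)) (N % m) = c at h1 h2
    generalize Nat.count P N = a at h1 ⊢
    generalize Nat.count P m = C at h1 h4 ⊢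
    generalize N / m = q at h1 h3
    generalize N % m = t at h3 h5
    have e : (a : ℝ) * m - N * C = c * m - t * C := by
      rw [h1]
      nth_rewrite 1 [h3]
      push_cast
      ring
    have h2' : (c : ℝ) ≤ m := by exact_mod_cast h2
    have h4' : (C : ℝ) ≤ m := by exact_mod_cast h4
    have h5' : (t : ℝ) ≤ m := by exact_mod_cast h5
    have hc := c.cast_nonneg (α := ℝ)
    have hC := C.cast_nonneg (α := ℝ)
    have ht := t.cast_nonneg (α := ℝ)
    rw [e, ← mul_assoc, mul_right_comm]
    refine mul_le_mul_of_nonneg_right (abs_le.2 ⟨?_, ?_⟩) hN0.le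
    · nlinarith [mul_le_mul h5' h4' hC hm0.le]
    · nlinarith [mul_nonneg ht hC]
  rw [tendsto_iff_norm_sub_tendsto_zero]
  refine squeeze_zero' (Eventually.of_forall fun _ => norm_nonneg _) ?_
    (tendsto_const_div_atTop_nhds_zero_nat (m : ℝ))
  filter_upwards [eventually_gt_atTop 0] with N hN
  exact hb N hN

theorem tendsto_of_approx {f : ℕ → ℝ} {g : ℕ → ℕ → ℝ} {c : ℕ → ℝ} {l : ℝ}
    (hg : ∀ M, Tendsto (g M) atTop (nhds (c M))) (hc : Tendsto c atTop (nhds l))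
    (h : ∀ M N : ℕ, 0 < M → 0 < N → |f N - g M N| ≤ (N : ℝ)⁻¹ + (M : ℝ)⁻¹) :
    Tendsto f atTop (nhds l) := by
  rw [Metric.tendsto_atTop]
  intro ε hε
  have h1 := Metric.tendsto_atTop.1 hc (ε / 4) (by positivity)
  have h2 := Metric.tendsto_atTop.1 (tendsto_inv_atTop_nhds_zero_nat (𝕜 := ℝ)) (ε / 4) (by positivity)
  obtain ⟨M₁, h1⟩ := h1
  obtain ⟨M₂, h2⟩ := h2
  set M := M₁ + M₂ + 1
  obtain ⟨N₁, h3⟩ := Metric.tendsto_atTop.1 (hg M) (ε / 4) (by positivity)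
  refine ⟨N₁ + M₂ + 1, fun N hN => ?_⟩
  have i1 := h1 M (by omega)
  have i2 := h2 M (by omega)
  have i3 := h3 N (by omega)
  have i4 := h2 N (by omega)
  have i5 := h M N (by omega) (by omega)
  rw [Real.dist_eq] at *
  rw [sub_zero] at i2 i4
  rw [abs_lt] at *
  rw [abs_le] at i5
  constructor <;> linarith [i1.1, i1.2, i2.1, i2.2, i3.1, i3.2, i4.1, i4.2, i5.1, i5.2]

theorem periodic_locFund {s : ℤ} (M : ℕ) :
    Function.Periodic (fun n : ℕ => LocFund M (s * n)) (locMod 4 M) := fun n => by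
  refine propext ⟨(locFund_int M).1 _ _ ?_, (locFund_int M).1 _ _ ?_⟩ <;> simp

open Classical in
theorem count_locFund {s : ℤ} (hs : s = 1 ∨ s = -1) (M : ℕ) :
    Nat.count (fun n : ℕ => LocFund M (s * n)) (locMod 4 M) =
      6 * ∏ p ∈ oddPrimes M, (p ^ 2 - 1) := by
  have hm : NeZero (locMod 4 M) := ⟨(locMod_pos 4 M).ne'⟩
  have hs2 : s * s = 1 := by rcases hs with rfl | rfl <;> norm_num
  have hs3 : (s : ZMod (locMod 4 M)) * s = 1 := by
    rw [← Int.cast_mul, hs2, Int.cast_one]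
  rw [← (locFund_int M).2, Nat.count_eq_card_filter_range, ← Set.ncard_coe_finset]
  refine Set.ncard_congr (fun n _ => ((s * n : ℤ) : ZMod (locMod 4 M))) (fun n hn => ?_) ?_ ?_
  · exact ⟨s * n, (Finset.mem_filter.1 hn).2, rfl⟩
  · intro a b ha hb hab
    have ha' := Finset.mem_range.1 (Finset.mem_filter.1 ha).1
    have hb' := Finset.mem_range.1 (Finset.mem_filter.1 hb).1
    push_cast at hab
    have h := congrArg ((s : ZMod (locMod 4 M)) * ·) hab
    simp only [← mul_assoc, hs3, one_mul] at h
    rw [ZMod.natCast_eq_natCast_iff'] at h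
    rwa [Nat.mod_eq_of_lt ha', Nat.mod_eq_of_lt hb'] at h
  · rintro _ ⟨x, hx, rfl⟩
    have e : ((s * ((((s * x : ℤ) : ZMod (locMod 4 M)).val : ℕ) : ℤ) : ℤ) : ZMod (locMod 4 M)) = x := by
      push_cast
      rw [ZMod.natCast_zmod_val, ← mul_assoc, hs3, one_mul]
    refine ⟨((s * x : ℤ) : ZMod (locMod 4 M)).val, Finset.mem_filter.2 ⟨Finset.mem_range.2 (ZMod.val_lt _), ?_⟩, e⟩
    exact (locFund_int M).1 _ _ e.symm hx

open Classical in
theorem tendsto_count_fund {s : ℤ} (hs : s = 1 ∨ s = -1) :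
    Tendsto (fun N => (Nat.count (fun n : ℕ => IsFundamentalDiscriminant (s * n)) N : ℝ) / N) atTop
      (nhds (3 / Real.pi ^ 2)) := by
  refine tendsto_of_approx (fun M => tendsto_count_div_of_periodic (locMod_pos 4 M)
    (periodic_locFund (s := s) M)) ?_ fun M N hM hN => ?_
  · have h := tendsto_prod_oddPrimes.const_mul (3 / 8)
    rw [show 3 / 8 * (8 / Real.pi ^ 2) = 3 / Real.pi ^ 2 by field_simp] at h
    refine h.congr fun M => ?_
    rw [count_locFund hs, Nat.cast_mul, prod_sq_sub_one, cast_locMod]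
    have := prod_odd_sq_pos M
    field_simp
    ring
  · have hN0 : (0 : ℝ) < N := by exact_mod_cast hN
    have h1 : Nat.count (fun n : ℕ => IsFundamentalDiscriminant (s * n)) N ≤
        Nat.count (fun n : ℕ => LocFund M (s * n)) N :=
      Nat.count_mono_left fun n _ hn => (isFundamentalDiscriminant_iff.1 hn).2 M
    have h2 : (Nat.count (fun n : ℕ => LocFund M (s * n)) N : ℝ) ≤
        Nat.count (fun n : ℕ => IsFundamentalDiscriminant (s * n)) N + 1 + N / M := by
      rw [Nat.count_eq_card_filter_range, Nat.count_eq_card_filter_range]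
      have hsub : (Finset.range N).filter (fun n : ℕ => LocFund M (s * n)) ⊆
          ((Finset.range N).filter (fun n : ℕ => IsFundamentalDiscriminant (s * n)) ∪ {1}) ∪
          (Finset.Ioc M N).biUnion fun p => (Finset.Ioc 0 N).filter fun n => p ^ 2 ∣ n := by
        intro n hn
        rw [Finset.mem_filter, Finset.mem_range] at hn
        by_cases hf : IsFundamentalDiscriminant (s * n)
        · exact Finset.mem_union_left _ (Finset.mem_union_left _
            (Finset.mem_filter.2 ⟨Finset.mem_range.2 hn.1, hf⟩))
        by_cases h1 : s * n = 1
        · refine Finset.mem_union_left _ (Finset.mem_union_right _ (Finset.mem_singleton.2 ?_))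
          rcases hs with rfl | rfl <;> omega
        obtain ⟨p, hp, hMp, hd⟩ := exists_prime_of_locFund hn.2 h1 hf
        have hd' : p ^ 2 ∣ n := by
          have h3 : (p : ℤ) ^ 2 ∣ n := by
            rcases hs with rfl | rfl
            · simpa using hd
            · simpa using hd
          exact_mod_cast h3
        have hn0 : 0 < n := by
          rcases n.eq_zero_or_pos with rfl | h0
          · have := hn.2.1
            simp at this
          · exact h0
        have hpn : p ≤ n := (Nat.le_self_pow two_ne_zero p).trans (Nat.le_of_dvd hn0 hd')
        refine Finset.mem_union_right _ (Finset.mem_biUnion.2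
          ⟨p, Finset.mem_Ioc.2 ⟨hMp, by omega⟩, Finset.mem_filter.2
            ⟨Finset.mem_Ioc.2 ⟨hn0, hn.1.le⟩, hd'⟩⟩)
      have h3 : (((Finset.Ioc M N).biUnion fun p =>
          (Finset.Ioc 0 N).filter fun n => p ^ 2 ∣ n).card : ℝ) ≤ N / M := by
        refine (Nat.cast_le.2 Finset.card_biUnion_le).trans ?_
        push_cast
        refine (Finset.sum_le_sum (g := fun p : ℕ => (N : ℝ) * ((p : ℝ) ^ 2)⁻¹) fun p _ => ?_).trans ?_
        · rw [Nat.Ioc_filter_dvd_card_eq_div]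
          refine Nat.cast_div_le.trans (le_of_eq ?_)
          push_cast
          rw [div_eq_mul_inv]
        · rw [← Finset.mul_sum, div_eq_mul_inv]
          exact mul_le_mul_of_nonneg_left (BCF.sum_inv_sq_le hM N) hN0.le
      have h4 := (Finset.card_le_card hsub).trans ((Finset.card_union_le _ _).trans
        (Nat.add_le_add_right (Finset.card_union_le _ _) _))
      rw [Finset.card_singleton] at h4
      have h5 : (((Finset.range N).filter fun n : ℕ => LocFund M (s * n)).card : ℝ) ≤ _ :=
        Nat.cast_le.2 h4
      push_cast at h5
      linarith
    rw [← sub_div, abs_div, abs_of_pos hN0, div_le_iff₀ hN0, add_mul, inv_mul_cancel₀ hN0.ne',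
      abs_sub_comm, abs_of_nonneg (sub_nonneg.2 (by exact_mod_cast h1)), inv_mul_eq_div]
    linarith

end Count

/-! ### The averages -/

/-- The fundamental discriminants of sign `s` and absolute value less than `X`. -/
def fundDisc (s : ℤ) (X : ℝ) : Set ℤ :=
  {d | (IsFundamentalDiscriminant d ∧ 0 < s * d) ∧ |(d : ℝ)| < X}

theorem finite_fundDisc (s : ℤ) (X : ℝ) : (fundDisc s X).Finite := by
  refine (Set.finite_Icc (-⌈X⌉) ⌈X⌉).subset fun d hd => ?_
  have h1 := abs_lt.1 hd.2
  have h2 := Int.le_ceil X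
  constructor
  · have : ((-⌈X⌉ : ℤ) : ℝ) ≤ d := by push_cast; linarith
    exact_mod_cast this
  · have : (d : ℝ) ≤ ⌈X⌉ := by linarith
    exact_mod_cast this

open Classical in
theorem ncard_fundDisc {s : ℤ} (hs : s = 1 ∨ s = -1) (X : ℝ) :
    (fundDisc s X).ncard = Nat.count (fun n : ℕ => IsFundamentalDiscriminant (s * n)) ⌈X⌉₊ := by
  have hs2 : s * s = 1 := by rcases hs with rfl | rfl <;> norm_num
  have habs : ∀ n : ℕ, |((s * n : ℤ) : ℝ)| = n := fun n => by
    rcases hs with rfl | rfl <;> simp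
  rw [Nat.count_eq_card_filter_range, ← Set.ncard_coe_finset]
  symm
  refine Set.ncard_congr (fun n _ => s * (n : ℤ)) (fun n hn => ?_) (fun a b _ _ h => ?_)
    (fun d hd => ?_)
  · rw [Finset.mem_coe, Finset.mem_filter, Finset.mem_range, Nat.lt_ceil] at hn
    refine ⟨⟨hn.2, ?_⟩, ?_⟩
    · rw [← mul_assoc, hs2, one_mul]
      have h0 := hn.2.ne_zero
      rcases n.eq_zero_or_pos with rfl | h
      · simp at h0
      · exact_mod_cast h
    · rw [habs]; exact hn.1
  · have := congrArg (s * ·) h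
    simp only [← mul_assoc, hs2, one_mul] at this
    exact_mod_cast this
  · obtain ⟨⟨h1, h2⟩, h3⟩ := hd
    obtain ⟨n, hn⟩ := Int.eq_ofNat_of_zero_le h2.le
    have e : s * (n : ℤ) = d := by rw [← hn, ← mul_assoc, hs2, one_mul]
    refine ⟨n, ?_, e⟩
    rw [Finset.mem_coe, Finset.mem_filter, Finset.mem_range, Nat.lt_ceil, e]
    exact ⟨by rwa [← e, habs] at h3, h1⟩

theorem tendsto_ncard_fundDisc_div {s : ℤ} (hs : s = 1 ∨ s = -1) :
    Tendsto (fun X => ((fundDisc s X).ncard : ℝ) / X) atTop (nhds (3 / Real.pi ^ 2)) := by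
  classical
  have h := ((tendsto_count_fund hs).comp (tendsto_nat_ceil_atTop (α := ℝ))).mul
    (tendsto_nat_ceil_div_atTop (R := ℝ))
  rw [mul_one] at h
  refine h.congr' ?_
  filter_upwards [eventually_gt_atTop 0] with X hX
  have : (⌈X⌉₊ : ℝ) ≠ 0 := by
    have := Nat.ceil_pos.2 hX
    positivity
  rw [ncard_fundDisc hs, Function.comp_apply]
  field_simp

namespace BCF

theorem fundCls_eq {s : ℤ} {σ : ℝ} (h : ∀ d : ℤ, 0 < σ * (d : ℝ) ↔ 0 < s * d) (X : ℝ) :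
    fundCls σ X = ⋃ d ∈ fundDisc s X, irrCls d := by
  ext c
  simp only [Set.mem_iUnion]
  constructor
  · rintro ⟨f, ⟨⟨h1, h2, h3⟩, h4⟩, rfl⟩
    exact ⟨f.disc, ⟨⟨h4, (h _).1 h2⟩, h3⟩, f, ⟨rfl, h1⟩, rfl⟩
  · rintro ⟨d, ⟨⟨h1, h2⟩, h3⟩, f, ⟨rfl, h4⟩, rfl⟩
    exact ⟨f, ⟨⟨h4, (h _).2 h2, h3⟩, h1⟩, rfl⟩

theorem disjoint_irrCls {d e : ℤ} (h : d ≠ e) : Disjoint (irrCls d) (irrCls e) := by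
  rw [Set.disjoint_left]
  rintro _ ⟨f, ⟨rfl, -⟩, rfl⟩ ⟨g, ⟨rfl, -⟩, hg⟩
  exact h ((cls_eq_iff.1 hg).disc_eq)

theorem ncard_fundCls {s : ℤ} {σ : ℝ} (hσ : Adm σ) (h : ∀ d : ℤ, 0 < σ * (d : ℝ) ↔ 0 < s * d)
    (X : ℝ) : (fundCls σ X).ncard = ∑ d ∈ (finite_fundDisc s X).toFinset, (irrCls d).ncard := by
  classical
  have hfin : (fundCls σ X).Finite := (finite_classes hσ X).subset (fundCls_subset σ X)
  rw [fundCls_eq h] at hfin ⊢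
  have hf : ∀ d ∈ fundDisc s X, (irrCls d).Finite := fun d hd =>
    hfin.subset (Set.subset_biUnion_of_mem hd)
  rw [(finite_fundDisc s X).ncard_biUnion hf fun d _ e _ hde => disjoint_irrCls hde,
    finsum_mem_eq_finite_toFinset_sum _ (finite_fundDisc s X)]

end BCF

theorem hasAverage_of_sign {s : ℤ} {σ : ℝ} {k : ℕ} (hσ : BCF.Adm σ) (hs : s = 1 ∨ s = -1)
    (h : ∀ d : ℤ, 0 < σ * (d : ℝ) ↔ 0 < s * d) (hk : ∀ d : ℤ, 0 < s * d → unitIndex d = k)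
    (hk0 : 0 < k) :
    HasAverage (fun d => IsFundamentalDiscriminant d ∧ 0 < s * d)
      (fun d => (Nat.card {x : ClassGroup (Od d) // x ^ 3 = 1} : ℝ)) ((1 / |σ| + 1) / k) := by
  have hk' : (k : ℝ) ≠ 0 := by positivity
  set T : ℤ → ℝ := fun d => (Nat.card {x : ClassGroup (Od d) // x ^ 3 = 1} : ℝ) with hT
  set E : ℤ → ℝ := fun d => T d * k - ((BCF.irrCls d).ncard + 1) with hE
  have hE0 : ∀ X, ∀ d ∈ fundDisc s X, d ≠ -3 → d ≠ -4 → E d = 0 := fun X d hd h3 h4 => by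
    have h0 := ((isFundamentalDiscriminant_iff.1 hd.1.1).2 0).1
    have h1 := card_class_group_eq hd.1.1 (by omega)
    rw [hk d hd.1.2] at h1
    have h2 : T d * k = (BCF.irrCls d).ncard + 1 := by simp only [hT]; exact_mod_cast h1
    rw [hE]
    linarith
  have hsum : ∀ X, |∑ d ∈ (finite_fundDisc s X).toFinset, E d| ≤ |E (-3)| + |E (-4)| := fun X => by
    have hite : ∀ (F : Finset ℤ) (e : ℤ), ∑ d ∈ F, (if d = e then |E e| else 0) ≤ |E e| :=
      fun F e => by
        rw [Finset.sum_ite_eq']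
        split_ifs
        exacts [le_rfl, abs_nonneg _]
    refine (Finset.abs_sum_le_sum_abs _ _).trans ((Finset.sum_le_sum fun d hd => ?_).trans
      (Finset.sum_add_distrib.trans_le (add_le_add (hite _ (-3)) (hite _ (-4)))))
    by_cases h3 : d = -3
    · subst h3; simp
    by_cases h4 : d = -4
    · subst h4; simp
    rw [hE0 X d ((finite_fundDisc s X).mem_toFinset.1 hd) h3 h4]
    simp [h3, h4]
  have hcard : ∀ X, ∑ d ∈ (finite_fundDisc s X).toFinset, T d =
      ((BCF.fundCls σ X).ncard + (fundDisc s X).ncard +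
        ∑ d ∈ (finite_fundDisc s X).toFinset, E d) / k := fun X => by
    rw [BCF.ncard_fundCls hσ h, Set.ncard_eq_toFinset_card _ (finite_fundDisc s X), eq_div_iff hk',
      Finset.card_eq_sum_ones]
    push_cast
    rw [← Finset.sum_add_distrib, ← Finset.sum_add_distrib, Finset.sum_mul]
    exact Finset.sum_congr rfl fun d _ => by rw [hE]; ring
  have hD := tendsto_ncard_fundDisc_div hs
  have hC := BCF.tendsto_ncard_fundCls_div hσ
  have hErr : Tendsto (fun X => (∑ d ∈ (finite_fundDisc s X).toFinset, E d) / X) atTop (nhds 0) := by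
    rw [tendsto_zero_iff_norm_tendsto_zero]
    refine squeeze_zero' (Eventually.of_forall fun _ => norm_nonneg _) ?_
      ((tendsto_const_nhds (x := |E (-3)| + |E (-4)|)).div_atTop tendsto_id)
    filter_upwards [eventually_gt_atTop 0] with X hX
    rw [norm_div, Real.norm_eq_abs, Real.norm_eq_abs, abs_of_pos hX]
    exact div_le_div_of_nonneg_right (hsum X) hX.le
  have hpi := Real.pi_pos
  have hσ0 := abs_pos.2 hσ.ne_zero
  have hlim := (((hC.add hD).add hErr).div hD (by positivity)).div_const (k : ℝ)
  rw [HasAverage]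
  have e : ((3 / (|σ| * Real.pi ^ 2) + 3 / Real.pi ^ 2 + 0) / (3 / Real.pi ^ 2)) / (k : ℝ) =
      (1 / |σ| + 1) / k := by
    field_simp
    ring
  rw [e] at hlim
  refine hlim.congr' ?_
  filter_upwards [eventually_gt_atTop 0] with X hX
  change _ = (∑ᶠ d ∈ fundDisc s X, T d) / ((fundDisc s X).ncard : ℝ)
  rw [finsum_mem_eq_finite_toFinset_sum _ (finite_fundDisc s X), hcard X]
  simp only [Pi.div_apply]
  field_simp

/-- **Davenport–Heilbronn.**  When ordered by absolute discriminant, the average size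
of `Cl(K)[3]` over imaginary quadratic fields is `2`, and over real quadratic fields
is `4/3`. -/
theorem davenport_heilbronn :
    HasAverage (fun d => IsFundamentalDiscriminant d ∧ d < 0)
      (fun d => (Nat.card {x : ClassGroup (Od d) // x ^ 3 = 1} : ℝ)) 2 ∧
    HasAverage (fun d => IsFundamentalDiscriminant d ∧ 0 < d)
      (fun d => (Nat.card {x : ClassGroup (Od d) // x ^ 3 = 1} : ℝ)) (4 / 3) := by
  constructor
  · have h := hasAverage_of_sign (s := -1) (σ := -1) (k := 1) (Or.inl rfl) (Or.inr rfl)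
      (fun d => by
        rw [show (-1 : ℝ) * d = ((-1 * d : ℤ) : ℝ) by push_cast; ring]
        exact Int.cast_pos)
      (fun d hd => by rw [unitIndex, if_neg (by omega)]) one_pos
    norm_num at h
    exact h
  · have h := hasAverage_of_sign (s := 1) (σ := 1 / 3) (k := 3) (Or.inr rfl) (Or.inl rfl)
      (fun d => by
        rw [one_mul, mul_pos_iff_of_pos_left (by norm_num)]
        exact Int.cast_pos)
      (fun d hd => by rw [unitIndex, if_pos (by omega)]) (by norm_num)
    simp only [one_mul] at h
    rw [show (1 / |(1 / 3 : ℝ)| + 1) / ((3 : ℕ) : ℝ) = 4 / 3 by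
      rw [abs_of_pos (by norm_num)]; norm_num] at h
    exact h
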